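/- Let φ be subharmonic on ℂ with doubling Laplacian. There exists an entire function g such that: (a) the zero sequence Z(g) of g is ρ_φ-separated and sup_{z∈ℂ} d_φ(z, Z(g)) < ∞; (b) |g(z)| ≃ e^{φ(z)} d_φ(z, Z(g)) for all z ∈ ℂ, with comparability constants independent of z. Moreover g can be chosen to vanish at any prescribed point z₀ ∈ ℂ. -/

import Mathlib

open MeasureTheory Metric Filter Set
open scoped ENNReal NNReal Real Topology Classical

noncomputable section

/-- The Laplacian of a function on `ℂ ≅ ℝ²`, computed via the second Fréchet derivative. -/
def lap (v : ℂ → ℝ) (z : ℂ) : ℝ :=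
  iteratedFDeriv ℝ 2 v z ![1, 1] + iteratedFDeriv ℝ 2 v z ![Complex.I, Complex.I]

/-- `μ` is a doubling measure on `ℂ` with doubling constant `C`. -/
def IsDoubling (μ : Measure ℂ) (C : ℝ≥0) : Prop :=
  ∀ z : ℂ, ∀ r : ℝ, 0 < r → μ (ball z (2 * r)) ≤ C * μ (ball z r)

/-- `φ` is a (continuous) subharmonic function whose distributional Laplacian is the
doubling measure `μ` (not identically zero).  The distributional identity is expressed
by testing against smooth compactly supported functions. -/
structure HasDoublingLaplacian (φ : ℂ → ℝ) (μ : Measure ℂ) : Prop where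
  continuous : Continuous φ
  lap_eq : ∀ v : ℂ → ℝ, ContDiff ℝ (⊤ : ℕ∞) v → HasCompactSupport v →
    ∫ z, φ z * lap v z = ∫ z, v z ∂μ
  doubling : ∃ C : ℝ≥0, 0 < C ∧ IsDoubling μ C
  ne_zero : μ ≠ 0

/-- `ρ` assigns to every `z` the positive radius such that the disk `D(z, ρ z)` has
`μ`-mass `1`. -/
def IsRadius (μ : Measure ℂ) (ρ : ℂ → ℝ) : Prop :=
  ∀ z : ℂ, 0 < ρ z ∧ μ (ball z (ρ z)) = 1

/-- The distance induced by the metric `ρ(z)⁻² dz⊗d\bar z`: infimum of lengths of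
`C¹` curves joining the two points. -/
def pathDist (ρ : ℂ → ℝ) (z ζ : ℂ) : ℝ :=
  sInf { L : ℝ | ∃ γ : ℝ → ℂ, γ 0 = z ∧ γ 1 = ζ ∧ ContDiff ℝ 1 γ ∧
    L = ∫ t in (0:ℝ)..1, ‖deriv γ t‖ / ρ (γ t) }

/-- The `pathDist` from a point to a set. -/
def pathDistSet (ρ : ℂ → ℝ) (z : ℂ) (Λ : Set ℂ) : ℝ :=
  ⨅ l : Λ, pathDist ρ z l.1

/-- A flat weight for `φ`: a positive measurable function whose logarithm has slow
growth with respect to the induced distance. -/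
def IsFlatWeight (ρ : ℂ → ℝ) (ω : ℂ → ℝ) : Prop :=
  (∀ z, 0 < ω z) ∧ Measurable ω ∧
  ∃ C : ℝ, 0 < C ∧ ∀ z ζ : ℂ,
    |Real.log (ω z) - Real.log (ω ζ)| ≤ C * (1 + max (Real.log (pathDist ρ z ζ)) 0)

/-- The norm of the space `F^p_{φ,ω}` (with `p = ∞` giving the weighted sup norm). -/
def Fnorm (p : ℝ≥0∞) (φ ω ρ : ℂ → ℝ) (f : ℂ → ℂ) : ℝ≥0∞ :=
  if p = ∞ then ⨆ z : ℂ, ENNReal.ofReal (ω z * ‖f z‖ * Real.exp (-φ z))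
  else (∫⁻ z, ENNReal.ofReal
      (‖f z‖ ^ p.toReal * Real.exp (-(p.toReal * φ z)) * ω z ^ p.toReal / ρ z ^ 2)) ^
      (1 / p.toReal)

/-- Membership in `F^p_{φ,ω}`: entire with finite norm. -/
def MemF (p : ℝ≥0∞) (φ ω ρ : ℂ → ℝ) (f : ℂ → ℂ) : Prop :=
  Differentiable ℂ f ∧ Fnorm p φ ω ρ f < ∞

/-- The norm of the sequence space `ℓ^p_{φ,ω}(Λ)`. -/
def lnorm (p : ℝ≥0∞) (φ ω : ℂ → ℝ) (Λ : Set ℂ) (v : ℂ → ℂ) : ℝ≥0∞ :=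
  if p = ∞ then ⨆ l : Λ, ENNReal.ofReal (ω l.1 * ‖v l.1‖ * Real.exp (-φ l.1))
  else (∑' l : Λ, ENNReal.ofReal
      (ω l.1 ^ p.toReal * ‖v l.1‖ ^ p.toReal * Real.exp (-(p.toReal * φ l.1)))) ^
      (1 / p.toReal)

/-- `Λ` is a sampling sequence for `F^p_{φ,ω}`. -/
def IsSampling (p : ℝ≥0∞) (φ ω ρ : ℂ → ℝ) (Λ : Set ℂ) : Prop :=
  if p = ∞ then
    ∃ C : ℝ≥0, 0 < C ∧ ∀ f : ℂ → ℂ, MemF ∞ φ ω ρ f →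
      Fnorm ∞ φ ω ρ f ≤ C * lnorm ∞ φ ω Λ f
  else
    ∃ C : ℝ≥0, 0 < C ∧ ∀ f : ℂ → ℂ, MemF p φ ω ρ f →
      (C : ℝ≥0∞)⁻¹ * lnorm p φ ω Λ f ≤ Fnorm p φ ω ρ f ∧
      Fnorm p φ ω ρ f ≤ C * lnorm p φ ω Λ f

/-- `Λ` is an interpolating sequence for `F^p_{φ,ω}`. -/
def IsInterpolating (p : ℝ≥0∞) (φ ω ρ : ℂ → ℝ) (Λ : Set ℂ) : Prop :=
  ∀ v : ℂ → ℂ, lnorm p φ ω Λ v < ∞ →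
    ∃ f : ℂ → ℂ, MemF p φ ω ρ f ∧ ∀ l ∈ Λ, f l = v l

/-- `Λ` is `ρ`-separated. -/
def RhoSeparated (ρ : ℂ → ℝ) (Λ : Set ℂ) : Prop :=
  ∃ δ : ℝ, 0 < δ ∧ ∀ l ∈ Λ, ∀ l' ∈ Λ, l ≠ l' → δ * max (ρ l) (ρ l') ≤ dist l l'

/-- `Λ` is a finite union of `ρ`-separated sequences. -/
def FiniteUnionSeparated (ρ : ℂ → ℝ) (Λ : Set ℂ) : Prop :=
  ∃ n : ℕ, ∃ Λs : Fin n → Set ℂ, Λ = ⋃ i, Λs i ∧ ∀ i, RhoSeparated ρ (Λs i)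

/-- Upper uniform density of `Λ` with respect to the doubling measure `μ`. -/
def upperUnifDensity (μ : Measure ℂ) (ρ : ℂ → ℝ) (Λ : Set ℂ) : ℝ≥0∞ :=
  limsup (fun r : ℝ =>
    ⨆ z : ℂ, Measure.count (Λ ∩ closedBall z (r * ρ z)) / μ (ball z (r * ρ z))) atTop

/-- Lower uniform density of `Λ` with respect to the doubling measure `μ`. -/
def lowerUnifDensity (μ : Measure ℂ) (ρ : ℂ → ℝ) (Λ : Set ℂ) : ℝ≥0∞ :=
  liminf (fun r : ℝ =>
    ⨅ z : ℂ, Measure.count (Λ ∩ closedBall z (r * ρ z)) / μ (ball z (r * ρ z))) atTop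

/-- The Cauchy–Riemann operator `∂̄` on `ℂ`-valued functions. -/
def dbar (v : ℂ → ℂ) (z : ℂ) : ℂ :=
  (fderiv ℝ v z 1 + Complex.I • fderiv ℝ v z Complex.I) / 2

/-- `∂̄ u = f` in the sense of distributions. -/
def IsDistribDbarOf (u f : ℂ → ℂ) : Prop :=
  ∀ v : ℂ → ℂ, ContDiff ℝ (⊤ : ℕ∞) v → HasCompactSupport v →
    ∫ z, f z * v z = - ∫ z, u z * dbar v z

/-- Closed axis-parallel rectangle with centre `a` and half-sides `s, t`. -/
def axisRect (a : ℂ) (s t : ℝ) : Set ℂ :=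
  {w : ℂ | |w.re - a.re| ≤ s ∧ |w.im - a.im| ≤ t}


/-- Real-valued formulation of the doubling property, with finiteness and positivity. -/
structure Dbl (μ : Measure ℂ) (C : ℝ) : Prop where
  one_le : 1 ≤ C
  fin : ∀ z r, μ (ball z r) < ∞
  pos : ∀ z r, 0 < r → 0 < μ.real (ball z r)
  dbl : ∀ z r, 0 < r → μ.real (ball z (2 * r)) ≤ C * μ.real (ball z r)

lemma exists_Dbl {φ : ℂ → ℝ} {μ : Measure ℂ} (hφ : HasDoublingLaplacian φ μ)
    {ρ : ℂ → ℝ} (hρ : IsRadius μ ρ) : ∃ C : ℝ, Dbl μ C := by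
  obtain ⟨C, hC0, hC⟩ := hφ.doubling
  have hit : ∀ z r, 0 < r → ∀ k : ℕ, μ (ball z (2 ^ k * r)) ≤ (C : ℝ≥0∞) ^ k * μ (ball z r) := by
    intro z r hr k
    induction k with
    | zero => simp
    | succ k ih =>
      have := hC z (2 ^ k * r) (by positivity)
      calc μ (ball z (2 ^ (k + 1) * r)) = μ (ball z (2 * (2 ^ k * r))) := by ring_nf
        _ ≤ C * μ (ball z (2 ^ k * r)) := this
        _ ≤ C * ((C : ℝ≥0∞) ^ k * μ (ball z r)) := by gcongr
        _ = _ := by ring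
  have hfin : ∀ z r, μ (ball z r) < ∞ := by
    intro z r
    obtain ⟨k, hk⟩ := pow_unbounded_of_one_lt (|r| / ρ z) (one_lt_two)
    have h1 := (hρ z).1
    have : ball z r ⊆ ball z (2 ^ k * ρ z) := by
      apply ball_subset_ball
      rw [div_lt_iff₀ h1] at hk
      exact (le_abs_self r).trans hk.le
    refine (measure_mono this).trans_lt ((hit z _ h1 k).trans_lt ?_)
    rw [(hρ z).2, mul_one]
    exact ENNReal.pow_lt_top ENNReal.coe_lt_top
  have hpos : ∀ z r, 0 < r → 0 < μ (ball z r) := by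
    intro z r hr
    by_contra h
    have h0 : μ (ball z r) = 0 := by simpa using h
    obtain ⟨k, hk⟩ := pow_unbounded_of_one_lt (ρ z / r) (one_lt_two)
    rw [div_lt_iff₀ hr] at hk
    have h2 := hit z r hr k
    rw [h0, mul_zero] at h2
    have h3 := (measure_mono (ball_subset_ball hk.le)).trans h2
    rw [(hρ z).2] at h3
    simp at h3
  have hdb : ∀ z r, 0 < r → μ.real (ball z (2 * r)) ≤ C * μ.real (ball z r) := by
    intro z r hr
    have := ENNReal.toReal_mono (ENNReal.mul_lt_top ENNReal.coe_lt_top (hfin z r)).ne (hC z r hr)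
    simpa [Measure.real, ENNReal.toReal_mul] using this
  have hp : ∀ z r, 0 < r → 0 < μ.real (ball z r) := fun z r hr =>
    ENNReal.toReal_pos (hpos z r hr).ne' (hfin z r).ne
  refine ⟨C, ?_, hfin, hp, hdb⟩
  have h1 := hdb 0 1 one_pos
  have h2 : μ.real (ball (0:ℂ) 1) ≤ μ.real (ball 0 (2 * 1)) :=
    measureReal_mono (ball_subset_ball (by norm_num)) (hfin _ _).ne
  have h3 := hp 0 1 one_pos
  by_contra hlt
  push Not at hlt
  nlinarith

namespace Dbl

variable {μ : Measure ℂ} {C : ℝ}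

lemma mono (h : Dbl μ C) {z w : ℂ} {r s : ℝ} (hs : dist z w + r ≤ s) :
    μ.real (ball z r) ≤ μ.real (ball w s) := by
  apply measureReal_mono _ (h.fin _ _).ne
  apply ball_subset_ball'
  linarith

lemma mono' (h : Dbl μ C) {z : ℂ} {r s : ℝ} (hs : r ≤ s) :
    μ.real (ball z r) ≤ μ.real (ball z s) :=
  h.mono (by simpa using hs)

lemma iter (h : Dbl μ C) (z : ℂ) {r : ℝ} (hr : 0 < r) (k : ℕ) :
    μ.real (ball z (2 ^ k * r)) ≤ C ^ k * μ.real (ball z r) := by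
  induction k with
  | zero => simp
  | succ k ih =>
    have := h.dbl z (2 ^ k * r) (by positivity)
    have hC := h.one_le
    calc μ.real (ball z (2 ^ (k + 1) * r)) = μ.real (ball z (2 * (2 ^ k * r))) := by ring_nf
      _ ≤ C * μ.real (ball z (2 ^ k * r)) := this
      _ ≤ C * (C ^ k * μ.real (ball z r)) := by gcongr
      _ = _ := by ring

/-- reverse doubling constant -/
def th (C : ℝ) : ℝ := 1 - (C ^ 3)⁻¹

lemma th_nonneg (h : Dbl μ C) : 0 ≤ th C := by
  have : (C ^ 3)⁻¹ ≤ 1 := inv_le_one_of_one_le₀ (one_le_pow₀ h.one_le)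
  unfold th; linarith

lemma th_lt (h : Dbl μ C) : th C < 1 := by
  have : 0 < (C ^ 3)⁻¹ := by have := h.one_le; positivity
  unfold th; linarith

lemma rev (h : Dbl μ C) (z : ℂ) {r : ℝ} (hr : 0 < r) :
    μ.real (ball z (r / 4)) ≤ th C * μ.real (ball z r) := by
  have hC := h.one_le
  set w : ℂ := z + ((r / 2 : ℝ) : ℂ) with hw
  have hd : dist w z = r / 2 := by
    simp [hw, dist_eq_norm, abs_of_pos hr]
  have h1 : μ.real (ball z r) ≤ C ^ 3 * μ.real (ball w (r / 4)) := by
    have := h.iter w (r := r / 4) (by positivity) 3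
    refine le_trans (h.mono ?_) this
    rw [dist_comm, hd]; linarith
  have hdis : Disjoint (ball z (r / 4)) (ball w (r / 4)) := by
    apply ball_disjoint_ball
    rw [dist_comm, hd]; linarith
  have h2 : μ.real (ball z (r / 4)) + μ.real (ball w (r / 4)) ≤ μ.real (ball z r) := by
    rw [← measureReal_union hdis measurableSet_ball (h.fin _ _).ne (h.fin _ _).ne]
    apply measureReal_mono _ (h.fin _ _).ne
    apply union_subset
    · exact ball_subset_ball (by linarith)
    · apply ball_subset_ball'; rw [hd]; linarith
  have h3 : (C ^ 3)⁻¹ * μ.real (ball z r) ≤ μ.real (ball w (r / 4)) := by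
    rw [inv_mul_le_iff₀ (by positivity)]; exact h1
  unfold th; linarith

lemma rev_iter (h : Dbl μ C) (z : ℂ) {r : ℝ} (hr : 0 < r) (k : ℕ) :
    μ.real (ball z (r / 4 ^ k)) ≤ th C ^ k * μ.real (ball z r) := by
  induction k with
  | zero => simp
  | succ k ih =>
    have := h.rev z (r := r / 4 ^ k) (by positivity)
    calc μ.real (ball z (r / 4 ^ (k + 1))) = μ.real (ball z (r / 4 ^ k / 4)) := by
          rw [div_div, pow_succ]
      _ ≤ th C * μ.real (ball z (r / 4 ^ k)) := this
      _ ≤ th C * (th C ^ k * μ.real (ball z r)) := by gcongr; exact h.th_nonneg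
      _ = _ := by ring

lemma rev_up (h : Dbl μ C) (z : ℂ) {r : ℝ} (hr : 0 < r) (k : ℕ) :
    μ.real (ball z r) ≤ th C ^ k * μ.real (ball z (4 ^ k * r)) := by
  have := h.rev_iter z (r := 4 ^ k * r) (by positivity) k
  rwa [mul_div_cancel_left₀ _ (by positivity)] at this

lemma noAtoms (h : Dbl μ C) : NullSingletonClass μ := by
  refine ⟨fun z => ?_⟩
  have h1 : ∀ k : ℕ, μ.real {z} ≤ th C ^ k * μ.real (ball z 1) := fun k =>
    (measureReal_mono (by simp) (h.fin _ _).ne).trans (h.rev_iter z one_pos k)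
  have h2 : Tendsto (fun k : ℕ => th C ^ k * μ.real (ball z 1)) atTop (𝓝 0) := by
    simpa using (tendsto_pow_atTop_nhds_zero_of_lt_one h.th_nonneg h.th_lt).mul_const
      (μ.real (ball z 1))
  have h3 : μ.real {z} ≤ 0 := ge_of_tendsto' h2 h1
  have h4 : μ.real {z} = 0 := le_antisymm h3 measureReal_nonneg
  have h5 : μ {z} ≠ ∞ := ((measure_mono (by simp : {z} ⊆ ball z 1)).trans_lt (h.fin z 1)).ne
  simpa [Measure.real, ENNReal.toReal_eq_zero_iff, h5] using h4

/-- constant in the log-potential lemma -/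
def Klog (C : ℝ) : ℝ := Real.log 4 * (1 - th C)⁻¹

lemma Klog_nonneg (h : Dbl μ C) : 0 ≤ Klog C := by
  have := h.th_lt
  have : 0 < 1 - th C := by linarith
  unfold Klog
  have := Real.log_nonneg (show (1:ℝ) ≤ 4 by norm_num)
  positivity

lemma log_le_tsum {r d : ℝ} (hr : 0 < r) (hd : 0 < d) :
    ENNReal.ofReal (Real.log (r / d)) ≤
      ∑' k : ℕ, ENNReal.ofReal (Real.log 4) * (if d < r / 4 ^ k then 1 else 0) := by
  by_cases hdr : d < r
  swap
  · have : Real.log (r / d) ≤ 0 := Real.log_nonpos (by positivity) (by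
      rw [div_le_one hd]; linarith)
    rw [ENNReal.ofReal_of_nonpos this]; exact zero_le
  -- find n with 4^n ≤ r/d < 4^(n+1)
  have h1 : 1 ≤ r / d := by rw [one_le_div hd]; exact hdr.le
  obtain ⟨n, hn1, hn2⟩ := exists_nat_pow_near h1 (show (1:ℝ) < 4 by norm_num)
  have h4 : (0:ℝ) < Real.log 4 := Real.log_pos (by norm_num)
  have hlog : Real.log (r / d) ≤ (n + 1 : ℕ) * Real.log 4 := by
    rw [← Real.log_pow]
    exact Real.log_le_log (by positivity) hn2.le
  rcases Nat.eq_zero_or_pos n with hn0 | hn0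
  · subst hn0
    refine le_trans ?_ (ENNReal.le_tsum 0)
    simp only [pow_zero, div_one, hdr, if_true, mul_one]
    apply ENNReal.ofReal_le_ofReal
    simpa using hlog
  · -- for k < n, d < r/4^k; also k=n has d ≤ r/4^n; use k<n plus log (r/d) ≤ ...
    by_cases hn3 : d < r / 4 ^ n
    · calc ENNReal.ofReal (Real.log (r / d)) ≤ ENNReal.ofReal ((n + 1 : ℕ) * Real.log 4) :=
          ENNReal.ofReal_le_ofReal hlog
        _ = ∑ k ∈ Finset.range (n + 1), ENNReal.ofReal (Real.log 4) * (if d < r / 4 ^ k then 1 else 0) := by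
          rw [Finset.sum_congr rfl (g := fun _ => ENNReal.ofReal (Real.log 4))]
          · rw [Finset.sum_const, Finset.card_range, nsmul_eq_mul,
              ENNReal.ofReal_mul (by positivity), ENNReal.ofReal_natCast]
          · intro k hk
            rw [if_pos, mul_one]
            refine hn3.trans_le ?_
            have : k ≤ n := by simpa [Nat.lt_succ_iff] using hk
            gcongr
            norm_num
        _ ≤ _ := ENNReal.sum_le_tsum _
    · have heq : r / d = 4 ^ n := by
        apply le_antisymm _ hn1
        push Not at hn3
        rw [div_le_iff₀ (by positivity)] at hn3
        rw [div_le_iff₀ hd]; linarith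
      calc ENNReal.ofReal (Real.log (r / d)) ≤ ENNReal.ofReal ((n : ℕ) * Real.log 4) := by
            rw [heq, Real.log_pow]
        _ = ∑ k ∈ Finset.range n, ENNReal.ofReal (Real.log 4) * (if d < r / 4 ^ k then 1 else 0) := by
          rw [Finset.sum_congr rfl (g := fun _ => ENNReal.ofReal (Real.log 4))]
          · rw [Finset.sum_const, Finset.card_range, nsmul_eq_mul,
              ENNReal.ofReal_mul (by positivity), ENNReal.ofReal_natCast]
          · intro k hk
            rw [if_pos, mul_one]
            have : k < n := by simpa using hk
            have h5 : r = d * 4 ^ n := by field_simp at heq; linarith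
            rw [lt_div_iff₀ (by positivity), h5]
            gcongr
            norm_num
        _ ≤ _ := ENNReal.sum_le_tsum _

lemma lintegral_log (h : Dbl μ C) (z : ℂ) {r : ℝ} (hr : 0 < r) :
    ∫⁻ ζ in ball z r, ENNReal.ofReal (Real.log (r / dist z ζ)) ∂μ
      ≤ ENNReal.ofReal (Klog C * μ.real (ball z r)) := by
  have hna := h.noAtoms
  have h4 : (0:ℝ) < Real.log 4 := Real.log_pos (by norm_num)
  calc ∫⁻ ζ in ball z r, ENNReal.ofReal (Real.log (r / dist z ζ)) ∂μ
      ≤ ∫⁻ ζ in ball z r, ∑' k : ℕ, ENNReal.ofReal (Real.log 4) *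
          (ball z (r / 4 ^ k)).indicator 1 ζ ∂μ := by
        apply lintegral_mono_ae
        have : ∀ᵐ ζ ∂(μ.restrict (ball z r)), ζ ≠ z := by
          apply ae_restrict_of_ae
          simp [ae_iff, measure_singleton z]
        filter_upwards [this] with ζ hζ
        have hd : 0 < dist z ζ := dist_pos.2 hζ.symm
        convert log_le_tsum hr hd using 4 with k
        simp [indicator, mem_ball, dist_comm]
    _ = ∑' k : ℕ, ENNReal.ofReal (Real.log 4) * (μ.restrict (ball z r)) (ball z (r / 4 ^ k)) := by
        rw [lintegral_tsum]
        · congr 1; ext k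
          rw [lintegral_const_mul _ (measurable_one.indicator measurableSet_ball),
            lintegral_indicator_one measurableSet_ball]
        · intro k
          exact ((measurable_one.indicator measurableSet_ball).const_mul _).aemeasurable
    _ ≤ ∑' k : ℕ, ENNReal.ofReal (Real.log 4 * (μ.real (ball z r) * th C ^ k)) := by
        apply ENNReal.tsum_le_tsum
        intro k
        rw [ENNReal.ofReal_mul h4.le]
        gcongr
        calc (μ.restrict (ball z r)) (ball z (r / 4 ^ k)) ≤ μ (ball z (r / 4 ^ k)) :=
              Measure.restrict_apply_le _ _
          _ = ENNReal.ofReal (μ.real (ball z (r / 4 ^ k))) := by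
              rw [Measure.real, ENNReal.ofReal_toReal (h.fin _ _).ne]
          _ ≤ _ := ENNReal.ofReal_le_ofReal ((h.rev_iter z hr k).trans_eq (mul_comm _ _))
    _ = ENNReal.ofReal (∑' k : ℕ, Real.log 4 * (μ.real (ball z r) * th C ^ k)) := by
        rw [ENNReal.ofReal_tsum_of_nonneg]
        · intro k
          have := h.th_nonneg
          have := (h.pos z r hr).le
          positivity
        · exact ((summable_geometric_of_lt_one h.th_nonneg h.th_lt).mul_left _).mul_left _
    _ = _ := by
        rw [tsum_mul_left, tsum_mul_left, tsum_geometric_of_lt_one h.th_nonneg h.th_lt]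
        unfold Klog; congr 1; ring

end Dbl

/-- The radius function attached to mass (about) `M`. -/
structure RSetup (μ : Measure ℂ) (C M : ℝ) (R : ℂ → ℝ) : Prop where
  dbl : Dbl μ C
  oneM : 1 ≤ M
  pos : ∀ z, 0 < R z
  lip : ∀ z w, R z ≤ R w + dist z w
  up : ∀ z, μ.real (ball z (R z)) ≤ M
  low : ∀ z, M ≤ C * μ.real (ball z (R z))

lemma radius_lip {μ : Measure ℂ} {C : ℝ} (h : Dbl μ C) {ρ : ℂ → ℝ} (hρ : IsRadius μ ρ)
    (z w : ℂ) : ρ z ≤ ρ w + dist z w := by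
  by_contra hlt
  push Not at hlt
  have hz := hρ z
  have hw := hρ w
  set s := ρ w + dist z w with hs
  have hs0 : 0 < s := by have := dist_nonneg (x := z) (y := w); linarith [hw.1]
  set t := (ρ z - s) / 2 with ht
  have ht0 : 0 < t := by rw [ht]; linarith
  set x : ℂ := z + ((s + t : ℝ) : ℂ) with hx
  have hd : dist x z = s + t := by
    rw [hx, dist_eq_norm, add_sub_cancel_left, Complex.norm_real, Real.norm_of_nonneg (by linarith)]
  have hdis : Disjoint (ball z s) (ball x t) := by
    apply ball_disjoint_ball
    rw [dist_comm, hd]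
  have h2 : μ.real (ball z s) + μ.real (ball x t) ≤ μ.real (ball z (ρ z)) := by
    rw [← measureReal_union hdis measurableSet_ball (h.fin _ _).ne (h.fin _ _).ne]
    apply measureReal_mono _ (h.fin _ _).ne
    apply union_subset
    · exact ball_subset_ball hlt.le
    · apply ball_subset_ball'; rw [hd]; linarith
  have h3 : μ.real (ball w (ρ w)) ≤ μ.real (ball z s) := h.mono (by rw [dist_comm w z]; linarith)
  have h4 := h.pos x t ht0
  have h5 : μ.real (ball z (ρ z)) = 1 := by simp [Measure.real, hz.2]
  have h6 : μ.real (ball w (ρ w)) = 1 := by simp [Measure.real, hw.2]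
  linarith

lemma exists_RSetup {μ : Measure ℂ} {C : ℝ} (h : Dbl μ C) {ρ : ℂ → ℝ} (hρ : IsRadius μ ρ)
    (M : ℝ) (hM : 1 ≤ M) : ∃ R : ℂ → ℝ, RSetup μ C M R ∧ (∀ z, ρ z ≤ R z) ∧
      ∃ A : ℝ, 1 ≤ A ∧ ∀ z, R z ≤ A * ρ z := by
  have hone : ∀ z, μ.real (ball z (ρ z)) = 1 := fun z => by simp [Measure.real, (hρ z).2]
  obtain ⟨k, hk⟩ : ∃ k : ℕ, Dbl.th C ^ k * (M + 1) < 1 := by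
    have h2 : Tendsto (fun k : ℕ => Dbl.th C ^ k * (M + 1)) atTop (𝓝 0) := by
      simpa using (tendsto_pow_atTop_nhds_zero_of_lt_one h.th_nonneg h.th_lt).mul_const (M + 1)
    exact (h2.eventually (gt_mem_nhds one_pos)).exists
  have hbig : ∀ z r, 4 ^ k * ρ z ≤ r → M < μ.real (ball z r) := by
    intro z r hr
    by_contra hle
    push Not at hle
    have h1 := h.rev_up z (hρ z).1 k
    rw [hone] at h1
    have h2 := (h.mono' (z := z) hr).trans hle
    have h3 : Dbl.th C ^ k * μ.real (ball z (4 ^ k * ρ z)) ≤ Dbl.th C ^ k * (M + 1) := by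
      have := pow_nonneg h.th_nonneg k
      gcongr; linarith
    linarith
  set S : ℂ → Set ℝ := fun z => {r | μ.real (ball z r) ≤ M} with hS
  have hub : ∀ z, 4 ^ k * ρ z ∈ upperBounds (S z) := by
    intro z r hr
    by_contra hlt
    push Not at hlt
    have := hbig z r hlt.le
    simp only [hS, mem_setOf_eq] at hr
    linarith
  have hbdd : ∀ z, BddAbove (S z) := fun z => ⟨_, hub z⟩
  have hρS : ∀ z, ρ z ∈ S z := fun z => by simp only [hS, mem_setOf_eq, hone]; exact hM
  have hρR : ∀ z, ρ z ≤ sSup (S z) := fun z => le_csSup (hbdd z) (hρS z)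
  have hpos : ∀ z, 0 < sSup (S z) := fun z => (hρ z).1.trans_le (hρR z)
  refine ⟨fun z => sSup (S z), ⟨h, hM, hpos, ?_, ?_, ?_⟩, hρR, 4 ^ k, one_le_pow₀ (by norm_num), ?_⟩
  · intro z w
    apply csSup_le ⟨_, hρS z⟩
    intro r hr
    have : r - dist z w ∈ S w := by
      simp only [hS, mem_setOf_eq] at hr ⊢
      refine le_trans (h.mono ?_) hr
      rw [dist_comm]; linarith
    linarith [le_csSup (hbdd w) this]
  · intro z
    -- ball z (sSup) = ⋃ of smaller balls
    have hlt : ∀ r < sSup (S z), μ.real (ball z r) ≤ M := by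
      intro r hr
      obtain ⟨s, hs, hrs⟩ := exists_lt_of_lt_csSup ⟨_, hρS z⟩ hr
      exact (h.mono' hrs.le).trans hs
    set u : ℕ → ℝ := fun n => sSup (S z) - 1 / ((n : ℝ) + 1) with hu
    have hmono : Monotone fun n => ball z (u n) := by
      intro a b hab
      apply ball_subset_ball
      simp only [hu]
      have : (1:ℝ) / ((b:ℝ) + 1) ≤ 1 / ((a:ℝ) + 1) := by gcongr
      linarith
    have hun : ⋃ n, ball z (u n) = ball z (sSup (S z)) := by
      ext x
      simp only [mem_iUnion, mem_ball, hu]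
      constructor
      · rintro ⟨n, hn⟩
        have : (0:ℝ) < 1 / ((n:ℝ) + 1) := by positivity
        linarith
      · intro hx
        obtain ⟨n, hn⟩ := exists_nat_one_div_lt (sub_pos.2 hx)
        exact ⟨n, by linarith⟩
    have ht := tendsto_measure_iUnion_atTop (μ := μ) hmono
    rw [hun] at ht
    have ht2 := (ENNReal.tendsto_toReal (h.fin z (sSup (S z))).ne).comp ht
    apply le_of_tendsto' ht2
    intro n
    apply hlt
    have : (0:ℝ) < 1 / ((n:ℝ) + 1) := by positivity
    simp only [hu]; linarith
  · intro z
    refine le_trans ?_ (h.dbl z _ (hpos z))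
    by_contra hlt
    push Not at hlt
    have : 2 * sSup (S z) ∈ S z := hlt.le
    have := le_csSup (hbdd z) this
    linarith [hpos z]
  · intro z
    exact csSup_le ⟨_, hρS z⟩ (hub z)

namespace RSetup
variable {μ : Measure ℂ} {C M : ℝ} {R : ℂ → ℝ}

lemma cont (h : RSetup μ C M R) : Continuous R := by
  have : LipschitzWith 1 R := LipschitzWith.of_le_add (fun z w => h.lip z w)
  exact this.continuous

/-- comparability of `R` at points at distance at most a multiple of `R a`. -/
lemma comp (h : RSetup μ C M R) (K : ℝ) : ∃ K' : ℝ, 1 ≤ K' ∧ ∀ z a, dist z a ≤ K * R a →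
    R a ≤ K' * R z := by
  have hd := h.dbl
  obtain ⟨l, hl⟩ := pow_unbounded_of_one_lt (K + 1) one_lt_two
  obtain ⟨k, hk⟩ : ∃ k : ℕ, Dbl.th C ^ k * (C ^ (l + 1) * M) < 1 := by
    have h2 : Tendsto (fun k : ℕ => Dbl.th C ^ k * (C ^ (l + 1) * M)) atTop (𝓝 0) := by
      simpa using (tendsto_pow_atTop_nhds_zero_of_lt_one hd.th_nonneg hd.th_lt).mul_const
        (C ^ (l + 1) * M)
    exact (h2.eventually (gt_mem_nhds one_pos)).exists
  refine ⟨4 ^ k, one_le_pow₀ (by norm_num), fun z a hza => ?_⟩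
  by_contra hlt
  push Not at hlt
  have hC := hd.one_le
  have hRa := h.pos a
  have h1 := hd.rev_up z (h.pos z) k
  have h2 : μ.real (ball z (4 ^ k * R z)) ≤ C ^ l * M := by
    calc μ.real (ball z (4 ^ k * R z)) ≤ μ.real (ball a (2 ^ l * R a)) := by
          apply hd.mono
          nlinarith
      _ ≤ C ^ l * μ.real (ball a (R a)) := hd.iter a hRa l
      _ ≤ _ := by gcongr; exact h.up a
  have h3 := h.low z
  have hth := pow_nonneg hd.th_nonneg k
  have : M ≤ Dbl.th C ^ k * (C ^ (l + 1) * M) := by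
    calc M ≤ C * μ.real (ball z (R z)) := h3
      _ ≤ C * (Dbl.th C ^ k * (C ^ l * M)) := by gcongr; exact h1.trans (by gcongr)
      _ = _ := by ring
  linarith [h.oneM]

/-- Mass lower bound for fractions of the radius. -/
lemma low_frac (h : RSetup μ C M R) (z : ℂ) (k : ℕ) :
    M ≤ C ^ (k + 1) * μ.real (ball z (R z / 2 ^ k)) := by
  have hR := h.pos z
  have := h.dbl.iter z (r := R z / 2 ^ k) (by positivity) k
  rw [mul_div_cancel₀ _ (by positivity)] at this
  have hC := h.dbl.one_le
  calc M ≤ C * μ.real (ball z (R z)) := h.low z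
    _ ≤ C * (C ^ k * μ.real (ball z (R z / 2 ^ k))) := by gcongr
    _ = _ := by ring

lemma up_mul (h : RSetup μ C M R) (z : ℂ) (k : ℕ) :
    μ.real (ball z (2 ^ k * R z)) ≤ C ^ k * M := by
  have hC := h.dbl.one_le
  refine (h.dbl.iter z (h.pos z) k).trans ?_
  gcongr; exact h.up z

/-- `Λ` is separated with parameter `1/20`. -/
def Sep (R : ℂ → ℝ) (Λ : Set ℂ) : Prop :=
  ∀ a ∈ Λ, ∀ b ∈ Λ, a ≠ b → (1/20) * max (R a) (R b) ≤ dist a b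

lemma Sep.disj {Λ : Set ℂ} (hΛ : Sep R Λ) {a b : ℂ} (ha : a ∈ Λ) (hb : b ∈ Λ) (hab : a ≠ b) :
    Disjoint (ball a (R a / 64)) (ball b (R b / 64)) := by
  apply ball_disjoint_ball
  have := hΛ a ha b hb hab
  have h1 := le_max_left (R a) (R b)
  have h2 := le_max_right (R a) (R b)
  by_cases h0 : 0 ≤ max (R a) (R b)
  · linarith
  · push Not at h0
    have := dist_nonneg (x := a) (y := b)
    linarith

/-- counting -/
lemma card_le (h : RSetup μ C M R) {Λ : Set ℂ} (hΛ : Sep R Λ) (F : Finset ℂ)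
    (hF : ∀ a ∈ F, a ∈ Λ) (z : ℂ) (s : ℝ) (hs : ∀ a ∈ F, dist a z + R a / 64 ≤ s) :
    (F.card : ℝ) * M ≤ C ^ 7 * μ.real (ball z s) := by
  have hC := h.dbl.one_le
  calc (F.card : ℝ) * M = ∑ a ∈ F, M := by simp
    _ ≤ ∑ a ∈ F, C ^ 7 * μ.real (ball a (R a / 64)) := by
        apply Finset.sum_le_sum
        intro a _
        have := h.low_frac a 6
        norm_num at this
        exact this
    _ = C ^ 7 * ∑ a ∈ F, μ.real (ball a (R a / 64)) := by rw [Finset.mul_sum]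
    _ = C ^ 7 * μ.real (⋃ a ∈ F, ball a (R a / 64)) := by
        rw [measureReal_biUnion_finset _ (fun _ _ => measurableSet_ball)
          (fun a _ => (h.dbl.fin _ _).ne)]
        intro a ha b hb hab
        exact hΛ.disj (hF a ha) (hF b hb) hab
    _ ≤ _ := by
        gcongr
        · exact (h.dbl.fin _ _).ne
        · exact iUnion₂_subset fun a ha => ball_subset_ball' (by linarith [hs a ha])

/-- Points of a separated set in a bounded region are finitely many. -/
lemma finite_ball (h : RSetup μ C M R) {Λ : Set ℂ} (hΛ : Sep R Λ) (z : ℂ) (s : ℝ) :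
    {a ∈ Λ | dist a z ≤ s}.Finite := by
  by_contra hinf
  have hinf : {a ∈ Λ | dist a z ≤ s}.Infinite := hinf
  set B := C ^ 7 * μ.real (ball z (s + (R z + s) / 64)) with hB
  obtain ⟨n, hn⟩ := exists_nat_gt B
  obtain ⟨F, hF1, hF2⟩ := hinf.exists_subset_card_eq n
  have := h.card_le hΛ F (fun a ha => (hF1 ha).1) z (s + (R z + s) / 64) (by
    intro a ha
    have h1 := (hF1 ha).2
    have h2 := h.lip a z
    linarith)
  rw [hF2] at this
  have hM := h.oneM
  have : (n:ℝ) ≤ n * M := le_mul_of_one_le_right (by positivity) hM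
  linarith

/-- uniform counting -/
lemma card_unif (h : RSetup μ C M R) (K : ℝ) : ∃ J : ℕ, ∀ Λ : Set ℂ, Sep R Λ → ∀ z : ℂ,
    ∀ F : Finset ℂ, (∀ a ∈ F, a ∈ Λ ∧ dist a z ≤ K * R z) → F.card ≤ J := by
  obtain ⟨l, hl⟩ := pow_unbounded_of_one_lt (|K| + (1 + |K|) / 64) one_lt_two
  obtain ⟨J, hJ⟩ := exists_nat_gt (C ^ 7 * C ^ l)
  refine ⟨J, fun Λ hΛ z F hF => ?_⟩
  have hR := h.pos z
  have hC := h.dbl.one_le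
  have h1 := h.card_le hΛ F (fun a ha => (hF a ha).1) z (2 ^ l * R z) (by
    intro a ha
    have h1 := (hF a ha).2
    have h2 := h.lip a z
    have h3 : K * R z ≤ |K| * R z := by gcongr; exact le_abs_self K
    have h4 : (|K| + (1 + |K|) / 64) * R z ≤ 2 ^ l * R z := by gcongr
    nlinarith)
  have h2 := h.up_mul z l
  have hM := h.oneM
  have h3 : (F.card : ℝ) * M ≤ (C ^ 7 * C ^ l) * M := by
    calc _ ≤ _ := h1
      _ ≤ C ^ 7 * (C ^ l * M) := by gcongr
      _ = _ := by ring
  have h4 : (F.card : ℝ) ≤ C ^ 7 * C ^ l := le_of_mul_le_mul_right h3 (by linarith)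
  exact_mod_cast (h4.trans hJ.le)

end RSetup

namespace RSetup
variable {μ : Measure ℂ} {C M : ℝ} {R : ℂ → ℝ}

lemma far_term (h : RSetup μ C M R) {p : ℕ} (hp : C ^ 4 ≤ 4 ^ p) (z a : ℂ)
    (hd : 4 * R a ≤ dist z a) :
    (R a / dist z a) ^ p * μ.real (ball z (dist z a)) ^ 2 ≤ C ^ 6 * M ^ 2 := by
  have hR := h.pos a
  have hC := h.dbl.one_le
  have hM := h.oneM
  set D := dist z a with hD
  have hD0 : 0 < D := by linarith
  obtain ⟨j, hj1, hj2⟩ := exists_nat_pow_near (x := D / R a) (y := 4)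
    (by rw [le_div_iff₀ hR]; linarith) (by norm_num)
  rw [le_div_iff₀ hR] at hj1
  rw [div_lt_iff₀ hR] at hj2
  have h1 : (R a / D) ^ p ≤ (C ^ (4 * j))⁻¹ := by
    have h2 : R a / D ≤ (4 ^ j)⁻¹ := by
      rw [div_le_iff₀ hD0, inv_mul_eq_div, le_div_iff₀ (by positivity)]; linarith
    calc (R a / D) ^ p ≤ ((4 ^ j)⁻¹) ^ p := by gcongr
      _ = ((4 ^ p) ^ j)⁻¹ := by rw [inv_pow, ← pow_mul, ← pow_mul, mul_comm]
      _ ≤ ((C ^ 4) ^ j)⁻¹ := by gcongr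
      _ = _ := by rw [← pow_mul]
  have h2 : μ.real (ball z D) ≤ C ^ (2 * j + 3) * M := by
    refine le_trans (h.dbl.mono ?_) (h.up_mul a (2 * j + 3))
    have : (2:ℝ) ^ (2 * j + 3) = 2 * 4 ^ (j + 1) := by
      rw [show 2 * j + 3 = 2 * (j + 1) + 1 by ring, pow_succ, pow_mul]; norm_num; ring
    rw [this]; linarith
  calc (R a / D) ^ p * μ.real (ball z D) ^ 2 ≤ (C ^ (4 * j))⁻¹ * (C ^ (2 * j + 3) * M) ^ 2 := by
        gcongr
    _ = C ^ 6 * M ^ 2 := by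
        have : (C ^ (2 * j + 3) * M) ^ 2 = C ^ (4 * j) * (C ^ 6 * M ^ 2) := by ring
        rw [this, inv_mul_cancel_left₀ (by positivity)]

/-- Far sum bound. -/
lemma far_sum (h : RSetup μ C M R) {p : ℕ} (hp : C ^ 4 ≤ 4 ^ p) :
    ∃ K : ℝ, 0 ≤ K ∧ ∀ Λ, Sep R Λ → ∀ z : ℂ, ∀ F : Finset ℂ,
      (∀ a ∈ F, a ∈ Λ ∧ 4 * R a ≤ dist z a) → ∑ a ∈ F, (R a / dist z a) ^ p ≤ K := by
  have hC := h.dbl.one_le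
  have hM := h.oneM
  have hth0 := h.dbl.th_nonneg
  have hth1 := h.dbl.th_lt
  refine ⟨C ^ 19 * (1 - Dbl.th C)⁻¹, by have : 0 ≤ 1 - Dbl.th C := by linarith
                                        positivity, ?_⟩
  intro Λ hΛ z F hF
  have hRz := h.pos z
  set r := R z / 2 with hr
  have hr0 : 0 < r := by positivity
  have hex : ∀ a : ℂ, ∃ k : ℕ, a ∈ F → 4 ^ k * r ≤ dist z a ∧ dist z a < 4 ^ (k + 1) * r := by
    intro a
    by_cases ha : a ∈ F
    · have h1 := (hF a ha).2
      have h2 := h.lip z a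
      have h3 := h.pos a
      obtain ⟨k, hk1, hk2⟩ := exists_nat_pow_near (x := dist z a / r) (y := 4)
        (by rw [le_div_iff₀ hr0]; linarith) (by norm_num)
      rw [le_div_iff₀ hr0] at hk1
      rw [div_lt_iff₀ hr0] at hk2
      exact ⟨k, fun _ => ⟨hk1, hk2⟩⟩
    · exact ⟨0, fun h => absurd h ha⟩
  choose κ hκ using hex
  have hshell : ∀ k, ∑ a ∈ F with κ a = k, (R a / dist z a) ^ p ≤ C ^ 19 * Dbl.th C ^ k := by
    intro k
    set mk := μ.real (ball z (4 ^ k * r)) with hmk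
    have hmk0 : 0 < mk := h.dbl.pos _ _ (by positivity)
    have hcard : ((F.filter (κ · = k)).card : ℝ) * M ≤ C ^ 7 * (C ^ 4 * mk) := by
      refine (h.card_le hΛ _ (fun a ha => (hF a (Finset.mem_filter.1 ha).1).1) z
        (2 ^ 4 * (4 ^ k * r)) ?_).trans ?_
      · intro a ha
        obtain ⟨ha, hk⟩ := Finset.mem_filter.1 ha
        have h1 := (hF a ha).2
        have h2 := (hκ a ha).2
        rw [hk, pow_succ] at h2
        rw [dist_comm]
        linarith [h.pos a]
      · have := h.dbl.iter z (r := 4 ^ k * r) (by positivity) 4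
        gcongr
    have hterm : ∀ a ∈ F.filter (κ · = k), (R a / dist z a) ^ p ≤ C ^ 6 * M ^ 2 / mk ^ 2 := by
      intro a ha
      obtain ⟨ha, hk⟩ := Finset.mem_filter.1 ha
      have h1 := h.far_term hp z a (hF a ha).2
      rw [le_div_iff₀ (by positivity)]
      refine le_trans ?_ h1
      have h2 := (hκ a ha).1
      rw [hk] at h2
      have hh : mk ≤ μ.real (ball z (dist z a)) := h.dbl.mono' h2
      have := (h.pos a).le
      gcongr
    have hm0 : M ≤ C ^ 2 * μ.real (ball z r) := by
      have := h.low_frac z 1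
      simpa using this
    have hrev := h.dbl.rev_up z hr0 k
    have hMk : M ≤ C ^ 2 * (Dbl.th C ^ k * mk) := hm0.trans (by gcongr)
    calc ∑ a ∈ F with κ a = k, (R a / dist z a) ^ p
        ≤ ∑ a ∈ F with κ a = k, C ^ 6 * M ^ 2 / mk ^ 2 := Finset.sum_le_sum hterm
      _ = (((F.filter (κ · = k)).card : ℝ) * M) * (C ^ 6 * M / mk ^ 2) := by
          rw [Finset.sum_const, nsmul_eq_mul]; ring
      _ ≤ (C ^ 7 * (C ^ 4 * mk)) * (C ^ 6 * M / mk ^ 2) := by gcongr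
      _ = C ^ 17 * M / mk := by field_simp
      _ ≤ C ^ 17 * (C ^ 2 * (Dbl.th C ^ k * mk)) / mk := by gcongr
      _ = _ := by field_simp
  calc ∑ a ∈ F, (R a / dist z a) ^ p
      = ∑ k ∈ F.image κ, ∑ a ∈ F with κ a = k, (R a / dist z a) ^ p := by
        rw [Finset.sum_fiberwise_of_maps_to]
        exact fun a ha => Finset.mem_image_of_mem _ ha
    _ ≤ ∑ k ∈ F.image κ, C ^ 19 * Dbl.th C ^ k := Finset.sum_le_sum fun k _ => hshell k
    _ = C ^ 19 * ∑ k ∈ F.image κ, Dbl.th C ^ k := by rw [Finset.mul_sum]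
    _ ≤ C ^ 19 * (1 - Dbl.th C)⁻¹ := by
        gcongr
        rw [← tsum_geometric_of_lt_one hth0 hth1]
        exact (summable_geometric_of_lt_one hth0 hth1).sum_le_tsum _ (fun k _ => by positivity)

end RSetup

/-- Greedy recursion along a code. -/
lemma greedy {ι X : Type*} [Inhabited X] (e : ι → ℕ) (P : ι → (ι → X) → X → Prop)
    (hdep : ∀ a f f' x, (∀ b, e b < e a → f b = f' b) → P a f x → P a f' x)
    (hex : ∀ a f, (∀ b, e b < e a → P b f (f b)) → ∃ x, P a f x) :
    ∃ f : ι → X, ∀ a, P a f (f a) := by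
  let ext : (a : ι) → ((b : ι) → e b < e a → X) → ι → X :=
    fun a g b => if hb : e b < e a then g b hb else default
  let step : (a : ι) → ((b : ι) → e b < e a → X) → X := fun a g =>
    if hx : ∃ x, P a (ext a g) x then hx.choose else default
  let wf : WellFounded (fun b a : ι => e b < e a) := (measure e).wf
  let f : ι → X := wf.fix step
  refine ⟨f, ?_⟩
  have hf : ∀ a, f a = step a (fun b _ => f b) := fun a => wf.fix_eq step a
  intro a
  induction a using wf.induction with
  | _ a ih =>
    have hagree : ∀ b, e b < e a → f b = ext a (fun b _ => f b) b := by
      intro b hb; simp [ext, hb]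
    obtain ⟨x, hx⟩ := hex a f (fun b hb => ih b hb)
    have hx' : ∃ x, P a (ext a (fun b _ => f b)) x := ⟨x, hdep _ _ _ _ hagree hx⟩
    rw [hf a]
    simp only [step]
    rw [dif_pos hx']
    exact hdep _ _ _ _ (fun b hb => (hagree b hb).symm) hx'.choose_spec

namespace RSetup
variable {μ : Measure ℂ} {C M : ℝ} {R : ℂ → ℝ}

lemma exists_net (h : RSetup μ C M R) (z₀ : ℂ) : ∃ Λ : Set ℂ, Sep R Λ ∧ z₀ ∈ Λ ∧
    ∀ z, ∃ a ∈ Λ, dist z a ≤ R a / 19 := by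
  obtain ⟨Λ, h1, h2⟩ := zorn_subset_nonempty {Λ : Set ℂ | Sep R Λ} (by
    intro c hc hch hne
    refine ⟨⋃₀ c, ?_, fun s hs => subset_sUnion_of_mem hs⟩
    rintro a ⟨s, hs, has⟩ b ⟨t, ht, hbt⟩ hab
    rcases hch.total hs ht with hst | hst
    · exact hc ht a (hst has) b hbt hab
    · exact hc hs a has b (hst hbt) hab) {z₀} (by
    intro a ha b hb hab
    rw [mem_singleton_iff] at ha hb
    exact absurd (ha.trans hb.symm) hab)
  refine ⟨Λ, h2.prop, h1 rfl, fun z => ?_⟩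
  by_cases hz : z ∈ Λ
  · exact ⟨z, hz, by rw [dist_self]; have := h.pos z; positivity⟩
  by_contra hno
  push Not at hno
  apply hz
  have : Sep R (insert z Λ) := by
    have key : ∀ a ∈ Λ, (1/20) * max (R z) (R a) ≤ dist z a := by
      intro a ha
      have h3 := hno a ha
      have h4 := h.lip z a
      have h5 := h.pos a
      rcases max_choice (R z) (R a) with h6 | h6 <;> rw [h6] <;> linarith
    rintro a (rfl | ha) b (rfl | hb) hab
    · exact absurd rfl hab
    · exact key b hb
    · rw [dist_comm, max_comm]; exact key a ha
    · exact h2.prop a ha b hb hab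
  exact h2.le_of_ge this (subset_insert z Λ) (mem_insert z Λ)

lemma countable (h : RSetup μ C M R) {Λ : Set ℂ} (hΛ : Sep R Λ) : Λ.Countable := by
  have : Λ = ⋃ n : ℕ, {a ∈ Λ | dist a 0 ≤ n} := by
    ext a
    simp only [mem_iUnion, mem_setOf_eq, exists_and_left, iff_self_and]
    intro _
    exact exists_nat_ge _
  rw [this]
  exact countable_iUnion fun n => (h.finite_ball hΛ 0 n).countable

/-- Cells. -/
lemma exists_cells (h : RSetup μ C M R) {Λ : Set ℂ} (hΛ : Sep R Λ)
    (hcov : ∀ z, ∃ a ∈ Λ, dist z a ≤ R a / 19) :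
    ∃ Q : Λ → Set ℂ, (∀ a, MeasurableSet (Q a)) ∧ Pairwise (Function.onFun Disjoint Q) ∧ (⋃ a, Q a) = univ ∧
      (∀ a : Λ, ball a.1 (R a / 64) ⊆ Q a) ∧ (∀ a : Λ, Q a ⊆ closedBall a.1 (R a / 19)) := by
  have : Countable Λ := (h.countable hΛ).to_subtype
  obtain ⟨e, he⟩ := exists_injective_nat Λ
  set B : Λ → Set ℂ := fun a => ball a.1 (R a / 64) with hB
  set D : Λ → Set ℂ := fun a => closedBall a.1 (R a / 19) with hD
  have hBD : ∀ a, B a ⊆ D a := by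
    intro a x hx
    have := h.pos a
    simp only [hB, hD, mem_ball, mem_closedBall] at hx ⊢
    linarith
  refine ⟨fun a => B a ∪ (D a \ ((⋃ b, B b) ∪ ⋃ b, ⋃ (_ : e b < e a), D b)), ?_, ?_, ?_, ?_, ?_⟩
  · intro a
    refine measurableSet_ball.union (measurableSet_closedBall.diff ?_)
    refine (MeasurableSet.iUnion fun b => measurableSet_ball).union
      (MeasurableSet.iUnion fun b => MeasurableSet.iUnion fun _ => measurableSet_closedBall)
  · intro a b hab
    have hdis : Disjoint (B a) (B b) := hΛ.disj a.2 b.2 (fun h => hab (Subtype.ext h))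
    rw [Function.onFun, Set.disjoint_left]
    rintro x (hx | ⟨hx, hx'⟩) (hy | ⟨hy, hy'⟩)
    · exact Set.disjoint_left.1 hdis hx hy
    · exact hy' (Or.inl (mem_iUnion.2 ⟨a, hx⟩))
    · exact hx' (Or.inl (mem_iUnion.2 ⟨b, hy⟩))
    · rcases lt_trichotomy (e a) (e b) with h1 | h1 | h1
      · exact hy' (Or.inr (mem_iUnion₂.2 ⟨a, h1, hx⟩))
      · exact hab (he h1)
      · exact hx' (Or.inr (mem_iUnion₂.2 ⟨b, h1, hy⟩))
  · rw [eq_univ_iff_forall]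
    intro x
    by_cases hx : x ∈ ⋃ b, B b
    · obtain ⟨b, hb⟩ := mem_iUnion.1 hx
      exact mem_iUnion.2 ⟨b, Or.inl hb⟩
    · have hne : ∃ n, ∃ b, e b = n ∧ x ∈ D b := by
        obtain ⟨a, ha, hxa⟩ := hcov x
        exact ⟨_, ⟨a, ha⟩, rfl, hxa⟩
      obtain ⟨b, hb1, hb2⟩ := Nat.find_spec hne
      refine mem_iUnion.2 ⟨b, Or.inr ⟨hb2, ?_⟩⟩
      rintro (h1 | h1)
      · exact hx h1
      · obtain ⟨c, hc, hxc⟩ := mem_iUnion₂.1 h1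
        rw [hb1] at hc
        exact Nat.find_min hne hc ⟨c, rfl, hxc⟩
  · exact fun a => subset_union_left
  · exact fun a => union_subset (hBD a) diff_subset

/-- The outward parent. -/
lemma exists_parent (h : RSetup μ C M R) {Λ : Set ℂ}
    (hcov : ∀ z, ∃ a ∈ Λ, dist z a ≤ R a / 19) (a : Λ) :
    ∃ b : Λ, ‖a.1‖ < ‖b.1‖ ∧ dist a.1 b.1 ≤ 7 / 12 * R a := by
  have hR := h.pos a
  obtain ⟨u, hu1, hu2⟩ : ∃ u : ℂ, ‖u‖ = 1 ∧ ‖a.1 + ((R a / 2 : ℝ) : ℂ) * u‖ = ‖a.1‖ + R a / 2 := by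
    by_cases ha : a.1 = 0
    · refine ⟨1, by simp, ?_⟩
      rw [ha]
      simp only [zero_add, norm_zero, mul_one, Complex.norm_real, Real.norm_eq_abs]
      rw [abs_of_pos]
      have := h.pos 0
      positivity
    · have hn : (‖a.1‖ : ℂ) ≠ 0 := by simpa using ha
      have hn' : ‖a.1‖ ≠ 0 := by simpa using ha
      refine ⟨a.1 / ‖a.1‖, by simp [hn'], ?_⟩
      have : a.1 + ((R a / 2 : ℝ) : ℂ) * (a.1 / ‖a.1‖) =
          ((1 + R a / 2 / ‖a.1‖ : ℝ) : ℂ) * a.1 := by push_cast; field_simp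
      rw [this, norm_mul, Complex.norm_real, Real.norm_of_nonneg (by positivity)]
      field_simp
  set x := a.1 + ((R a / 2 : ℝ) : ℂ) * u with hx
  obtain ⟨b, hb, hxb⟩ := hcov x
  have hax : dist a.1 x = R a / 2 := by
    rw [hx, dist_eq_norm, sub_add_cancel_left, norm_neg, norm_mul, hu1, Complex.norm_real,
      Real.norm_of_nonneg (by positivity), mul_one]
  have h1 := h.lip b x
  have h2 := h.lip x a
  have h3 := dist_triangle a.1 x b
  rw [dist_comm b x] at h1
  rw [dist_comm x a.1] at h2
  have h4 : ‖x‖ ≤ ‖b‖ + dist x b := by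
    rw [dist_eq_norm]; have := norm_add_le b (x - b); simpa using this
  refine ⟨⟨b, hb⟩, ?_, ?_⟩
  · show ‖a.1‖ < ‖b‖
    linarith
  · show dist a.1 b ≤ _
    linarith

lemma exists_partition (h : RSetup μ C M R) (nmin : ℕ)
    (hM : 2 * π * (nmin + 2) * C ^ 7 ≤ M) {Λ : Set ℂ} (hΛ : Sep R Λ)
    (hcov : ∀ z, ∃ a ∈ Λ, dist z a ≤ R a / 19) :
    ∃ (ν : Λ → Measure ℂ) (n : Λ → ℕ), (∀ a, nmin ≤ n a) ∧
      (∀ a, ν a univ = n a) ∧ (∀ a, ν a (ball a.1 (2 * R a))ᶜ = 0) ∧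
      Measure.sum ν = ENNReal.ofReal (2 * π)⁻¹ • μ := by
  have hC := h.dbl.one_le
  have hpi := Real.pi_pos
  have hcount : Countable Λ := (h.countable hΛ).to_subtype
  obtain ⟨Q, hQm, hQd, hQu, hQin, hQout⟩ := h.exists_cells hΛ hcov
  choose par hpar1 hpar2 using h.exists_parent hcov
  have hQfin : ∀ a, μ (Q a) ≠ ∞ := fun a =>
    ((measure_mono ((hQout a).trans (closedBall_subset_ball
      (lt_add_one (R a / 19))))).trans_lt (h.dbl.fin _ _)).ne
  have hQmass : ∀ a, 2 * π * (nmin + 2) ≤ μ.real (Q a) := by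
    intro a
    have h1 := h.low_frac a 6
    have h2 : μ.real (ball a.1 (R a / 2 ^ 6)) ≤ μ.real (Q a) := by
      apply measureReal_mono _ (hQfin a)
      norm_num
      exact hQin a
    have h3 : (2 * π * (nmin + 2)) * C ^ 7 ≤ μ.real (Q a) * C ^ 7 := by
      calc _ ≤ M := hM
        _ ≤ C ^ 7 * μ.real (ball a.1 (R a / 2 ^ 6)) := h1
        _ ≤ C ^ 7 * μ.real (Q a) := by gcongr
        _ = _ := by ring
    exact le_of_mul_le_mul_right h3 (by positivity)
  have hchild : ∀ c a : Λ, par c = a → R c ≤ 12 / 5 * R a ∧ dist c.1 a.1 ≤ 7 / 5 * R a := by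
    rintro c a rfl
    have h1 := hpar2 c
    have h2 := h.lip c (par c)
    constructor <;> linarith
  have hchfin : ∀ a : Λ, {c : Λ | par c = a}.Finite := by
    intro a
    have := h.finite_ball hΛ a.1 (7 / 5 * R a)
    refine Set.Finite.of_finite_image (f := Subtype.val) (this.subset ?_) Subtype.val_injective.injOn
    rintro _ ⟨c, hc, rfl⟩
    exact ⟨c.2, (hchild c a hc).2⟩
  set ch : Λ → Finset Λ := fun a => (hchfin a).toFinset with hch
  have hmemch : ∀ a c, c ∈ ch a ↔ par c = a := by intro a c; simp [hch]
  have hlowfin : ∀ a : Λ, {b : Λ | ‖b.1‖ < ‖a.1‖}.Finite := by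
    intro a
    have := h.finite_ball hΛ 0 ‖a.1‖
    refine Set.Finite.of_finite_image (f := Subtype.val) (this.subset ?_) Subtype.val_injective.injOn
    rintro _ ⟨c, hc, rfl⟩
    exact ⟨c.2, by rw [dist_zero_right]; exact le_of_lt hc⟩
  set N : Λ → ℕ := fun a => {b : Λ | ‖b.1‖ < ‖a.1‖}.ncard with hN
  have hNlt : ∀ a b : Λ, ‖a.1‖ < ‖b.1‖ → N a < N b := by
    intro a b hab
    refine Set.ncard_lt_ncard ⟨fun c hc => ?_, fun hsub => ?_⟩ (hlowfin b)
    · exact lt_trans (show ‖c.1‖ < ‖a.1‖ from hc) hab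
    · exact lt_irrefl _ (show ‖a.1‖ < ‖a.1‖ from hsub hab)
  set m : Λ → ℝ := fun a => μ.real (Q a) / (2 * π) with hm
  obtain ⟨l, hl⟩ := greedy (X := ℝ) N (fun a f x => x = Int.fract (m a + ∑ c ∈ ch a, f c)) (by
    intro a f f' x hff hx
    rw [hx]
    congr 2
    apply Finset.sum_congr rfl
    intro c hc
    apply hff
    apply hNlt
    rw [hmemch] at hc
    rw [← hc]
    exact hpar1 c) (fun a f _ => ⟨_, rfl⟩)
  have hl0 : ∀ a, 0 ≤ l a := fun a => by rw [hl]; exact Int.fract_nonneg _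
  have hl1 : ∀ a, l a < 1 := fun a => by rw [hl]; exact Int.fract_lt_one _
  have hm2 : ∀ a, (nmin : ℝ) + 2 ≤ m a := by
    intro a
    rw [hm, le_div_iff₀ (by positivity)]
    linarith [hQmass a]
  have hQpos : ∀ a, 0 < μ.real (Q a) := by
    intro a
    refine lt_of_lt_of_le ?_ (hQmass a)
    positivity
  set w2 : Λ → ℝ := fun a => l a / μ.real (Q a) with hw2
  set w1 : Λ → ℝ := fun a => (2 * π)⁻¹ - w2 a with hw1
  have hw20 : ∀ a, 0 ≤ w2 a := fun a => div_nonneg (hl0 a) (hQpos a).le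
  have hw10 : ∀ a, 0 ≤ w1 a := by
    intro a
    rw [hw1, sub_nonneg, hw2]
    show l a / μ.real (Q a) ≤ (2 * π)⁻¹
    rw [div_le_iff₀ (hQpos a), inv_mul_eq_div]
    have := hm2 a
    have h1 : m a = μ.real (Q a) / (2 * π) := rfl
    rw [← h1]
    have : (0:ℝ) ≤ nmin := Nat.cast_nonneg _
    linarith [hl1 a]
  set W : Λ → Λ → ℝ≥0∞ := fun c a => (if c = a then ENNReal.ofReal (w1 a) else 0) +
    (if par c = a then ENNReal.ofReal (w2 c) else 0) with hW
  set ν : Λ → Measure ℂ := fun a => Measure.sum fun c => W c a • μ.restrict (Q c) with hν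
  have hWsum : ∀ c, ∑' a, W c a = ENNReal.ofReal (2 * π)⁻¹ := by
    intro c
    simp only [hW]
    rw [ENNReal.tsum_add]
    rw [tsum_eq_single c (by intro b hb; rw [if_neg hb.symm]),
      tsum_eq_single (par c) (by intro b hb; rw [if_neg hb.symm])]
    rw [if_pos rfl, if_pos rfl, ← ENNReal.ofReal_add (hw10 c) (hw20 c)]
    congr 1
    simp [hw1]
  have hμQ : ∀ a, μ (Q a) = ENNReal.ofReal (μ.real (Q a)) := fun a =>
    (ENNReal.ofReal_toReal (hQfin a)).symm
  have htot : ∀ a, ν a univ = ENNReal.ofReal (m a - l a + ∑ c ∈ ch a, l c) := by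
    intro a
    simp only [hν]
    rw [Measure.sum_apply _ MeasurableSet.univ]
    simp only [Measure.smul_apply, Measure.restrict_apply MeasurableSet.univ, univ_inter,
      smul_eq_mul, hW, add_mul]
    rw [ENNReal.tsum_add, tsum_eq_single a (by intro b hb; rw [if_neg hb, zero_mul]),
      tsum_eq_sum (s := ch a) (by intro b hb; rw [hmemch] at hb; rw [if_neg hb, zero_mul])]
    rw [if_pos rfl, hμQ, ← ENNReal.ofReal_mul (hw10 a), ENNReal.ofReal_add _ (Finset.sum_nonneg fun c _ => hl0 c),
      ENNReal.ofReal_sum_of_nonneg (fun c _ => hl0 c)]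
    · congr 1
      · congr 1
        have := (hQpos a).ne'
        simp only [hw1, hw2, hm]
        field_simp
      · apply Finset.sum_congr rfl
        intro c hc
        rw [hmemch] at hc
        rw [if_pos hc, hμQ, ← ENNReal.ofReal_mul (hw20 c)]
        congr 1
        have := (hQpos c).ne'
        simp only [hw2]
        field_simp
    · have : (0:ℝ) ≤ nmin := Nat.cast_nonneg _
      linarith [hm2 a, hl1 a]
  have hfl : ∀ a, m a - l a + ∑ c ∈ ch a, l c = (⌊m a + ∑ c ∈ ch a, l c⌋₊ : ℝ) := by
    intro a
    have h0 : 0 ≤ m a + ∑ c ∈ ch a, l c := by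
      have h1 : 0 ≤ ∑ c ∈ ch a, l c := Finset.sum_nonneg fun c _ => hl0 c
      have : (0:ℝ) ≤ nmin := Nat.cast_nonneg _
      linarith [hm2 a]
    have h2 := hl a
    rw [natCast_floor_eq_intCast_floor h0]
    have := Int.floor_add_fract (m a + ∑ c ∈ ch a, l c)
    linarith
  refine ⟨ν, fun a => ⌊m a + ∑ c ∈ ch a, l c⌋₊, ?_, ?_, ?_, ?_⟩
  · intro a
    apply Nat.le_floor
    have h1 : 0 ≤ ∑ c ∈ ch a, l c := Finset.sum_nonneg fun c _ => hl0 c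
    linarith [hm2 a]
  · intro a
    rw [htot, hfl]
    simp
  · intro a
    simp only [hν]
    rw [Measure.sum_apply _ measurableSet_ball.compl, ENNReal.tsum_eq_zero]
    intro c
    rw [Measure.smul_apply, Measure.restrict_apply measurableSet_ball.compl, smul_eq_mul]
    have hRa := h.pos a
    by_cases hca : c = a
    · have : (ball a.1 (2 * R a))ᶜ ∩ Q c = ∅ := by
        rw [hca]
        ext x
        simp only [mem_inter_iff, mem_compl_iff, mem_ball, not_lt, mem_empty_iff_false, iff_false,
          not_and]
        intro hx hxQ
        have := hQout a hxQ
        rw [mem_closedBall] at this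
        linarith
      rw [this]; simp
    by_cases hpc : par c = a
    · have : (ball a.1 (2 * R a))ᶜ ∩ Q c = ∅ := by
        ext x
        simp only [mem_inter_iff, mem_compl_iff, mem_ball, not_lt, mem_empty_iff_false, iff_false,
          not_and]
        intro hx hxQ
        have h1 := hQout c hxQ
        rw [mem_closedBall] at h1
        have h2 := hchild c a hpc
        have h3 := dist_triangle x c.1 a.1
        linarith
      rw [this]; simp
    · simp only [hW]
      rw [if_neg hca, if_neg hpc]; simp
  · ext s hs
    rw [Measure.sum_apply _ hs]
    simp only [hν, Measure.sum_apply _ hs, Measure.smul_apply, smul_eq_mul]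
    rw [ENNReal.tsum_comm]
    simp only [ENNReal.tsum_mul_right, hWsum]
    rw [ENNReal.tsum_mul_left]
    congr 1
    have := Measure.restrict_iUnion (μ := μ) hQd hQm
    rw [hQu, Measure.restrict_univ] at this
    conv_rhs => rw [this]
    rw [Measure.sum_apply _ hs]

end RSetup

lemma abs_log_norm_one_add {d : ℂ} (hd : ‖d‖ ≤ 1 / 2) : |Real.log ‖1 + d‖| ≤ 2 * ‖d‖ := by
  have h0 := norm_nonneg d
  have h1 : ‖1 + d‖ ≤ 1 + ‖d‖ := by simpa using norm_add_le 1 d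
  have h2 : 1 - ‖d‖ ≤ ‖1 + d‖ := by
    have := norm_sub_norm_le (1 : ℂ) (-d)
    simpa using this
  have hpos : 0 < ‖1 + d‖ := by linarith
  rw [abs_le]
  constructor
  · have h3 := Real.one_sub_inv_le_log_of_pos (show 0 < 1 - ‖d‖ by linarith)
    have h4 : Real.log (1 - ‖d‖) ≤ Real.log ‖1 + d‖ := Real.log_le_log (by linarith) h2
    have h5 : (1 - ‖d‖)⁻¹ ≤ 1 + 2 * ‖d‖ := by
      rw [inv_le_iff_one_le_mul₀ (by linarith)]
      nlinarith
    linarith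
  · have h3 := Real.log_le_sub_one_of_pos hpos
    linarith

/-- The polar part. -/
def polar (N : ℕ) (p : ℕ → ℂ) (w : ℂ) : ℂ := ∑ k ∈ Finset.range N, p k / (k + 1) * (w ^ (k + 1))⁻¹

def Shat (N : ℕ) (p : ℕ → ℂ) : Polynomial ℂ :=
  ∑ k ∈ Finset.range N, Polynomial.C (p k / (k + 1)) * Polynomial.X ^ (N - 1 - k)

def Prest (N n : ℕ) (p : ℕ → ℂ) : Polynomial ℂ :=
  ∑ j ∈ Finset.range N, Polynomial.C ((-1) ^ (j + 1) / ((j + 1).factorial : ℂ)) *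
    (Polynomial.X ^ (n - 1 - N * (j + 1)) * Shat N p ^ (j + 1))

def Ppol (N n : ℕ) (p : ℕ → ℂ) : Polynomial ℂ := Polynomial.X ^ (n - 1) + Prest N n p

lemma polar_norm {N : ℕ} {p : ℕ → ℂ} {T : ℝ} (hp : ∀ k, ‖p k‖ ≤ T) {w : ℂ} (hw : 1 ≤ ‖w‖) :
    ‖polar N p w‖ ≤ N * T / ‖w‖ := by
  have hT : 0 ≤ T := (norm_nonneg _).trans (hp 0)
  have hw0 : 0 < ‖w‖ := by linarith
  calc ‖polar N p w‖ ≤ ∑ k ∈ Finset.range N, T / ‖w‖ := by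
        apply norm_sum_le_of_le
        intro k _
        rw [norm_mul, norm_div, norm_inv, norm_pow, div_eq_mul_inv T]
        have h1 : ‖p k‖ / ‖(k + 1 : ℂ)‖ ≤ T := by
          have : ‖(k + 1 : ℂ)‖ = k + 1 := by
            have := Complex.norm_natCast (k + 1); push_cast at this; exact this
          rw [this, div_le_iff₀ (by positivity)]
          have := hp k
          have : (0:ℝ) ≤ k := Nat.cast_nonneg _
          nlinarith
        gcongr
        exact le_self_pow₀ hw (by omega)
    _ = _ := by simp; ring

lemma Shat_eval {N : ℕ} {p : ℕ → ℂ} {w : ℂ} (hw : w ≠ 0) :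
    (Shat N p).eval w = w ^ N * polar N p w := by
  simp only [Shat, polar, Polynomial.eval_finsetSum, Polynomial.eval_mul, Polynomial.eval_C,
    Polynomial.eval_pow, Polynomial.eval_X, Finset.mul_sum]
  apply Finset.sum_congr rfl
  intro k hk
  rw [Finset.mem_range] at hk
  have : w ^ N = w ^ (N - 1 - k) * w ^ (k + 1) := by rw [← pow_add]; congr 1; omega
  rw [this]
  field_simp

lemma Ppol_eval {N n : ℕ} {p : ℕ → ℂ} {w : ℂ} (hw : w ≠ 0) (hn : N * N + N + 3 ≤ n) :
    (Ppol N n p).eval w = w ^ (n - 1) *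
      ∑ m ∈ Finset.range (N + 1), (-polar N p w) ^ m / (m.factorial : ℂ) := by
  rw [Finset.sum_range_succ']
  simp only [Ppol, Prest, Polynomial.eval_add, Polynomial.eval_finsetSum, Polynomial.eval_mul,
    Polynomial.eval_C, Polynomial.eval_pow, Polynomial.eval_X, Shat_eval hw]
  rw [mul_add, Finset.mul_sum, add_comm]
  congr 1
  · apply Finset.sum_congr rfl
    intro j hj
    rw [Finset.mem_range] at hj
    have hle : N * (j + 1) ≤ N * N := Nat.mul_le_mul_left _ (by omega)
    have : w ^ (n - 1) = w ^ (n - 1 - N * (j + 1)) * w ^ (N * (j + 1)) := by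
      rw [← pow_add]; congr 1; omega
    rw [this, mul_pow, ← pow_mul, neg_pow (polar N p w)]
    ring
  · simp

lemma Shat_natDegree {N : ℕ} {p : ℕ → ℂ} : (Shat N p).natDegree ≤ N - 1 := by
  apply Polynomial.natDegree_sum_le_of_forall_le
  intro k _
  refine (Polynomial.natDegree_C_mul_X_pow_le _ _).trans (by omega)

lemma Prest_degree {N n : ℕ} {p : ℕ → ℂ} (hn : N * N + N + 3 ≤ n) :
    (Prest N n p).natDegree < n - 1 := by
  have : (Prest N n p).natDegree ≤ n - 2 := by
    apply Polynomial.natDegree_sum_le_of_forall_le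
    intro j hj
    rw [Finset.mem_range] at hj
    refine (Polynomial.natDegree_C_mul_le _ _).trans ?_
    refine Polynomial.natDegree_mul_le.trans ?_
    rw [Polynomial.natDegree_X_pow]
    have h1 : (Shat N p ^ (j + 1)).natDegree ≤ (j + 1) * (N - 1) :=
      Polynomial.natDegree_pow_le.trans (Nat.mul_le_mul_left _ Shat_natDegree)
    have hle : N * (j + 1) ≤ N * N := Nat.mul_le_mul_left _ (by omega)
    have h2 : (j + 1) * (N - 1) + (j + 1) = N * (j + 1) := by
      obtain ⟨N', rfl⟩ : ∃ N', N = N' + 1 := ⟨N - 1, by omega⟩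
      simp; ring
    omega
  omega

lemma Ppol_monic {N n : ℕ} {p : ℕ → ℂ} (hn : N * N + N + 3 ≤ n) : (Ppol N n p).Monic := by
  apply Polynomial.monic_X_pow_add
  by_cases h0 : Prest N n p = 0
  · rw [h0, Polynomial.degree_zero]; exact WithBot.bot_lt_coe _
  rw [Polynomial.degree_eq_natDegree h0]
  exact_mod_cast Prest_degree hn

lemma Ppol_natDegree {N n : ℕ} {p : ℕ → ℂ} (hn : N * N + N + 3 ≤ n) :
    (Ppol N n p).natDegree = n - 1 := by
  rw [Ppol, Polynomial.natDegree_add_eq_left_of_natDegree_lt] <;> rw [Polynomial.natDegree_X_pow]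
  exact Prest_degree hn

lemma Ppol_zero {N n : ℕ} {p : ℕ → ℂ} (hn : N * N + N + 3 ≤ n) : (Ppol N n p).eval 0 = 0 := by
  simp only [Ppol, Prest, Polynomial.eval_add, Polynomial.eval_finsetSum, Polynomial.eval_mul,
    Polynomial.eval_C, Polynomial.eval_pow, Polynomial.eval_X]
  rw [zero_pow (by omega), zero_add]
  apply Finset.sum_eq_zero
  intro j hj
  rw [Finset.mem_range] at hj
  have hle : N * (j + 1) ≤ N * N := Nat.mul_le_mul_left _ (by omega)
  rw [zero_pow (by omega)]
  ring

lemma Shat_bound {N : ℕ} {p : ℕ → ℂ} {T : ℝ} (hp : ∀ k, ‖p k‖ ≤ T) {w : ℂ} {X : ℝ} (hX : 1 ≤ X)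
    (hw : ‖w‖ ≤ X) : ‖(Shat N p).eval w‖ ≤ N * (T * X ^ N) := by
  have hT : 0 ≤ T := (norm_nonneg _).trans (hp 0)
  simp only [Shat, Polynomial.eval_finsetSum, Polynomial.eval_mul, Polynomial.eval_C,
    Polynomial.eval_pow, Polynomial.eval_X]
  calc _ ≤ ∑ k ∈ Finset.range N, T * X ^ N := by
        apply norm_sum_le_of_le
        intro k _
        rw [norm_mul, norm_div, norm_pow]
        have h1 : ‖p k‖ / ‖(k + 1 : ℂ)‖ ≤ T := by
          have : ‖(k + 1 : ℂ)‖ = k + 1 := by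
            have := Complex.norm_natCast (k + 1); push_cast at this; exact this
          rw [this, div_le_iff₀ (by positivity)]
          have := hp k
          have : (0:ℝ) ≤ k := Nat.cast_nonneg _
          nlinarith
        gcongr
        calc ‖w‖ ^ (N - 1 - k) ≤ X ^ (N - 1 - k) := by gcongr
          _ ≤ X ^ N := pow_le_pow_right₀ hX (by omega)
    _ = _ := by simp

lemma Ppol_bound {N n nmax : ℕ} {p : ℕ → ℂ} {T : ℝ} (hT : 1 ≤ T) (hp : ∀ k, ‖p k‖ ≤ T)
    {w : ℂ} {X : ℝ} (hX : 1 ≤ X)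
    (hw : ‖w‖ ≤ X) (hn : n ≤ nmax) :
    ‖(Ppol N n p).eval w‖ ≤ X ^ nmax + N * (X ^ nmax * (N * (T * X ^ N) + 1) ^ N) := by
  simp only [Ppol, Prest, Polynomial.eval_add, Polynomial.eval_finsetSum, Polynomial.eval_mul,
    Polynomial.eval_C, Polynomial.eval_pow, Polynomial.eval_X]
  have hpw : ∀ k, k ≤ nmax → ‖w ^ k‖ ≤ X ^ nmax := by
    intro k hk
    rw [norm_pow]
    calc ‖w‖ ^ k ≤ X ^ k := by gcongr
      _ ≤ _ := pow_le_pow_right₀ hX hk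
  refine (norm_add_le _ _).trans (add_le_add (hpw _ (by omega)) ?_)
  calc _ ≤ ∑ k ∈ Finset.range N, (X ^ nmax * (N * (T * X ^ N) + 1) ^ N) := by
        apply norm_sum_le_of_le
        intro j hj
        rw [Finset.mem_range] at hj
        rw [norm_mul, norm_mul, norm_div, norm_pow, norm_neg, norm_one, one_pow,
          Complex.norm_natCast]
        have h1 : 1 / ((j + 1).factorial : ℝ) ≤ 1 := by
          rw [div_le_one (by positivity)]
          exact_mod_cast Nat.succ_le_of_lt (Nat.factorial_pos _)
        have h2 : ‖(Shat N p).eval w ^ (j + 1)‖ ≤ (N * (T * X ^ N) + 1) ^ N := by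
          rw [norm_pow]
          calc ‖(Shat N p).eval w‖ ^ (j + 1) ≤ (N * (T * X ^ N) + 1) ^ (j + 1) := by
                gcongr
                linarith [Shat_bound hp hX hw (N := N)]
            _ ≤ _ := pow_le_pow_right₀ (by
                have : 0 ≤ N * (T * X ^ N) := by positivity
                linarith) (by omega)
        have h3 := hpw (n - 1 - N * (j + 1)) (by omega)
        calc _ ≤ 1 * (X ^ nmax * (N * (T * X ^ N) + 1) ^ N) := by gcongr
          _ = _ := one_mul _
    _ = _ := by simp

/-- Main far asymptotics and boundedness of the model polynomial. -/
lemma Ppol_asymp (N nmax : ℕ) : ∃ A K : ℝ, 2 ≤ A ∧ 1 ≤ K ∧ ∀ (n : ℕ) (p : ℕ → ℂ),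
    N * N + N + 3 ≤ n → n ≤ nmax → (∀ k, ‖p k‖ ≤ n) →
    (∀ (B w : ℂ), ‖B‖ ≤ 1 → A ≤ ‖w‖ → (Ppol N n p).eval w ≠ B ∧
      |Real.log ‖w * ((Ppol N n p).eval w - B)‖ - (n * Real.log ‖w‖ - (polar N p w).re)| ≤
        K / ‖w‖ ^ (N + 1)) ∧
    (∀ w : ℂ, ‖w‖ ≤ A + 3 → ‖(Ppol N n p).eval w‖ ≤ K) := by
  set T : ℝ := (nmax : ℝ) with hT
  have hT0 : 0 ≤ T := Nat.cast_nonneg _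
  set E : ℝ := N * T with hE
  have hE0 : 0 ≤ E := by positivity
  set K1 : ℝ := Real.exp E * (E ^ (N + 1) * Real.exp E + 1) with hK1
  have hK10 : 0 ≤ K1 := by positivity
  set A : ℝ := 2 * K1 + 2 with hA
  set K2 : ℝ := (A + 3) ^ nmax + N * ((A + 3) ^ nmax * (N * ((T + 1) * (A + 3) ^ N) + 1) ^ N)
    with hK2
  have hK20 : 0 ≤ K2 := by positivity
  refine ⟨A, 2 * K1 + K2 + 1, by linarith, by linarith, ?_⟩
  intro n p hn1 hn2 hp
  have hnT : (n : ℝ) ≤ T := by rw [hT]; exact_mod_cast hn2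
  have hpT : ∀ k, ‖p k‖ ≤ T := fun k => (hp k).trans hnT
  constructor
  · intro B w hB hw
    have hw1 : 1 ≤ ‖w‖ := by linarith
    have hw0 : w ≠ 0 := by rintro rfl; simp at hw1; linarith
    have hwp : 0 < ‖w‖ := by linarith
    set S := polar N p w with hS
    have hSn : ‖S‖ ≤ E / ‖w‖ := polar_norm hpT hw1
    have hSE : ‖S‖ ≤ E := hSn.trans (div_le_self hE0 hw1)
    set tr := ∑ m ∈ Finset.range (N + 1), (-S) ^ m / (m.factorial : ℂ) with htr
    have hexp := Complex.norm_exp_sub_sum_le_norm_mul_exp (-S) (N + 1)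
    rw [norm_neg, ← htr] at hexp
    set d : ℂ := Complex.exp S * (tr - Complex.exp (-S) - B / w ^ (n - 1)) with hd
    have heq : w * ((Ppol N n p).eval w - B) = w ^ n * (Complex.exp (-S) * (1 + d)) := by
      rw [Ppol_eval hw0 hn1, ← hS, ← htr, hd]
      have h1 : Complex.exp (-S) * Complex.exp S = 1 := by rw [← Complex.exp_add]; simp
      have h2 : w ^ n = w * w ^ (n - 1) := by rw [← pow_succ']; congr 1; omega
      have h3 : w ^ (n - 1) ≠ 0 := pow_ne_zero _ hw0
      rw [mul_add, ← mul_assoc, h1, one_mul, mul_one, h2]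
      field_simp
      ring
    have hdn : ‖d‖ ≤ K1 / ‖w‖ ^ (N + 1) := by
      rw [hd, norm_mul]
      have h1 : ‖Complex.exp S‖ ≤ Real.exp E := by
        rw [Complex.norm_exp]
        exact Real.exp_le_exp.2 ((Complex.re_le_norm S).trans hSE)
      have h2 : ‖tr - Complex.exp (-S)‖ ≤ E ^ (N + 1) * Real.exp E / ‖w‖ ^ (N + 1) := by
        rw [norm_sub_rev]
        calc _ ≤ ‖S‖ ^ (N + 1) * Real.exp ‖S‖ := hexp
          _ ≤ (E / ‖w‖) ^ (N + 1) * Real.exp E := by gcongr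
          _ = _ := by rw [div_pow]; ring
      have h3 : ‖B / w ^ (n - 1)‖ ≤ 1 / ‖w‖ ^ (N + 1) := by
        rw [norm_div, norm_pow]
        have : ‖w‖ ^ (N + 1) ≤ ‖w‖ ^ (n - 1) := pow_le_pow_right₀ hw1 (by nlinarith [Nat.sub_add_cancel (show 1 ≤ n by omega)])
        gcongr
      calc _ ≤ Real.exp E * (E ^ (N + 1) * Real.exp E / ‖w‖ ^ (N + 1) + 1 / ‖w‖ ^ (N + 1)) := by
            gcongr
            exact (norm_sub_le _ _).trans (add_le_add h2 h3)
        _ = _ := by rw [hK1]; ring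
    have hd2 : ‖d‖ ≤ 1 / 2 := by
      refine hdn.trans ?_
      rw [div_le_div_iff₀ (by positivity) (by norm_num)]
      have : ‖w‖ ≤ ‖w‖ ^ (N + 1) := le_self_pow₀ hw1 (by omega)
      linarith
    have hd1 : 1 + d ≠ 0 := by
      intro h0
      have : d = -1 := by linear_combination h0
      rw [this] at hd2
      norm_num at hd2
    have hne : w * ((Ppol N n p).eval w - B) ≠ 0 := by
      rw [heq]
      exact mul_ne_zero (pow_ne_zero _ hw0) (mul_ne_zero (Complex.exp_ne_zero _) hd1)
    refine ⟨fun h => hne (by rw [h]; simp), ?_⟩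
    rw [heq, norm_mul, norm_mul, norm_pow, Real.log_mul (by positivity)
      (mul_ne_zero (by simp) (norm_ne_zero_iff.2 hd1)),
      Real.log_mul (by simp) (norm_ne_zero_iff.2 hd1), Real.log_pow, Complex.norm_exp,
      Real.log_exp, Complex.neg_re]
    have : n * Real.log ‖w‖ + (-S.re + Real.log ‖1 + d‖) - (n * Real.log ‖w‖ - S.re) =
      Real.log ‖1 + d‖ := by ring
    rw [this]
    calc _ ≤ 2 * ‖d‖ := abs_log_norm_one_add hd2
      _ ≤ 2 * (K1 / ‖w‖ ^ (N + 1)) := by gcongr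
      _ = (2 * K1) / ‖w‖ ^ (N + 1) := by ring
      _ ≤ _ := by gcongr; linarith
  · intro w hw
    have := Ppol_bound (N := N) (n := n) (nmax := nmax) (p := p) (T := T + 1) (by linarith)
      (fun k => (hpT k).trans (by linarith)) (X := A + 3) (by linarith) hw hn2
    linarith

/-- pigeonhole choice of a value. -/
lemma exists_avoid (J : ℕ) (V : Finset ℂ) (hV : V.card ≤ J) :
    ∃ B : ℂ, ‖B‖ ≤ 1 ∧ ∀ v ∈ V, 1 / (2 * ((J : ℝ) + 1)) ≤ ‖v - B‖ := by
  by_contra hno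
  push Not at hno
  set c : ℕ → ℂ := fun k => (((k : ℝ) / ((J : ℝ) + 1) : ℝ) : ℂ) with hc
  have h1 : ∀ k ∈ Finset.range (J + 1), ∃ v ∈ V, ‖v - c k‖ < 1 / (2 * ((J : ℝ) + 1)) := by
    intro k hk
    rw [Finset.mem_range] at hk
    apply hno
    rw [hc, Complex.norm_real, Real.norm_of_nonneg (by positivity), div_le_one (by positivity)]
    exact_mod_cast hk.le
  choose! f hf1 hf2 using h1
  have hmaps : ∀ k ∈ Finset.range (J + 1), f k ∈ V := hf1
  obtain ⟨x, hx, y, hy, hxy, hfxy⟩ := Finset.exists_ne_map_eq_of_card_lt_of_maps_to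
    (by rw [Finset.card_range]; omega) hmaps
  have h2 := hf2 x hx
  have h3 := hf2 y hy
  rw [hfxy] at h2
  have h4 : ‖c x - c y‖ < 1 / ((J : ℝ) + 1) := by
    calc ‖c x - c y‖ = ‖(f y - c y) - (f y - c x)‖ := by congr 1; ring
      _ ≤ ‖f y - c y‖ + ‖f y - c x‖ := norm_sub_le _ _
      _ < 1 / (2 * ((J : ℝ) + 1)) + 1 / (2 * ((J : ℝ) + 1)) := add_lt_add h3 h2
      _ = _ := by field_simp; norm_num
  rw [hc] at h4
  simp only at h4
  rw [← Complex.ofReal_sub, Complex.norm_real, ← sub_div, Real.norm_eq_abs, abs_div,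
    abs_of_pos (show (0:ℝ) < J + 1 by positivity)] at h4
  have h5 : |(x : ℝ) - y| < 1 := by
    rwa [div_lt_div_iff_of_pos_right (by positivity)] at h4
  have h6 : (1:ℤ) ≤ |(x:ℤ) - y| := Int.one_le_abs (by omega)
  have h7 : (1:ℝ) ≤ |(x:ℝ) - y| := by exact_mod_cast h6
  linarith

lemma multiset_prod_low {t : ℝ} (ht : 0 ≤ t) (w : ℂ) (s : Multiset ℂ) (hs : ∀ c ∈ s, t ≤ ‖w - c‖) :
    t ^ s.card ≤ ‖(s.map (fun c => w - c)).prod‖ := by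
  induction s using Multiset.induction_on with
  | empty => simp
  | cons a s ih =>
    rw [Multiset.map_cons, Multiset.prod_cons, Multiset.card_cons, norm_mul, pow_succ']
    have h1 := hs a (Multiset.mem_cons_self a s)
    have h2 := ih (fun c hc => hs c (Multiset.mem_cons_of_mem hc))
    gcongr

lemma poly_low {p : Polynomial ℂ} (hl : 1 ≤ ‖p.leadingCoeff‖) {m : ℕ} (hd : p.natDegree ≤ m)
    {t : ℝ} (ht0 : 0 ≤ t) (ht1 : t ≤ 1) (w : ℂ) (hr : ∀ c, p.eval c = 0 → t ≤ ‖w - c‖) :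
    t ^ m ≤ ‖p.eval w‖ := by
  have hp : p ≠ 0 := by rintro rfl; simp at hl; linarith
  have hs : p.Splits := IsAlgClosed.splits p
  rw [hs.eval_eq_prod_roots, norm_mul]
  have h1 := multiset_prod_low ht0 w p.roots (fun c hc => hr c (by
    rw [Polynomial.mem_roots hp] at hc; exact hc))
  have h2 : t ^ m ≤ t ^ p.roots.card :=
    pow_le_pow_of_le_one ht0 ht1 ((Polynomial.card_roots' p).trans hd)
  calc t ^ m ≤ 1 * ‖(p.roots.map (fun c => w - c)).prod‖ := by rw [one_mul]; exact h2.trans h1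
    _ ≤ _ := by gcongr

lemma poly_deriv_bound {p : Polynomial ℂ} {X K : ℝ} (hK : ∀ w, ‖w‖ ≤ X + 1 → ‖p.eval w‖ ≤ K) :
    ∀ w, ‖w‖ ≤ X → ‖p.derivative.eval w‖ ≤ K := by
  intro w hw
  have := Complex.norm_deriv_le_of_forall_mem_sphere_norm_le (c := w) (R := 1) (C := K)
    (f := fun x => p.eval x) one_pos (Differentiable.diffContOnCl p.differentiable) (by
      intro z hz
      apply hK
      rw [mem_sphere, dist_eq_norm] at hz
      calc ‖z‖ = ‖w + (z - w)‖ := by congr 1; ring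
        _ ≤ ‖w‖ + ‖z - w‖ := norm_add_le _ _
        _ ≤ _ := by linarith)
  rw [Polynomial.deriv, div_one] at this
  exact this

lemma poly_lip {p : Polynomial ℂ} {X K : ℝ} (hK : ∀ w, ‖w‖ ≤ X + 1 → ‖p.eval w‖ ≤ K)
    {x y : ℂ} (hx : ‖x‖ ≤ X) (hy : ‖y‖ ≤ X) : ‖p.eval y - p.eval x‖ ≤ K * ‖y - x‖ := by
  apply Convex.norm_image_sub_le_of_norm_deriv_le (𝕜 := ℂ) (s := closedBall 0 X)
    (f := fun x => p.eval x)
  · exact fun x _ => p.differentiable x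
  · intro z hz
    rw [Polynomial.deriv]
    exact poly_deriv_bound hK z (by simpa using hz)
  · exact convex_closedBall _ _
  · simpa using hx
  · simpa using hy

lemma poly_taylor {p : Polynomial ℂ} {X K : ℝ} (hK : ∀ w, ‖w‖ ≤ X + 2 → ‖p.eval w‖ ≤ K)
    {x y : ℂ} (hx : ‖x‖ ≤ X) (hy : ‖y‖ ≤ X) :
    ‖p.eval y - p.eval x - p.derivative.eval x * (y - x)‖ ≤ K * ‖y - x‖ * ‖y - x‖ := by
  have hK1 : ∀ w, ‖w‖ ≤ X + 1 → ‖p.derivative.eval w‖ ≤ K :=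
    poly_deriv_bound (X := X + 1) (by intro w hw; exact hK w (by linarith))
  have hK0 : 0 ≤ K := (norm_nonneg _).trans (hK1 x (by linarith))
  have := Convex.norm_image_sub_le_of_norm_hasDerivWithin_le (𝕜 := ℂ) (C := K * ‖y - x‖)
    (s := closedBall 0 X ∩ closedBall x ‖y - x‖)
    (f := fun z => p.eval z - p.derivative.eval x * z)
    (f' := fun z => p.derivative.eval z - p.derivative.eval x * 1) (x := x) (y := y)
    (by
      intro z _
      exact ((p.hasDerivAt z).sub ((hasDerivAt_id z).const_mul _)).hasDerivWithinAt)
    (by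
      rintro z ⟨hz1, hz2⟩
      rw [mem_closedBall, dist_eq_norm, sub_zero] at hz1
      rw [mem_closedBall, dist_eq_norm] at hz2
      rw [mul_one]
      refine (poly_lip hK1 hx hz1).trans ?_
      gcongr)
    ((convex_closedBall _ _).inter (convex_closedBall _ _))
    ⟨by simpa using hx, by simp⟩ ⟨by simpa using hy, by simp [dist_eq_norm]⟩
  refine le_trans (le_of_eq ?_) this
  congr 1
  ring

/-- Uniform facts about the zeros of `w (P(w) - B)`. -/
lemma zero_group (A K η : ℝ) (nmax : ℕ) (hA : 1 ≤ A) (hK : 1 ≤ K) (hη : 0 < η) (hη1 : η ≤ 1)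
    (hn : 1 ≤ nmax) :
    ∃ δ c L : ℝ, 0 < δ ∧ δ ≤ 1 ∧ 0 < c ∧ 1 ≤ L ∧ ∀ (P : Polynomial ℂ) (B : ℂ), P.Monic →
      1 ≤ P.natDegree → P.natDegree ≤ nmax → (∀ w : ℂ, ‖w‖ ≤ A + 3 → ‖P.eval w‖ ≤ K) → ‖B‖ ≤ 1 →
      P.eval 0 = 0 → η ≤ ‖P.eval 0 - B‖ →
      (∀ w : ℂ, A ≤ ‖w‖ → P.eval w ≠ B) →
      (∀ x, P.derivative.eval x = 0 → η ≤ ‖P.eval x - B‖) →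
      (∀ w₁ w₂ : ℂ, w₁ * (P.eval w₁ - B) = 0 → w₂ * (P.eval w₂ - B) = 0 → w₁ ≠ w₂ →
        δ ≤ ‖w₁ - w₂‖) ∧
      (∀ x w : ℂ, η ≤ ‖P.eval x - B‖ → P.eval w = B → δ ≤ ‖x - w‖) ∧
      (∀ (w : ℂ) (s : ℝ), 0 ≤ s → s ≤ 1 → (∀ ζ : ℂ, ζ * (P.eval ζ - B) = 0 → s ≤ ‖w - ζ‖) →
        c * s ≤ ‖w * (P.eval w - B)‖) ∧
      (∀ w : ℂ, ‖w‖ ≤ A + 1 → ‖w * (P.eval w - B)‖ ≤ L) ∧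
      (∀ w ζ : ℂ, ‖w‖ ≤ A + 1 → ζ * (P.eval ζ - B) = 0 →
        ‖w * (P.eval w - B)‖ ≤ L * ‖w - ζ‖) := by
  set t := η / K with ht
  have ht0 : 0 < t := by positivity
  have ht1 : t ≤ 1 := by rw [ht, div_le_one (by linarith)]; linarith
  set δ := t ^ nmax / K with hδ
  have hδ0 : 0 < δ := by positivity
  have hδt : δ ≤ t := by
    calc δ ≤ t ^ nmax := div_le_self (by positivity) hK
      _ ≤ t ^ 1 := pow_le_pow_of_le_one ht0.le ht1 hn
      _ = t := pow_one t
  have hδ1 : δ ≤ 1 := hδt.trans ht1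
  refine ⟨δ, (δ / 2) ^ (nmax + 1), (A + 1) * K + (K + 1) + (A + 1) * (K + 1), hδ0, hδ1,
    by positivity, by nlinarith, ?_⟩
  intro P B hmon hd1 hd2 hPK hB hP0 h0 hfar hcrit
  -- roots are bounded
  have hroot : ∀ w, P.eval w = B → ‖w‖ ≤ A := by
    intro w hw
    by_contra hlt
    push Not at hlt
    exact hfar w hlt.le hw
  have h2 : ∀ x w : ℂ, η ≤ ‖P.eval x - B‖ → P.eval w = B → t ≤ ‖x - w‖ := by
    intro x w hx hw
    by_contra hlt
    push Not at hlt
    have hwA := hroot w hw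
    have hxA : ‖x‖ ≤ A + 2 := by
      have := norm_add_le w (x - w)
      rw [add_sub_cancel] at this
      linarith
    have := poly_lip (p := P) (X := A + 2) (K := K) (fun w hw => hPK w (by linarith))
      (show ‖w‖ ≤ A + 2 by linarith) hxA
    rw [hw] at this
    have h3 : K * ‖x - w‖ < K * t := by gcongr
    rw [ht, mul_div_cancel₀ _ (by linarith)] at h3
    linarith
  -- derivative lower bound at roots
  have hder : ∀ w, P.eval w = B → t ^ nmax ≤ ‖P.derivative.eval w‖ := by
    intro w hw
    apply poly_low _ _ ht0.le ht1
    · intro c hc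
      rw [norm_sub_rev]
      exact h2 c w (hcrit c hc) hw
    · rw [Polynomial.leadingCoeff_derivative, hmon.leadingCoeff, one_mul,
        Complex.norm_natCast]
      exact_mod_cast hd1
    · exact (Polynomial.natDegree_derivative_le P).trans (by omega)
  have hsep : ∀ w₁ w₂ : ℂ, w₁ * (P.eval w₁ - B) = 0 → w₂ * (P.eval w₂ - B) = 0 → w₁ ≠ w₂ →
        δ ≤ ‖w₁ - w₂‖ := by
    intro w₁ w₂ hw1 hw2 hne
    rcases mul_eq_zero.1 hw1 with rfl | e1 <;> rcases mul_eq_zero.1 hw2 with rfl | e2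
    · exact absurd rfl hne
    · exact hδt.trans (h2 0 w₂ h0 (sub_eq_zero.1 e2))
    · rw [norm_sub_rev]
      exact hδt.trans (h2 0 w₁ h0 (sub_eq_zero.1 e1))
    · have e1 := sub_eq_zero.1 e1
      have e2 := sub_eq_zero.1 e2
      have h3 := poly_taylor (p := P) (X := A) (K := K) (fun w hw => hPK w (by linarith))
        (hroot w₁ e1) (hroot w₂ e2)
      rw [e1, e2, sub_self, zero_sub, norm_neg, norm_mul] at h3
      have hpos : 0 < ‖w₂ - w₁‖ := norm_pos_iff.2 (sub_ne_zero.2 hne.symm)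
      have h4 := le_of_mul_le_mul_right h3 hpos
      rw [norm_sub_rev, hδ, div_le_iff₀ (by linarith)]
      linarith [hder w₁ e1]
  refine ⟨hsep, fun x w hx hw => hδt.trans (h2 x w hx hw), ?_, ?_, ?_⟩
  · intro w s hs0 hs1 hs
    set Q : Polynomial ℂ := Polynomial.X * (P - Polynomial.C B) with hQ
    have hQe : ∀ x, Q.eval x = x * (P.eval x - B) := by intro x; simp [hQ]
    have hmon2 : (P - Polynomial.C B).Monic := by
      apply hmon.sub_of_left
      refine lt_of_le_of_lt Polynomial.degree_C_le ?_
      rw [Polynomial.degree_eq_natDegree hmon.ne_zero]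
      exact_mod_cast hd1
    have hQmon : Q.Monic := Polynomial.monic_X.mul hmon2
    have hQdeg : Q.natDegree ≤ nmax + 1 := by
      rw [hQ, Polynomial.natDegree_X_mul hmon2.ne_zero, Polynomial.natDegree_sub_C]
      omega
    rw [← hQe]
    by_cases hnear : ∃ ζ, Q.eval ζ = 0 ∧ ‖w - ζ‖ < δ / 2
    · obtain ⟨ζ, hζ, hwζ⟩ := hnear
      obtain ⟨Q1, hQ1⟩ := Polynomial.dvd_iff_isRoot.2 hζ
      have hQ1mon : Q1.Monic := by
        have := hQmon
        rw [hQ1] at this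
        exact (Polynomial.monic_X_sub_C ζ).of_mul_monic_left this
      have hQ1deg : Q1.natDegree ≤ nmax := by
        rw [hQ1, (Polynomial.monic_X_sub_C ζ).natDegree_mul hQ1mon,
          Polynomial.natDegree_X_sub_C] at hQdeg
        omega
      have hQ1ζ : Q1.eval ζ ≠ 0 := by
        have e1 : Q.derivative.eval ζ = Q1.eval ζ := by
          rw [hQ1]; simp
        have e2 : Q.derivative.eval ζ = (P.eval ζ - B) + ζ * P.derivative.eval ζ := by
          rw [hQ]; simp
        rw [← e1, e2]
        rw [hQe] at hζ
        by_cases hζ0 : ζ = 0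
        · rw [hζ0, zero_mul, add_zero]
          intro h
          rw [h, norm_zero] at h0
          linarith
        · have e3 : P.eval ζ - B = 0 := by
            rcases mul_eq_zero.1 hζ with h | h
            · exact absurd h hζ0
            · exact h
          rw [e3, zero_add]
          apply mul_ne_zero hζ0
          intro h
          have := hder ζ (sub_eq_zero.1 e3)
          rw [h, norm_zero] at this
          have : 0 < t ^ nmax := by positivity
          linarith
      have hlow : (δ / 2) ^ nmax ≤ ‖Q1.eval w‖ := by
        apply poly_low (by rw [hQ1mon.leadingCoeff]; simp) hQ1deg (by positivity) (by linarith)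
        intro c hc
        have hcζ : c ≠ ζ := by rintro rfl; exact hQ1ζ hc
        have hQc : Q.eval c = 0 := by rw [hQ1, Polynomial.eval_mul, hc, mul_zero]
        have := hsep c ζ (by rw [← hQe]; exact hQc) (by rw [← hQe]; exact hζ) hcζ
        have h5 : ‖c - ζ‖ ≤ ‖w - c‖ + ‖w - ζ‖ := by
          rw [norm_sub_rev w c]
          have := norm_add_le (c - w) (w - ζ)
          rwa [sub_add_sub_cancel] at this
        linarith
      rw [hQ1, Polynomial.eval_mul, norm_mul]
      have e4 : s ≤ ‖(Polynomial.X - Polynomial.C ζ : Polynomial ℂ).eval w‖ := by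
        simp only [Polynomial.eval_sub, Polynomial.eval_X, Polynomial.eval_C]
        exact hs ζ (by rw [← hQe]; exact hζ)
      calc (δ / 2) ^ (nmax + 1) * s ≤ (δ / 2) ^ nmax * s := by
            have := pow_le_pow_of_le_one (show 0 ≤ δ / 2 by positivity) (by linarith)
              (Nat.le_succ nmax)
            gcongr
        _ = s * (δ / 2) ^ nmax := mul_comm _ _
        _ ≤ _ := by gcongr
    · push Not at hnear
      have := poly_low (p := Q) (by rw [hQmon.leadingCoeff]; simp) hQdeg (t := δ / 2)
        (by positivity) (by linarith) w hnear
      calc (δ / 2) ^ (nmax + 1) * s ≤ (δ / 2) ^ (nmax + 1) * 1 := by gcongr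
        _ ≤ _ := by rw [mul_one]; exact this
  · intro w hw
    rw [norm_mul]
    have h3 := hPK w (by linarith)
    have h4 := norm_sub_le (P.eval w) B
    have : ‖w‖ * ‖P.eval w - B‖ ≤ (A + 1) * (K + 1) := by gcongr; linarith
    nlinarith
  · intro w ζ hw hζ
    have hζA : ‖ζ‖ ≤ A := by
      rcases mul_eq_zero.1 hζ with rfl | h
      · simp; linarith
      · exact hroot ζ (sub_eq_zero.1 h)
    have h3 := poly_lip (p := P) (X := A + 2) (K := K) (fun w hw => hPK w (by linarith))
      (show ‖ζ‖ ≤ A + 2 by linarith) (show ‖w‖ ≤ A + 2 by linarith)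
    have h4 : ‖P.eval ζ - B‖ ≤ K + 1 :=
      (norm_sub_le _ _).trans (add_le_add (hPK ζ (by linarith)) hB)
    calc ‖w * (P.eval w - B)‖ = ‖w * (P.eval w - B) - ζ * (P.eval ζ - B)‖ := by rw [hζ, sub_zero]
      _ = ‖w * (P.eval w - P.eval ζ) + (w - ζ) * (P.eval ζ - B)‖ := by congr 1; ring
      _ ≤ ‖w‖ * ‖P.eval w - P.eval ζ‖ + ‖w - ζ‖ * ‖P.eval ζ - B‖ := by
          refine (norm_add_le _ _).trans ?_
          rw [norm_mul, norm_mul]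
      _ ≤ (A + 1) * (K * ‖w - ζ‖) + ‖w - ζ‖ * (K + 1) := by gcongr
      _ = ((A + 1) * K + (K + 1)) * ‖w - ζ‖ := by ring
      _ ≤ _ := by
          refine mul_le_mul_of_nonneg_right ?_ (norm_nonneg _)
          have : 0 ≤ (A + 1) * (K + 1) := by positivity
          linarith

namespace RSetup
variable {μ : Measure ℂ} {C M : ℝ} {R : ℂ → ℝ}

lemma near_comp (h : RSetup μ C M R) (κ : ℝ) (hκ : 0 ≤ κ) : ∃ K' : ℝ, 1 ≤ K' ∧
    ∀ a b : ℂ, dist a b ≤ κ * (R a + R b) → R a ≤ K' * R b ∧ dist a b ≤ K' * R b := by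
  obtain ⟨K', h1, h2⟩ := h.comp (2 * κ)
  have hc : ∀ a b : ℂ, dist a b ≤ κ * (R a + R b) → R a ≤ K' * R b := by
    intro a b hab
    rcases le_total (R a) (R b) with hle | hle
    · have := h.pos b
      nlinarith
    · apply h2
      rw [dist_comm]
      nlinarith
  refine ⟨K' + κ * (K' + 1), by nlinarith, fun a b hab => ?_⟩
  have h3 := hc a b hab
  have h4 := h.pos b
  constructor
  · have : 0 ≤ κ * (K' + 1) * R b := by positivity
    linarith
  · calc dist a b ≤ κ * (R a + R b) := hab
      _ ≤ κ * (K' * R b + R b) := by gcongr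
      _ ≤ _ := by nlinarith

/-- normalized coordinate -/
def nrm (R : ℂ → ℝ) (a z : ℂ) : ℂ := (z - a) / ((2 * R a : ℝ) : ℂ)

lemma nrm_norm (h : RSetup μ C M R) (a z : ℂ) : ‖nrm R a z‖ = dist z a / (2 * R a) := by
  have := h.pos a
  rw [nrm, norm_div, Complex.norm_real, Real.norm_of_nonneg (by positivity), dist_eq_norm]

lemma nrm_sub (h : RSetup μ C M R) (a z z' : ℂ) :
    ‖nrm R a z - nrm R a z'‖ = dist z z' / (2 * R a) := by
  have := h.pos a
  rw [nrm, nrm, ← sub_div, norm_div, Complex.norm_real, Real.norm_of_nonneg (by positivity),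
    dist_eq_norm]
  congr 2; ring

lemma nrm_inv (h : RSetup μ C M R) (a w : ℂ) : nrm R a (a + ((2 * R a : ℝ) : ℂ) * w) = w := by
  have : ((2 * R a : ℝ) : ℂ) ≠ 0 := by
    have := h.pos a
    exact_mod_cast (by positivity : (2 * R a) ≠ 0)
  rw [nrm, add_sub_cancel_left, mul_div_cancel_left₀ _ this]

/-- The group polynomial in the original coordinate. -/
def grp (R : ℂ → ℝ) (P : Polynomial ℂ) (B a z : ℂ) : ℂ := nrm R a z * (P.eval (nrm R a z) - B)

lemma exists_B (h : RSetup μ C M R) {Λ : Set ℂ} (hΛ : Sep R Λ) (A K : ℝ) (nmax : ℕ)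
    (hA : 1 ≤ A) (hK : 1 ≤ K) (hn : 1 ≤ nmax) (P : Λ → Polynomial ℂ)
    (hmon : ∀ a, (P a).Monic) (hd1 : ∀ a, 1 ≤ (P a).natDegree) (hd2 : ∀ a, (P a).natDegree ≤ nmax)
    (hPK : ∀ a, ∀ w : ℂ, ‖w‖ ≤ A + 3 → ‖(P a).eval w‖ ≤ K) (hP0 : ∀ a, (P a).eval 0 = 0)
    (hfar : ∀ a, ∀ (B w : ℂ), ‖B‖ ≤ 1 → A ≤ ‖w‖ → (P a).eval w ≠ B) :
    ∃ (B : Λ → ℂ) (δ c L : ℝ), 0 < δ ∧ 0 < c ∧ 1 ≤ L ∧ (∀ a, ‖B a‖ ≤ 1) ∧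
      (∀ a b : Λ, ∀ z z' : ℂ, grp R (P a) (B a) a z = 0 → grp R (P b) (B b) b z' = 0 →
        (a ≠ b ∨ z ≠ z') → δ * (R a + R b) ≤ dist z z') ∧
      (∀ a : Λ, ∀ (z : ℂ) (s : ℝ), 0 ≤ s → s ≤ 1 →
        (∀ ζ : ℂ, grp R (P a) (B a) a ζ = 0 → s * (2 * R a) ≤ dist z ζ) →
        c * s ≤ ‖grp R (P a) (B a) a z‖) ∧
      (∀ a : Λ, ∀ z : ℂ, dist z a ≤ (A + 1) * (2 * R a) → ‖grp R (P a) (B a) a z‖ ≤ L) ∧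
      (∀ a : Λ, ∀ z ζ : ℂ, dist z a ≤ (A + 1) * (2 * R a) → grp R (P a) (B a) a ζ = 0 →
        ‖grp R (P a) (B a) a z‖ ≤ L * (dist z ζ / (2 * R a))) ∧
      (∀ a : Λ, ∀ z, grp R (P a) (B a) a z = 0 → dist z a ≤ A * (2 * R a)) := by
  have hcount : Countable Λ := (h.countable hΛ).to_subtype
  obtain ⟨e, he⟩ := exists_injective_nat Λ
  obtain ⟨K', hK'1, hK'⟩ := h.near_comp (2 * A + 1) (by linarith)
  obtain ⟨J0, hJ0⟩ := h.card_unif K'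
  set near : Λ → Λ → Prop := fun a b => dist b.1 a.1 ≤ (2 * A + 1) * (R b + R a) with hnear
  have hnearfin : ∀ a, {b | near a b}.Finite := by
    intro a
    refine Set.Finite.of_finite_image (f := Subtype.val)
      ((h.finite_ball hΛ a.1 (K' * R a)).subset ?_) Subtype.val_injective.injOn
    rintro _ ⟨b, hb, rfl⟩
    exact ⟨b.2, (hK' b a hb).2⟩
  set nf : Λ → Finset Λ := fun a => (hnearfin a).toFinset with hnf
  have hnfm : ∀ a b, b ∈ nf a ↔ near a b := by intro a b; simp [hnf]
  have hnfc : ∀ a, (nf a).card ≤ J0 := by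
    intro a
    rw [← Finset.card_map (Function.Embedding.subtype _)]
    apply hJ0 Λ hΛ a.1
    intro x hx
    obtain ⟨b, hb, rfl⟩ := Finset.mem_map.1 hx
    exact ⟨b.2, (hK' b a ((hnfm a b).1 hb)).2⟩
  set J : ℕ := nmax + J0 + J0 * nmax with hJ
  set η : ℝ := 1 / (2 * ((J : ℝ) + 1)) with hη
  have hη0 : 0 < η := by positivity
  have hη1 : η ≤ 1 := by
    rw [hη, div_le_one (by positivity)]
    have : (0:ℝ) ≤ J := Nat.cast_nonneg _
    linarith
  obtain ⟨B, hB⟩ := greedy (X := ℂ) e (fun a f x => ‖x‖ ≤ 1 ∧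
      (∀ y, (P a).derivative.eval y = 0 → η ≤ ‖(P a).eval y - x‖) ∧
      (∀ b, near a b → η ≤ ‖(P a).eval (nrm R a b) - x‖) ∧
      (∀ b, near a b → e b < e a → ∀ y, (P b).eval y = f b →
        η ≤ ‖(P a).eval (nrm R a (b.1 + ((2 * R b : ℝ) : ℂ) * y)) - x‖)) (by
    rintro a f f' x hff ⟨h1, h2, h3, h4⟩
    refine ⟨h1, h2, h3, fun b hb hlt y hy => h4 b hb hlt y ?_⟩
    rw [hy, hff b hlt]) (by
    intro a f _
    have hP' : (P a).derivative ≠ 0 := by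
      intro h0
      have := Polynomial.derivative_eq_zero.1 h0
      have := hd1 a
      omega
    have hPb : ∀ b, P b - Polynomial.C (f b) ≠ 0 := by
      intro b h0
      have h1 := sub_eq_zero.1 h0
      have := hd1 b
      rw [h1, Polynomial.natDegree_C] at this
      omega
    set V : Finset ℂ := ((P a).derivative.roots.toFinset.image (fun y => (P a).eval y)) ∪
      ((nf a).image (fun b : Λ => (P a).eval (nrm R a b.1))) ∪
      ((nf a).biUnion (fun b => (P b - Polynomial.C (f b)).roots.toFinset.image
        (fun y => (P a).eval (nrm R a (b.1 + ((2 * R b : ℝ) : ℂ) * y))))) with hV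
    have hVc : V.card ≤ J := by
      refine (Finset.card_union_le _ _).trans (add_le_add ((Finset.card_union_le _ _).trans
        (add_le_add ?_ ?_)) ?_)
      · refine Finset.card_image_le.trans ((Multiset.toFinset_card_le _).trans
          ((Polynomial.card_roots' _).trans ((Polynomial.natDegree_derivative_le _).trans ?_)))
        have := hd2 a
        omega
      · exact Finset.card_image_le.trans (hnfc a)
      · refine (Finset.card_biUnion_le_card_mul _ _ nmax ?_).trans (Nat.mul_le_mul_right _ (hnfc a))
        intro b _
        refine Finset.card_image_le.trans ((Multiset.toFinset_card_le _).trans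
          ((Polynomial.card_roots' _).trans ?_))
        rw [Polynomial.natDegree_sub_C]
        exact hd2 b
    obtain ⟨x, hx1, hx2⟩ := exists_avoid J V hVc
    refine ⟨x, hx1, ?_, ?_, ?_⟩
    · intro y hy
      apply hx2
      simp only [hV, Finset.mem_union, Finset.mem_image, Multiset.mem_toFinset]
      exact Or.inl (Or.inl ⟨y, (Polynomial.mem_roots hP').2 hy, rfl⟩)
    · intro b hb
      apply hx2
      simp only [hV, Finset.mem_union, Finset.mem_image]
      exact Or.inl (Or.inr ⟨b, (hnfm a b).2 hb, rfl⟩)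
    · intro b hb _ y hy
      apply hx2
      simp only [hV, Finset.mem_union, Finset.mem_biUnion]
      refine Or.inr ⟨b, (hnfm a b).2 hb, Finset.mem_image.2 ⟨y, ?_, rfl⟩⟩
      rw [Multiset.mem_toFinset, Polynomial.mem_roots (hPb b)]
      simp [Polynomial.IsRoot, hy])
  obtain ⟨δ, c, L, hδ0, hδ1, hc0, hL1, hzero⟩ := zero_group A K η nmax hA hK hη0 hη1 hn
  have hnself : ∀ a, near a a := by
    intro a
    have := h.pos a
    simp only [hnear, dist_self]
    positivity
  have hself : ∀ a : Λ, nrm R a a = 0 := by intro a; simp [nrm]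
  have Z := fun a => hzero (P a) (B a) (hmon a) (hd1 a) (hd2 a) (hPK a) (hB a).1 (hP0 a)
    (by have := (hB a).2.2.1 a (hnself a); rwa [hself] at this)
    (fun w hw => hfar a (B a) w (hB a).1 hw) (hB a).2.1
  have hzbd : ∀ a : Λ, ∀ z, grp R (P a) (B a) a z = 0 → dist z a ≤ A * (2 * R a) := by
    intro a z hz
    have hR := h.pos a
    rcases mul_eq_zero.1 hz with h1 | h1
    · have := h.nrm_norm a z
      rw [h1, norm_zero, eq_comm, div_eq_zero_iff] at this
      rcases this with h2 | h2
      · rw [h2]; positivity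
      · linarith
    · have h2 := sub_eq_zero.1 h1
      have h3 : ‖nrm R a z‖ ≤ A := by
        by_contra hlt
        push Not at hlt
        exact hfar a (B a) _ (hB a).1 hlt.le h2
      rwa [h.nrm_norm, div_le_iff₀ (by positivity)] at h3
  have hinv : ∀ a : Λ, ∀ z, a.1 + ((2 * R a : ℝ) : ℂ) * nrm R a z = z := by
    intro a z
    have : ((2 * R a : ℝ) : ℂ) ≠ 0 := by
      have := h.pos a
      exact_mod_cast (by positivity : (2 * R a) ≠ 0)
    rw [nrm, mul_div_cancel₀ _ this]; ring
  set δ' : ℝ := min (1 / 40) (δ / K') with hδ'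
  have hδ'0 : 0 < δ' := by
    rw [hδ']; apply lt_min <;> positivity
  have hδ'2 : δ' ≤ δ / K' := min_le_right _ _
  have hδ'1 : δ' ≤ 1 / 40 := min_le_left _ _
  -- converting a one-sided estimate
  have conv : ∀ a b : Λ, near a b → ∀ x : ℝ, δ * (2 * R a) ≤ x → δ' * (R a + R b) ≤ x := by
    intro a b hab x hx
    have h1 := (hK' b a hab).1
    have h2 := h.pos a
    have h3 := h.pos b
    calc δ' * (R a + R b) ≤ δ / K' * (K' * R a + K' * R a) := by
          gcongr
          nlinarith
      _ = δ * (2 * R a) := by field_simp; ring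
      _ ≤ x := hx
  refine ⟨B, δ', c, L, hδ'0, hc0, hL1, fun a => (hB a).1, ?_, ?_, ?_, ?_, hzbd⟩
  · -- separation
    have main : ∀ a b : Λ, a ≠ b → near a b → e b < e a → ∀ z z',
        grp R (P a) (B a) a z = 0 → grp R (P b) (B b) b z' = 0 → δ' * (R a + R b) ≤ dist z z' := by
      intro a b hab hn hlt z z' hz hz'
      have hRa := h.pos a
      have hRb := h.pos b
      have hnba : near b a := by
        simp only [hnear] at hn ⊢
        rw [dist_comm, add_comm (R a)]; exact hn
      rcases mul_eq_zero.1 hz with h1 | h1 <;> rcases mul_eq_zero.1 hz' with h2 | h2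
      · have e1 := hinv a z
        have e2 := hinv b z'
        rw [h1, mul_zero, add_zero] at e1
        rw [h2, mul_zero, add_zero] at e2
        rw [← e1, ← e2]
        have := hΛ a.1 a.2 b.1 b.2 (fun h => hab (Subtype.ext h))
        have l1 := le_max_left (R a) (R b)
        have l2 := le_max_right (R a) (R b)
        nlinarith
      · have e1 := hinv a z
        rw [h1, mul_zero, add_zero] at e1
        have h3 := (Z b).2.1 _ _ ((hB b).2.2.1 a hnba) (sub_eq_zero.1 h2)
        rw [h.nrm_sub, le_div_iff₀ (by positivity)] at h3
        rw [← e1, add_comm]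
        exact conv b a hnba _ h3
      · have e1 := hinv b z'
        rw [h2, mul_zero, add_zero] at e1
        have h3 := (Z a).2.1 _ _ ((hB a).2.2.1 b hn) (sub_eq_zero.1 h1)
        rw [h.nrm_sub, le_div_iff₀ (by positivity)] at h3
        rw [← e1, dist_comm]
        exact conv a b hn _ h3
      · have h3 := (Z a).2.1 _ _ ((hB a).2.2.2 b hn hlt _ (sub_eq_zero.1 h2)) (sub_eq_zero.1 h1)
        rw [hinv, h.nrm_sub, le_div_iff₀ (by positivity)] at h3
        rw [dist_comm]
        exact conv a b hn _ h3
    intro a b z z' hz hz' hor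
    have hRa := h.pos a
    have hRb := h.pos b
    by_cases hab : a = b
    · subst hab
      have hne : z ≠ z' := by
        rcases hor with h1 | h1
        · exact absurd rfl h1
        · exact h1
      have hne' : nrm R a z ≠ nrm R a z' := by
        intro heq
        apply hne
        rw [← hinv a z, ← hinv a z', heq]
      have h3 := (Z a).1 _ _ hz hz' hne'
      rw [h.nrm_sub, le_div_iff₀ (by positivity)] at h3
      exact conv a a (hnself a) _ h3
    · by_cases hn : near a b
      · rcases lt_trichotomy (e a) (e b) with h1 | h1 | h1
        · have hnba : near b a := by
            simp only [hnear] at hn ⊢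
            rw [dist_comm, add_comm (R a)]; exact hn
          have := main b a (fun h => hab h.symm) hnba h1 z' z hz' hz
          rwa [dist_comm, add_comm] at this
        · exact absurd (he h1) hab
        · exact main a b hab hn h1 z z' hz hz'
      · simp only [hnear] at hn
        push Not at hn
        have h1 := hzbd a z hz
        have h2 := hzbd b z' hz'
        have h3 : dist b.1 a.1 ≤ dist z' b + dist z z' + dist z a := by
          have t1 := dist_triangle b.1 z' a.1
          have t2 := dist_triangle z' z a.1
          rw [dist_comm b.1 z'] at t1
          rw [dist_comm z' z] at t2
          linarith
        nlinarith
  · intro a z s hs0 hs1 hs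
    have hRa := h.pos a
    apply (Z a).2.2.1 _ s hs0 hs1
    intro ζ hζ
    have h1 := hs (a.1 + ((2 * R a : ℝ) : ℂ) * ζ) (by rw [grp, h.nrm_inv]; exact hζ)
    rw [← le_div_iff₀ (by positivity), ← h.nrm_sub, h.nrm_inv] at h1
    exact h1
  · intro a z hz
    have hRa := h.pos a
    apply (Z a).2.2.2.1
    rwa [h.nrm_norm, div_le_iff₀ (by positivity)]
  · intro a z ζ hz hζ
    have hRa := h.pos a
    have := (Z a).2.2.2.2 (nrm R a z) (nrm R a ζ)
      (by rwa [h.nrm_norm, div_le_iff₀ (by positivity)]) hζ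
    rwa [h.nrm_sub] at this

end RSetup

lemma lap_eq' (v : ℂ → ℝ) (z : ℂ) :
    lap v z = fderiv ℝ (fderiv ℝ v) z 1 1 + fderiv ℝ (fderiv ℝ v) z Complex.I Complex.I := by
  simp [lap, iteratedFDeriv_two_apply]

lemma fderiv_fderiv_apply {v : ℂ → ℝ} (hv : ContDiff ℝ (⊤ : ℕ∞) v) (z e e' : ℂ) :
    fderiv ℝ (fun x => fderiv ℝ v x e) z e' = fderiv ℝ (fderiv ℝ v) z e' e := by
  have h1 : DifferentiableAt ℝ (fderiv ℝ v) z :=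
    ((hv.fderiv_right (m := 1) (by norm_cast)).differentiable (by norm_num)) z
  have := (h1.hasFDerivAt.clm_apply (hasFDerivAt_const e z)).fderiv
  rw [this]
  simp

lemma lap_eq {v : ℂ → ℝ} (hv : ContDiff ℝ (⊤ : ℕ∞) v) (z : ℂ) :
    lap v z = fderiv ℝ (fun x => fderiv ℝ v x 1) z 1 +
      fderiv ℝ (fun x => fderiv ℝ v x Complex.I) z Complex.I := by
  rw [fderiv_fderiv_apply hv, fderiv_fderiv_apply hv, lap_eq']

lemma contDiff_dir {v : ℂ → ℝ} (hv : ContDiff ℝ (⊤ : ℕ∞) v) (e : ℂ) :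
    ContDiff ℝ (⊤ : ℕ∞) (fun x => fderiv ℝ v x e) :=
  (hv.fderiv_right (m := (⊤ : ℕ∞)) (by simp)).clm_apply contDiff_const

lemma support_dir {v : ℂ → ℝ} (hv : HasCompactSupport v) (e : ℂ) :
    HasCompactSupport (fun x => fderiv ℝ v x e) :=
  hv.fderiv_apply (𝕜 := ℝ) e

lemma lap_contDiff {v : ℂ → ℝ} (hv : ContDiff ℝ (⊤ : ℕ∞) v) : ContDiff ℝ (⊤ : ℕ∞) (lap v) := by
  have : lap v = fun z => fderiv ℝ (fun x => fderiv ℝ v x 1) z 1 +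
      fderiv ℝ (fun x => fderiv ℝ v x Complex.I) z Complex.I := funext fun z => lap_eq hv z
  rw [this]
  exact (contDiff_dir (contDiff_dir hv _) _).add (contDiff_dir (contDiff_dir hv _) _)

lemma lap_zero_of_eventually {v : ℂ → ℝ} {z : ℂ} (h : v =ᶠ[𝓝 z] 0) : lap v z = 0 := by
  have h1 : fderiv ℝ v =ᶠ[𝓝 z] 0 := by
    have := h.fderiv (𝕜 := ℝ)
    refine this.trans ?_
    refine Eventually.of_forall fun x => ?_
    simp [show (0 : ℂ → ℝ) = fun _ => 0 from rfl]
  have h2 := h1.fderiv_eq (𝕜 := ℝ)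
  rw [lap_eq', h2]
  simp [show (0 : ℂ → ℂ →L[ℝ] ℝ) = fun _ => 0 from rfl]

lemma lap_support (v : ℂ → ℝ) : tsupport (lap v) ⊆ tsupport v := by
  refine closure_minimal ?_ (isClosed_tsupport v)
  intro z hz
  by_contra hc
  exact hz (lap_zero_of_eventually (notMem_tsupport_iff_eventuallyEq.1 hc))

lemma lap_compact {v : ℂ → ℝ} (hc : HasCompactSupport v) : HasCompactSupport (lap v) :=
  hc.of_isClosed_subset (isClosed_tsupport _) (lap_support v)

lemma ibp_dir {u v : ℂ → ℝ} (hu : ContDiff ℝ (⊤ : ℕ∞) u) (hv : ContDiff ℝ (⊤ : ℕ∞) v)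
    (hc : HasCompactSupport v) (e : ℂ) :
    ∫ x, u x * fderiv ℝ v x e = - ∫ x, fderiv ℝ u x e * v x := by
  apply integral_mul_fderiv_eq_neg_fderiv_mul_of_integrable
  · exact ((contDiff_dir hu e).continuous.mul hv.continuous).integrable_of_hasCompactSupport
      hc.mul_left
  · exact (hu.continuous.mul (contDiff_dir hv e).continuous).integrable_of_hasCompactSupport
      (support_dir hc e).mul_left
  · exact (hu.continuous.mul hv.continuous).integrable_of_hasCompactSupport hc.mul_left
  · exact fun x _ => hu.differentiable (by simp) x
  · exact fun x _ => hv.differentiable (by simp) x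

lemma ibp_lap {u v : ℂ → ℝ} (hu : ContDiff ℝ (⊤ : ℕ∞) u) (hv : ContDiff ℝ (⊤ : ℕ∞) v)
    (hc : HasCompactSupport v) : ∫ x, u x * lap v x = ∫ x, lap u x * v x := by
  have key : ∀ e : ℂ, ∫ x, u x * fderiv ℝ (fun x => fderiv ℝ v x e) x e =
      ∫ x, fderiv ℝ (fun x => fderiv ℝ u x e) x e * v x := by
    intro e
    rw [ibp_dir hu (contDiff_dir hv e) (support_dir hc e) e,
      ibp_dir (contDiff_dir hu e) hv hc e, neg_neg]
  have i1 : ∀ e : ℂ, Integrable (fun x => u x * fderiv ℝ (fun x => fderiv ℝ v x e) x e) :=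
    fun e => (hu.continuous.mul (contDiff_dir (contDiff_dir hv e) e).continuous)
      |>.integrable_of_hasCompactSupport (support_dir (support_dir hc e) e).mul_left
  have i2 : ∀ e : ℂ, Integrable (fun x => fderiv ℝ (fun x => fderiv ℝ u x e) x e * v x) :=
    fun e => ((contDiff_dir (contDiff_dir hu e) e).continuous.mul hv.continuous)
      |>.integrable_of_hasCompactSupport hc.mul_left
  simp_rw [lap_eq hu, lap_eq hv, mul_add, add_mul]
  rw [integral_add (i1 _) (i1 _), integral_add (i2 _) (i2 _), key, key]

lemma normSq_contDiff (c : ℂ) : ContDiff ℝ (⊤ : ℕ∞) (fun z : ℂ => Complex.normSq (z - c)) := by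
  have : (fun z : ℂ => Complex.normSq (z - c)) = fun z => ‖z - c‖ ^ 2 := by
    funext z; rw [Complex.normSq_eq_norm_sq]
  rw [this]
  exact (contDiff_id.sub contDiff_const).norm_sq ℝ

lemma normSq_hasFDerivAt (c z e : ℂ) :
    fderiv ℝ (fun z : ℂ => Complex.normSq (z - c)) z e = 2 * ((z - c).re * e.re + (z - c).im * e.im) := by
  have hre : HasFDerivAt (fun z : ℂ => (z - c).re) Complex.reCLM z := Complex.reCLM.hasFDerivAt.comp z ((hasFDerivAt_id z).sub_const c)
  have him : HasFDerivAt (fun z : ℂ => (z - c).im) Complex.imCLM z := Complex.imCLM.hasFDerivAt.comp z ((hasFDerivAt_id z).sub_const c)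
  have := ((hre.mul hre).add (him.mul him))
  have h2 : (fun z : ℂ => Complex.normSq (z - c)) =
    ((fun z : ℂ => (z - c).re) * (fun z : ℂ => (z - c).re) + (fun z : ℂ => (z - c).im) * (fun z : ℂ => (z - c).im)) := by
    funext z; simp [Complex.normSq_apply]
  rw [h2, this.fderiv]
  simp
  ring

lemma lap_radial {f : ℝ → ℝ} (hf : ContDiff ℝ (⊤ : ℕ∞) f) (c z : ℂ) :
    lap (fun z => f (Complex.normSq (z - c))) z =
      4 * deriv f (Complex.normSq (z - c)) +
        4 * Complex.normSq (z - c) * deriv (deriv f) (Complex.normSq (z - c)) := by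
  have hsm : ContDiff ℝ (⊤ : ℕ∞) (fun z : ℂ => f (Complex.normSq (z - c))) := hf.comp (normSq_contDiff c)
  have hd : ∀ (g : ℝ → ℝ) (_ : ContDiff ℝ 1 g) (x e : ℂ),
      HasFDerivAt (fun z => g (Complex.normSq (z - c)))
        (deriv g (Complex.normSq (x - c)) • fderiv ℝ (fun z : ℂ => Complex.normSq (z - c)) x) x := by
    intro g hg x e
    exact ((hg.differentiable (by simp) _).hasDerivAt).comp_hasFDerivAt x
      (((normSq_contDiff c).differentiable (by simp)) x).hasFDerivAt
  have hf' : ContDiff ℝ 1 (deriv f) := by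
    have : ContDiff ℝ (1+1) f := hf.of_le (by norm_cast)
    exact ((contDiff_succ_iff_deriv (n := 1)).1 this).2.2
  have h1 : ∀ e : ℂ, (fun x => fderiv ℝ (fun z => f (Complex.normSq (z - c))) x e) =
      fun x => deriv f (Complex.normSq (x - c)) * (2 * ((x - c).re * e.re + (x - c).im * e.im)) := by
    intro e
    funext x
    rw [(hd f (hf.of_le (by norm_cast)) x e).fderiv]
    simp [normSq_hasFDerivAt]
  have hlin : ∀ e x : ℂ, HasFDerivAt (fun x : ℂ => 2 * ((x - c).re * e.re + (x - c).im * e.im))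
      ((2:ℝ) • (e.re • Complex.reCLM + e.im • Complex.imCLM)) x := by
    intro e x
    have hre : HasFDerivAt (fun z : ℂ => (z - c).re) Complex.reCLM x := Complex.reCLM.hasFDerivAt.comp x ((hasFDerivAt_id x).sub_const c)
    have him : HasFDerivAt (fun z : ℂ => (z - c).im) Complex.imCLM x := Complex.imCLM.hasFDerivAt.comp x ((hasFDerivAt_id x).sub_const c)
    exact (((hre.mul_const e.re).add (him.mul_const e.im)).const_mul 2)
  rw [lap_eq hsm]
  have h2 : ∀ e : ℂ, fderiv ℝ (fun x => fderiv ℝ (fun z => f (Complex.normSq (z - c))) x e) z e =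
      deriv (deriv f) (Complex.normSq (z - c)) * (2 * ((z - c).re * e.re + (z - c).im * e.im))^2 +
      deriv f (Complex.normSq (z - c)) * (2 * (e.re^2 + e.im^2)) := by
    intro e
    have h4 := ((hd (deriv f) hf' z e).mul (hlin e z)).fderiv
    rw [h1 e]
    erw [h4]
    simp [normSq_hasFDerivAt]
    ring
  have := h2 1
  have h3 := h2 Complex.I
  erw [this, h3]
  simp [Complex.normSq_apply]
  ring

/-- smoothed `log √s` -/
def cut (s : ℝ) : ℝ := Real.smoothTransition (4 * s - 1) * (Real.log s / 2)

def hk (s : ℝ) : ℝ := 4 * deriv cut s + 4 * s * deriv (deriv cut) s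

lemma cut_eq {s : ℝ} (hs : 1 / 2 ≤ s) : cut s = Real.log s / 2 := by
  rw [cut, Real.smoothTransition.one_of_one_le (by linarith), one_mul]

lemma cut_zero {s : ℝ} (hs : s ≤ 1 / 4) : cut s = 0 := by
  rw [cut, Real.smoothTransition.zero_of_nonpos (by linarith), zero_mul]

lemma cut_contDiff : ContDiff ℝ (⊤ : ℕ∞) cut := by
  rw [contDiff_iff_contDiffAt]
  intro s
  by_cases hs : s < 1 / 4
  · have : cut =ᶠ[𝓝 s] fun _ => 0 := by
      filter_upwards [Iio_mem_nhds hs] with x hx using cut_zero (le_of_lt hx)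
    exact (contDiffAt_const).congr_of_eventuallyEq this
  · have h0 : s ≠ 0 := by intro h; apply hs; rw [h]; norm_num
    unfold cut
    refine ContDiffAt.mul ?_ ((Real.contDiffAt_log.2 h0).div_const _)
    exact Real.smoothTransition.contDiff.contDiffAt.comp s
      (((contDiff_const.mul contDiff_id).sub contDiff_const).contDiffAt)

lemma cut_deriv_contDiff : ContDiff ℝ (⊤ : ℕ∞) (deriv cut) :=
  (contDiff_infty_iff_deriv.1 cut_contDiff).2

lemma cut_deriv2_contDiff : ContDiff ℝ (⊤ : ℕ∞) (deriv (deriv cut)) :=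
  (contDiff_infty_iff_deriv.1 cut_deriv_contDiff).2

lemma hk_contDiff : ContDiff ℝ (⊤ : ℕ∞) hk := by
  unfold hk
  exact (contDiff_const.mul cut_deriv_contDiff).add
    ((contDiff_const.mul contDiff_id).mul cut_deriv2_contDiff)

lemma deriv_cut {s : ℝ} (hs : 1 / 2 < s) : deriv cut s = 1 / (2 * s) := by
  have : cut =ᶠ[𝓝 s] fun x => Real.log x / 2 := by
    filter_upwards [Ioi_mem_nhds hs] with x hx using cut_eq (le_of_lt hx)
  rw [this.deriv_eq, ((Real.hasDerivAt_log (by linarith)).div_const 2).deriv]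
  field_simp

lemma hk_zero {s : ℝ} (hs : 1 / 2 < s) : hk s = 0 := by
  have : deriv cut =ᶠ[𝓝 s] fun x => x⁻¹ * (1 / 2) := by
    filter_upwards [Ioi_mem_nhds hs] with x hx
    rw [deriv_cut hx]; field_simp
  have h2 := (((hasDerivAt_inv (x := s) (by linarith)).mul_const (1/2:ℝ))).deriv
  have h3 : deriv (deriv cut) s = -(s^2)⁻¹ * (1/2) := by
    rw [this.deriv_eq]; exact h2
  rw [hk, h3, deriv_cut hs]
  have : s ≠ 0 := by linarith
  field_simp
  ring

lemma eta_contDiff : ContDiff ℝ (⊤ : ℕ∞) (fun w : ℂ => hk (Complex.normSq w)) := by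
  have := hk_contDiff.comp (normSq_contDiff 0)
  simpa [Function.comp_def] using this

lemma eta_zero {w : ℂ} (hw : 1 ≤ ‖w‖) : hk (Complex.normSq w) = 0 := by
  apply hk_zero
  rw [Complex.normSq_eq_norm_sq]; nlinarith

lemma eta_compact : HasCompactSupport (fun w : ℂ => hk (Complex.normSq w)) := by
  refine HasCompactSupport.of_support_subset_isCompact (isCompact_closedBall 0 1) ?_
  intro w hw
  by_contra hc
  rw [mem_closedBall_zero_iff, not_le] at hc
  exact hw (eta_zero hc.le)

lemma eta_integral : ∫ w : ℂ, hk (Complex.normSq w) = 2 * π := by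
  have h1 : (fun w : ℂ => hk (Complex.normSq w)) = fun w : ℂ => (fun y : ℝ => hk (y ^ 2)) ‖w‖ := by
    funext w; rw [Complex.normSq_eq_norm_sq]
  rw [h1, integral_fun_norm_addHaar volume (fun y : ℝ => hk (y ^ 2))]
  have hcts : Continuous fun y : ℝ => y * hk (y ^ 2) :=
    continuous_id.mul (hk_contDiff.continuous.comp (continuous_pow 2))
  have h2 : ∫ y in Ioi (0:ℝ), y * hk (y^2) = 1 - 2 * (0:ℝ)^2 * deriv cut (0^2) := by
    apply integral_Ioi_of_hasDerivAt_of_tendsto' (f := fun y => 2 * y ^ 2 * deriv cut (y ^ 2))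
    · intro x _
      have a1 : HasDerivAt (fun y : ℝ => y ^ 2) (2 * x) x := by simpa using hasDerivAt_pow 2 x
      have a2 : HasDerivAt (fun y : ℝ => deriv cut (y ^ 2)) (deriv (deriv cut) (x ^ 2) * (2 * x)) x :=
        HasDerivAt.comp x (h₂ := deriv cut) ((cut_deriv_contDiff.differentiable (by simp)) (x ^ 2)).hasDerivAt a1
      have a3 := (a1.const_mul 2).mul a2
      have a4 : x * hk (x ^ 2) = 2 * (2 * x) * deriv cut (x ^ 2) +
          2 * x ^ 2 * (deriv (deriv cut) (x ^ 2) * (2 * x)) := by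
        simp only [hk]; ring
      rw [a4]
      exact a3
    · apply Integrable.integrableOn
      apply hcts.integrable_of_hasCompactSupport
      refine HasCompactSupport.of_support_subset_isCompact (isCompact_closedBall 0 1) ?_
      intro w hw
      by_contra hc
      rw [mem_closedBall_zero_iff, not_le, Real.norm_eq_abs] at hc
      apply hw
      show w * hk (w ^ 2) = 0
      rw [hk_zero, mul_zero]
      rw [← sq_abs]; nlinarith
    · refine tendsto_const_nhds.congr' ?_
      filter_upwards [eventually_ge_atTop 1] with y hy
      rw [deriv_cut (by nlinarith)]
      have : y ≠ 0 := by linarith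
      field_simp
  have h3 : ∫ y in Ioi (0:ℝ), y ^ (Module.finrank ℝ ℂ - 1) • hk (y^2) = 1 := by
    rw [Complex.finrank_real_complex]
    simp only [Nat.add_one_sub_one, pow_one, smul_eq_mul]
    rw [h2]; simp
  rw [h3, Complex.finrank_real_complex]
  have : (volume : Measure ℂ).real (ball 0 1) = π := by
    simp [Measure.real, Complex.volume_ball]
  rw [this]; simp

/-- smoothed `log ‖z - c‖` -/
def El (ε : ℝ) (c z : ℂ) : ℝ := cut (Complex.normSq (z - c) / ε ^ 2) + Real.log ε

def etae (ε : ℝ) (c z : ℂ) : ℝ := (ε ^ 2)⁻¹ * hk (Complex.normSq (z - c) / ε ^ 2)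

lemma cute_contDiff (ε : ℝ) : ContDiff ℝ (⊤ : ℕ∞) (fun s => cut (s / ε ^ 2) + Real.log ε) :=
  (cut_contDiff.comp (contDiff_id.div_const _)).add contDiff_const

lemma El_contDiff (ε : ℝ) (c : ℂ) : ContDiff ℝ (⊤ : ℕ∞) (El ε c) :=
  (cute_contDiff ε).comp (normSq_contDiff c)

lemma lap_El {ε : ℝ} (hε : 0 < ε) (c z : ℂ) : lap (El ε c) z = etae ε c z := by
  have h0 := lap_radial (cute_contDiff ε) c z
  have d1 : deriv (fun s => cut (s / ε ^ 2) + Real.log ε) = fun s => deriv cut (s / ε ^ 2) / ε ^ 2 := by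
    funext s
    have := (HasDerivAt.comp s (h₂ := cut) ((cut_contDiff.differentiable (by simp)) (s / ε ^ 2)).hasDerivAt
      ((hasDerivAt_id s).div_const (ε ^ 2))).add_const (Real.log ε)
    rw [show (fun s => cut (s / ε ^ 2) + Real.log ε) = fun s => (cut ∘ fun x => id x / ε^2) s + Real.log ε from rfl, this.deriv]
    ring
  have d2 : ∀ s, deriv (fun s => deriv cut (s / ε ^ 2) / ε ^ 2) s = deriv (deriv cut) (s / ε ^ 2) / ε ^ 4 := by
    intro s
    have := (HasDerivAt.comp s (h₂ := deriv cut) ((cut_deriv_contDiff.differentiable (by simp)) (s / ε ^ 2)).hasDerivAt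
      ((hasDerivAt_id s).div_const (ε ^ 2))).div_const (ε ^ 2)
    rw [show (fun s => deriv cut (s / ε ^ 2) / ε ^ 2) = fun s => (deriv cut ∘ fun x => id x / ε^2) s / ε ^ 2 from rfl, this.deriv]
    field_simp
  rw [d1, d2] at h0
  refine Eq.trans h0 ?_
  rw [etae, hk]
  field_simp

lemma El_eq {ε : ℝ} (hε : 0 < ε) {c z : ℂ} (hz : ε ≤ ‖z - c‖) : El ε c z = Real.log ‖z - c‖ := by
  have h1 : (1:ℝ) ≤ Complex.normSq (z - c) / ε ^ 2 := by
    rw [Complex.normSq_eq_norm_sq, one_le_div (by positivity)]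
    exact pow_le_pow_left₀ hε.le hz 2
  have h3 : 0 < ‖z - c‖ := lt_of_lt_of_le hε hz
  rw [El, cut_eq (by linarith), Complex.normSq_eq_norm_sq, Real.log_div (by positivity) (by positivity),
    Real.log_pow, Real.log_pow]
  push_cast; ring

lemma El_bound {ε : ℝ} (hε : 0 < ε) (hε1 : ε ≤ 1) {c z : ℂ} (hz : z ≠ c) :
    |El ε c z| ≤ |Real.log ‖z - c‖| := by
  by_cases h : ε ≤ ‖z - c‖
  · rw [El_eq hε h]
  push Not at h
  have h3 : 0 < ‖z - c‖ := norm_pos_iff.2 (sub_ne_zero.2 hz)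
  have hl : Real.log ‖z - c‖ ≤ Real.log ε := Real.log_le_log h3 h.le
  have hl0 : Real.log ε ≤ 0 := Real.log_nonpos hε.le hε1
  have h4 : Real.log (Complex.normSq (z - c) / ε ^ 2) / 2 = Real.log ‖z - c‖ - Real.log ε := by
    rw [Complex.normSq_eq_norm_sq, Real.log_div (by positivity) (by positivity),
    Real.log_pow, Real.log_pow]
    push_cast; ring
  have s0 := Real.smoothTransition.nonneg (4 * (Complex.normSq (z - c) / ε ^ 2) - 1)
  have s1 := Real.smoothTransition.le_one (4 * (Complex.normSq (z - c) / ε ^ 2) - 1)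
  rw [El, cut, h4]
  set st := Real.smoothTransition (4 * (Complex.normSq (z - c) / ε ^ 2) - 1)
  rw [abs_of_nonpos (by nlinarith), abs_of_nonpos (by linarith)]
  nlinarith

lemma approx_id {u : ℂ → ℝ} (hu : Measurable u) {B : ℝ} (hB : ∀ z, |u z| ≤ B) {c : ℂ}
    (hc : ContinuousAt u c) :
    Tendsto (fun n : ℕ => ∫ z, u z * etae (1 / ((n:ℝ) + 1)) c z) atTop (𝓝 (2 * π * u c)) := by
  have hcv : ∀ n : ℕ, ∫ z, u z * etae (1 / ((n:ℝ) + 1)) c z =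
      ∫ w, u (c + (1 / ((n:ℝ) + 1) : ℝ) • w) * hk (Complex.normSq w) := by
    intro n
    set ε : ℝ := 1 / ((n:ℝ) + 1) with hε
    have e0 : 0 < ε := by positivity
    have h1 := Measure.integral_comp_smul (volume : Measure ℂ)
      (fun x => u (c + x) * hk (Complex.normSq x / ε ^ 2)) ε
    have h2 : ∫ z, u z * etae ε c z = ∫ z, u (c + z) * etae ε c (c + z) :=
      (integral_add_left_eq_self (μ := volume) (fun z => u z * etae ε c z) c).symm
    have h3 : ∀ x : ℂ, Complex.normSq (ε • x) / ε ^ 2 = Complex.normSq x := by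
      intro x
      rw [Complex.normSq_eq_norm_sq, Complex.normSq_eq_norm_sq, norm_smul, Real.norm_eq_abs, mul_pow, sq_abs]
      field_simp
    simp only [h3] at h1
    rw [h1, h2, Complex.finrank_real_complex, abs_of_nonneg (by positivity), smul_eq_mul, ← integral_const_mul]
    congr 1
    funext x
    simp only [etae, add_sub_cancel_left]
    ring
  simp_rw [hcv]
  have hlim : 2 * π * u c = ∫ w : ℂ, u c * hk (Complex.normSq w) := by
    rw [integral_const_mul, eta_integral]; ring
  rw [hlim]
  refine tendsto_integral_of_dominated_convergence (fun w => B * |hk (Complex.normSq w)|) ?_ ?_ ?_ ?_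
  · intro n
    exact ((hu.comp (by fun_prop : Measurable fun w : ℂ => c + (1 / ((n:ℝ) + 1) : ℝ) • w)).mul
      eta_contDiff.continuous.measurable).aestronglyMeasurable
  · exact ((eta_contDiff.continuous.integrable_of_hasCompactSupport eta_compact).abs).const_mul B
  · intro n
    refine Eventually.of_forall fun w => ?_
    rw [norm_mul, Real.norm_eq_abs, Real.norm_eq_abs]
    exact mul_le_mul_of_nonneg_right (hB _) (abs_nonneg _)
  · refine Eventually.of_forall fun w => ?_
    refine Tendsto.mul_const _ ?_
    have : Tendsto (fun n : ℕ => c + (1 / ((n:ℝ) + 1) : ℝ) • w) atTop (𝓝 c) := by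
      have := (tendsto_one_div_add_atTop_nhds_zero_nat (𝕜 := ℝ)).smul_const w
      simpa using this.const_add c
    exact hc.tendsto.comp this

lemma dbl_volume : Dbl (volume : Measure ℂ) 4 where
  one_le := by norm_num
  fin := fun z r => measure_ball_lt_top
  pos := fun z r hr => ENNReal.toReal_pos (measure_ball_pos volume z hr).ne' measure_ball_lt_top.ne
  dbl := by
    intro z r hr
    simp only [Measure.real, Complex.volume_ball, ENNReal.toReal_mul, ENNReal.toReal_pow]
    rw [ENNReal.toReal_ofReal (by positivity), ENNReal.toReal_ofReal hr.le]
    apply le_of_eq; ring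

lemma Dbl.integrableOn_log {μ : Measure ℂ} {C : ℝ} (h : Dbl μ C) (c : ℂ) (r : ℝ) :
    IntegrableOn (fun z => Real.log ‖z - c‖) (ball c r) μ := by
  rcases le_or_gt r 0 with hr | hr
  · rw [ball_eq_empty.2 hr]; exact integrableOn_empty
  have hm : Measurable fun z : ℂ => Real.log (r / dist c z) := by fun_prop
  have h1 : IntegrableOn (fun z => Real.log (r / dist c z)) (ball c r) μ := by
    refine ⟨hm.aestronglyMeasurable, ?_⟩
    rw [hasFiniteIntegral_iff_ofReal]
    · exact lt_of_le_of_lt (h.lintegral_log c hr) ENNReal.ofReal_lt_top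
    · filter_upwards [ae_restrict_mem measurableSet_ball] with z hz
      rw [mem_ball, dist_comm] at hz
      by_cases h0 : dist c z = 0
      · rw [h0]; simp
      · exact Real.log_nonneg ((one_le_div (lt_of_le_of_ne dist_nonneg (Ne.symm h0))).2 hz.le)
  have h2 : IntegrableOn (fun z => Real.log r - Real.log (r / dist c z)) (ball c r) μ := by
    refine Integrable.sub ?_ h1
    exact integrableOn_const (h.fin c r).ne
  refine h2.congr ?_
  have := h.noAtoms
  have hae : ∀ᵐ z ∂(μ.restrict (ball c r)), z ≠ c := by
    apply ae_restrict_of_ae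
    rw [ae_iff]; simp
  filter_upwards [hae] with z hz
  have h0 : dist c z ≠ 0 := dist_ne_zero.2 hz.symm
  rw [Real.log_div hr.ne' h0, dist_comm, dist_eq_norm]; ring

lemma integrable_log_mul (c : ℂ) {u : ℂ → ℝ} (hu : Continuous u) (hc : HasCompactSupport u) :
    Integrable (fun z => Real.log ‖z - c‖ * u z) := by
  obtain ⟨B, hB⟩ := hu.bounded_above_of_compact_support hc
  obtain ⟨r, hr⟩ := hc.isBounded.subset_ball c
  have h1 : IntegrableOn (fun z => Real.log ‖z - c‖ * u z) (ball c r) := by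
    refine Integrable.mul_bdd (c := B) (dbl_volume.integrableOn_log c r) hu.aestronglyMeasurable ?_
    exact Eventually.of_forall hB
  refine (integrableOn_iff_integrable_of_support_subset ?_).1 h1
  intro z hz
  apply hr
  apply subset_tsupport
  exact right_ne_zero_of_mul hz

lemma fund_sol {v : ℂ → ℝ} (hv : ContDiff ℝ (⊤ : ℕ∞) v) (hc : HasCompactSupport v) (c : ℂ) :
    ∫ z, Real.log ‖z - c‖ * lap v z = 2 * π * v c := by
  obtain ⟨B, hB⟩ := hv.continuous.bounded_above_of_compact_support hc
  have t1 := approx_id hv.continuous.measurable hB hv.continuous.continuousAt (c := c)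
  refine tendsto_nhds_unique (f := fun n : ℕ => ∫ z, El (1 / ((n:ℝ) + 1)) c z * lap v z) (l := atTop)
    ?_ ?_
  · refine tendsto_integral_of_dominated_convergence (fun z => |Real.log ‖z - c‖ * lap v z|) ?_ ?_ ?_ ?_
    · intro n
      exact ((El_contDiff _ c).continuous.mul (lap_contDiff hv).continuous).aestronglyMeasurable
    · exact (integrable_log_mul c (lap_contDiff hv).continuous (lap_compact hc)).abs
    · intro n
      have hae : ∀ᵐ z : ℂ, z ≠ c := by rw [ae_iff]; simp
      filter_upwards [hae] with z hz
      rw [norm_mul, abs_mul, Real.norm_eq_abs, Real.norm_eq_abs]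
      refine mul_le_mul_of_nonneg_right (El_bound (by positivity) ?_ hz) (abs_nonneg _)
      rw [div_le_one (by positivity)]
      have : (0:ℝ) ≤ n := Nat.cast_nonneg _
      linarith
    · have hae : ∀ᵐ z : ℂ, z ≠ c := by rw [ae_iff]; simp
      filter_upwards [hae] with z hz
      refine tendsto_const_nhds.congr' ?_
      have h3 : 0 < ‖z - c‖ := norm_pos_iff.2 (sub_ne_zero.2 hz)
      filter_upwards [(tendsto_one_div_add_atTop_nhds_zero_nat (𝕜 := ℝ)).eventually (gt_mem_nhds h3)]
        with n hn
      rw [El_eq (by positivity) hn.le]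
  · refine t1.congr fun n => ?_
    rw [ibp_lap (El_contDiff _ c) hv hc]
    congr 1; funext z
    rw [lap_El (by positivity), mul_comm]

lemma etae_one (c z : ℂ) : etae 1 c z = hk (Complex.normSq (z - c)) := by simp [etae]

lemma lap_sub {u v : ℂ → ℝ} (hu : ContDiff ℝ (⊤ : ℕ∞) u) (hv : ContDiff ℝ (⊤ : ℕ∞) v) (z : ℂ) :
    lap (fun x => u x - v x) z = lap u z - lap v z := by
  rw [lap_eq (hu.sub hv), lap_eq hu, lap_eq hv]
  have h1 : ∀ e : ℂ, (fun x => fderiv ℝ (fun x => u x - v x) x e) =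
      fun x => fderiv ℝ u x e - fderiv ℝ v x e := by
    intro e; funext x
    rw [fderiv_fun_sub (hu.differentiable (by simp) x) (hv.differentiable (by simp) x)]
    simp
  have h2 : ∀ e : ℂ, fderiv ℝ (fun x => fderiv ℝ (fun x => u x - v x) x e) z e =
      fderiv ℝ (fun x => fderiv ℝ u x e) z e - fderiv ℝ (fun x => fderiv ℝ v x e) z e := by
    intro e
    rw [h1, fderiv_fun_sub ((contDiff_dir hu e).differentiable (by simp) z)
      ((contDiff_dir hv e).differentiable (by simp) z)]
    simp
  rw [h2, h2]; ring

/-- Weyl's lemma on a disc. -/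
lemma weyl {H : ℂ → ℝ} {T : ℝ} (hH : ContinuousOn H (ball 0 T))
    (hw : ∀ v : ℂ → ℝ, ContDiff ℝ (⊤ : ℕ∞) v → HasCompactSupport v → tsupport v ⊆ ball 0 T →
      ∫ z, H z * lap v z = 0) :
    ∃ F : ℂ → ℂ, AnalyticOnNhd ℂ F (ball 0 (T - 2)) ∧ ∀ z ∈ ball (0:ℂ) (T - 2), (F z).re = H z := by
  set Ht : ℂ → ℝ := (closedBall (0:ℂ) (T - 1)).indicator H with hHt
  have hsub : closedBall (0:ℂ) (T - 1) ⊆ ball 0 T := closedBall_subset_ball (by linarith)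
  have hHc : ContinuousOn H (closedBall (0:ℂ) (T - 1)) := hH.mono hsub
  have hHm : Measurable Ht := hHc.measurable_piecewise continuousOn_const measurableSet_closedBall
  obtain ⟨B, hB⟩ := (isCompact_closedBall (0:ℂ) (T - 1)).exists_bound_of_continuousOn hHc
  have hHB : ∀ z, |Ht z| ≤ max B 0 := by
    intro z
    by_cases hz : z ∈ closedBall (0:ℂ) (T - 1)
    · rw [hHt, indicator_of_mem hz]; exact le_max_of_le_left (hB z hz)
    · rw [hHt, indicator_of_notMem hz]; simp
  have hHi : Integrable Ht := by
    rw [hHt, integrable_indicator_iff measurableSet_closedBall]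
    exact hHc.integrableOn_compact (isCompact_closedBall _ _)
  set k : ℂ → ℝ := fun z => (2 * π)⁻¹ * ∫ t, Ht t * hk (Complex.normSq (z - t)) with hkdef
  have hk_smooth : ContDiff ℝ (⊤ : ℕ∞) k := by
    refine contDiff_const.mul ?_
    exact eta_compact.contDiff_convolution_right (ContinuousLinearMap.mul ℝ ℝ) (μ := volume)
      hHi.locallyIntegrable eta_contDiff
  have hnear : ∀ z ∈ ball (0:ℂ) (T - 2), closedBall z 1 ⊆ closedBall 0 (T - 1) := by
    intro z hz w hw
    rw [mem_ball, dist_zero_right] at hz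
    rw [mem_closedBall] at hw ⊢
    have := dist_triangle w z 0
    rw [dist_zero_right z] at this
    linarith
  have hkH : ∀ z ∈ ball (0:ℂ) (T - 2), k z = H z := by
    intro z hz
    have hzc : ContinuousAt Ht z := by
      have hz1 : ball (0:ℂ) (T - 2) ∈ 𝓝 z := isOpen_ball.mem_nhds hz
      have : Ht =ᶠ[𝓝 z] H := by
        filter_upwards [hz1] with x hx
        rw [hHt, indicator_of_mem]
        exact hnear x hx (mem_closedBall_self zero_le_one)
      refine ContinuousAt.congr ?_ this.symm
      exact hH.continuousAt (isOpen_ball.mem_nhds (ball_subset_ball (by linarith) hz))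
    have t1 := approx_id hHm hHB hzc
    have hHz : Ht z = H z := by
      rw [hHt, indicator_of_mem]
      exact hnear z hz (mem_closedBall_self zero_le_one)
    have hconst : ∀ n : ℕ, ∫ x, Ht x * etae (1 / ((n:ℝ) + 1)) z x = ∫ x, Ht x * etae 1 z x := by
      intro n
      set ε : ℝ := 1 / ((n:ℝ) + 1) with hε
      have e0 : 0 < ε := by positivity
      have e1 : ε ≤ 1 := by
        rw [hε, div_le_one (by positivity)]
        have : (0:ℝ) ≤ n := Nat.cast_nonneg _
        linarith
      have hsupp : tsupport (fun x => El 1 z x - El ε z x) ⊆ closedBall z 1 := by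
        refine closure_minimal ?_ isClosed_closedBall
        intro x hx
        by_contra hc
        rw [mem_closedBall, not_le, dist_eq_norm] at hc
        apply hx
        show El 1 z x - El ε z x = 0
        rw [El_eq one_pos hc.le, El_eq e0 (by linarith), sub_self]
      have hcs : HasCompactSupport (fun x => El 1 z x - El ε z x) :=
        (isCompact_closedBall z 1).of_isClosed_subset (isClosed_tsupport _) hsupp
      have hsm := (El_contDiff 1 z).sub (El_contDiff ε z)
      have h0 := hw _ hsm hcs (hsupp.trans ((hnear z hz).trans hsub))
      have h1 : ∀ x, H x * lap (fun x => El 1 z x - El ε z x) x =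
          Ht x * etae 1 z x - Ht x * etae ε z x := by
        intro x
        rw [← mul_sub, ← lap_El one_pos, ← lap_El e0, ← lap_sub (El_contDiff 1 z) (El_contDiff ε z)]
        by_cases hx : x ∈ closedBall z 1
        · rw [hHt, indicator_of_mem (hnear z hz hx)]
        · have : lap (fun x => El 1 z x - El ε z x) x = 0 := by
            by_contra hc
            exact hx (hsupp (lap_support _ (subset_tsupport _ hc)))
          rw [this]; simp
      simp_rw [h1] at h0
      have hInta : ∀ e : ℝ, 0 < e → Integrable fun x => Ht x * etae e z x := by
        intro e he
        have hcont : Continuous (etae e z) := by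
          unfold etae
          exact continuous_const.mul (hk_contDiff.continuous.comp
            ((normSq_contDiff z).continuous.div_const _))
        have hcomp : HasCompactSupport (etae e z) := by
          refine HasCompactSupport.of_support_subset_isCompact (isCompact_closedBall z e) ?_
          intro x hx
          by_contra hc
          rw [mem_closedBall, not_le, dist_eq_norm] at hc
          apply hx
          show etae e z x = 0
          rw [etae, hk_zero, mul_zero]
          rw [Complex.normSq_eq_norm_sq, lt_div_iff₀ (by positivity)]
          nlinarith
        obtain ⟨B', hB'⟩ := hcont.bounded_above_of_compact_support hcomp
        exact Integrable.mul_bdd hHi hcont.aestronglyMeasurable (Eventually.of_forall hB')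
      rw [integral_sub (hInta 1 one_pos) (hInta ε e0)] at h0
      linarith
    simp_rw [hconst] at t1
    have t2 := tendsto_nhds_unique tendsto_const_nhds t1
    have : k z = (2 * π)⁻¹ * ∫ x, Ht x * etae 1 z x := by
      rw [hkdef]
      simp only [etae_one]
      congr 2; funext t
      rw [← Complex.normSq_neg, neg_sub]
    rw [this, t2, hHz]
    field_simp
  have hlap : EqOn (lap k) (fun _ => 0) (ball 0 (T - 2)) := by
    refine Measure.eqOn_open_of_ae_eq (μ := volume) ?_ isOpen_ball (lap_contDiff hk_smooth).continuous.continuousOn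
      continuousOn_const
    rw [Filter.EventuallyEq, ae_restrict_iff' measurableSet_ball]
    refine isOpen_ball.ae_eq_zero_of_integral_contDiff_smul_eq_zero
      ((lap_contDiff hk_smooth).continuous.locallyIntegrable.locallyIntegrableOn _) ?_
    intro g hg hgc hgs
    have h1 := hw g hg hgc (hgs.trans (ball_subset_ball (by linarith)))
    have h2 : ∫ x, k x * lap g x = ∫ x, H x * lap g x := by
      congr 1; funext x
      by_cases hx : x ∈ tsupport g
      · rw [hkH x (hgs hx)]
      · have : lap g x = 0 := by
          by_contra hc
          exact hx (lap_support _ (subset_tsupport _ hc))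
        rw [this]; simp
    rw [← h1, ← h2, ibp_lap hk_smooth hg hgc]
    congr 1; funext x; rw [smul_eq_mul, mul_comm]
  have hharm : InnerProductSpace.HarmonicOnNhd k (ball 0 (T - 2)) := by
    intro x hx
    refine ⟨(hk_smooth.of_le (by norm_cast)).contDiffAt, ?_⟩
    filter_upwards [isOpen_ball.mem_nhds hx] with y hy
    rw [InnerProductSpace.laplacian_eq_iteratedFDeriv_complexPlane]
    exact hlap hy
  obtain ⟨F, hF, hF2⟩ := hharm.exists_analyticOnNhd_ball_re_eq
  exact ⟨F, hF, fun z hz => (hF2 hz).trans (hkH z hz)⟩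

/-- normalized logarithmic potential -/
def Vpot (R : ℂ → ℝ) (ν : Measure ℂ) (a z : ℂ) : ℝ := ∫ ζ, Real.log (‖z - ζ‖ / (2 * R a)) ∂ν

namespace RSetup
variable {μ : Measure ℂ} {C M : ℝ} {R : ℂ → ℝ}

lemma pot_abs (h : RSetup μ C M R) (A : ℝ) (hA : 0 ≤ A) (T : ℕ) : ∃ K : ℝ, 0 ≤ K ∧
    ∀ (a : ℂ) (ν : Measure ℂ) (n : ℕ), n ≤ T → ν ≤ μ → ν univ = n → ν (ball a (2 * R a))ᶜ = 0 →
    ∀ z, dist z a ≤ A * (2 * R a) → Integrable (fun ζ => Real.log (‖z - ζ‖ / (2 * R a))) ν ∧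
      ∫ ζ, |Real.log (‖z - ζ‖ / (2 * R a))| ∂ν ≤ K := by
  obtain ⟨k, hk⟩ := pow_unbounded_of_one_lt (4 * (A + 1)) (one_lt_two (α := ℝ))
  have hC := h.dbl.one_le
  have hM := h.oneM
  have hKl := h.dbl.Klog_nonneg
  have hlogA : 0 ≤ Real.log (A + 1) := Real.log_nonneg (by linarith)
  refine ⟨Dbl.Klog C * (C ^ k * M) + Real.log (A + 1) * T, by positivity, ?_⟩
  intro a ν n hn hle hν hsupp z hz
  have hna := h.dbl.noAtoms
  have hR := h.pos a
  have : IsFiniteMeasure ν := ⟨by rw [hν]; exact ENNReal.natCast_lt_top n⟩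
  set r : ℝ := 2 * R a with hr
  have hr0 : 0 < r := by positivity
  set S : ℝ := (A + 1) * r with hS
  have hS0 : 0 < S := by positivity
  have hae1 : ∀ᵐ ζ ∂ν, ζ ∈ ball a r := hsupp
  have hae2 : ∀ᵐ ζ ∂ν, ζ ∈ ball z S := by
    filter_upwards [hae1] with ζ hζ
    rw [mem_ball] at hζ ⊢
    have := dist_triangle ζ a z
    rw [dist_comm a z] at this
    nlinarith
  have hae3 : ∀ᵐ ζ ∂ν, ζ ≠ z := by
    rw [ae_iff]
    refine le_antisymm ((hle _).trans ?_) zero_le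
    simp
  have hli : ∫⁻ ζ, ENNReal.ofReal (Real.log (S / dist z ζ)) ∂ν ≤ ENNReal.ofReal (Dbl.Klog C * (C ^ k * M)) := by
    calc ∫⁻ ζ, ENNReal.ofReal (Real.log (S / dist z ζ)) ∂ν
        = ∫⁻ ζ in ball z S, ENNReal.ofReal (Real.log (S / dist z ζ)) ∂ν := by
          rw [Measure.restrict_eq_self_of_ae_mem hae2]
      _ ≤ ∫⁻ ζ in ball z S, ENNReal.ofReal (Real.log (S / dist z ζ)) ∂μ :=
          lintegral_mono' (Measure.restrict_mono le_rfl hle) le_rfl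
      _ ≤ _ := h.dbl.lintegral_log z hS0
      _ ≤ _ := by
          apply ENNReal.ofReal_le_ofReal
          refine mul_le_mul_of_nonneg_left ?_ hKl
          refine (h.dbl.mono ?_).trans (h.up_mul a k)
          have : 4 * (A + 1) * R a ≤ 2 ^ k * R a := by gcongr
          rw [hS, hr]; rw [hr] at hz; nlinarith
  have hmeas : Measurable fun ζ => Real.log (S / dist z ζ) := by fun_prop
  have hnn : 0 ≤ᵐ[ν] fun ζ => Real.log (S / dist z ζ) := by
    filter_upwards [hae2, hae3] with ζ h2 h3
    rw [mem_ball, dist_comm] at h2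
    exact Real.log_nonneg ((one_le_div (dist_pos.2 h3.symm)).2 h2.le)
  have hInta : Integrable (fun ζ => Real.log (S / dist z ζ)) ν := by
    refine ⟨hmeas.aestronglyMeasurable, ?_⟩
    rw [hasFiniteIntegral_iff_ofReal hnn]
    exact lt_of_le_of_lt hli ENNReal.ofReal_lt_top
  have hI : ∫ ζ, Real.log (S / dist z ζ) ∂ν ≤ Dbl.Klog C * (C ^ k * M) := by
    rw [integral_eq_lintegral_of_nonneg_ae hnn hmeas.aestronglyMeasurable]
    exact ENNReal.toReal_le_of_le_ofReal (by positivity) hli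
  have heq : (fun ζ => Real.log (‖z - ζ‖ / r)) =ᵐ[ν] fun ζ => Real.log (A + 1) - Real.log (S / dist z ζ) := by
    filter_upwards [hae3] with ζ h3
    have h0 : 0 < dist z ζ := dist_pos.2 h3.symm
    rw [← dist_eq_norm, Real.log_div h0.ne' hr0.ne', Real.log_div hS0.ne' h0.ne', hS,
      Real.log_mul (by linarith) hr0.ne']
    ring
  have hIntb : Integrable (fun ζ => Real.log (‖z - ζ‖ / r)) ν :=
    ((integrable_const _).sub hInta).congr heq.symm
  refine ⟨hIntb, ?_⟩
  calc ∫ ζ, |Real.log (‖z - ζ‖ / r)| ∂ν ≤ ∫ ζ, (Real.log (S / dist z ζ) + Real.log (A + 1)) ∂ν := by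
        refine integral_mono_ae hIntb.abs (hInta.add (integrable_const _)) ?_
        filter_upwards [heq, hnn] with ζ h1 h2
        simp only [Pi.zero_apply] at h2
        rw [h1, abs_le]
        constructor <;> linarith
    _ = ∫ ζ, Real.log (S / dist z ζ) ∂ν + Real.log (A + 1) * n := by
        rw [integral_add hInta (integrable_const _), integral_const, smul_eq_mul, mul_comm]
        simp [Measure.real, hν]
    _ ≤ _ := by
        have : (n : ℝ) ≤ T := by exact_mod_cast hn
        gcongr

lemma pot_cont (h : RSetup μ C M R) {a : ℂ} {ν : Measure ℂ} {n : ℕ} (hle : ν ≤ μ) (hν : ν univ = n)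
    (hsupp : ν (ball a (2 * R a))ᶜ = 0) : Continuous (Vpot R ν a) := by
  have : IsFiniteMeasure ν := ⟨by rw [hν]; exact ENNReal.natCast_lt_top n⟩
  have hna := h.dbl.noAtoms
  have hR := h.pos a
  set r : ℝ := 2 * R a with hr
  have hr0 : 0 < r := by positivity
  have hae1 : ∀ᵐ ζ ∂ν, ζ ∈ ball a r := hsupp
  have hae3 : ∀ z : ℂ, ∀ᵐ ζ ∂ν, ζ ≠ z := by
    intro z
    rw [ae_iff]
    refine le_antisymm ((hle _).trans ?_) zero_le
    simp
  have hfin : ∀ z, Integrable (fun ζ => Real.log (‖z - ζ‖ / r)) ν := by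
    intro z
    obtain ⟨K, _, hK⟩ := h.pot_abs (dist z a / r) (by positivity) n
    exact (hK a ν n le_rfl hle hν hsupp z (by rw [← hr]; field_simp; rfl)).1
  -- truncated integrand
  set tr : ℝ → ℂ → ℂ → ℝ := fun ε z ζ => Real.log (max ‖z - ζ‖ ε / r) with htr
  have htrc : ∀ ε, 0 < ε → ∀ ζ, Continuous fun z => tr ε z ζ := by
    intro ε he ζ
    refine Continuous.log (by fun_prop) ?_
    intro z
    have : 0 < max ‖z - ζ‖ ε := lt_max_of_lt_right he
    positivity
  have htrm : ∀ ε z, Measurable (tr ε z) := by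
    intro ε z
    exact Real.measurable_log.comp (by fun_prop)
  have htrb : ∀ ε, 0 < ε → ∀ Z z ζ, dist z a ≤ Z → ζ ∈ ball a r →
      |tr ε z ζ| ≤ |Real.log (ε / r)| + |Real.log (max (Z + r) ε / r)| := by
    intro ε he Z z ζ hz hζ
    have h1 : Real.log (ε / r) ≤ tr ε z ζ :=
      Real.log_le_log (by positivity) (by gcongr; exact le_max_right _ _)
    have h2 : tr ε z ζ ≤ Real.log (max (Z + r) ε / r) := by
      have : 0 < max ‖z - ζ‖ ε := lt_max_of_lt_right he
      refine Real.log_le_log (by positivity) ?_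
      gcongr
      rw [← dist_eq_norm]
      have := dist_triangle z a ζ
      rw [mem_ball, dist_comm] at hζ
      linarith
    have := neg_abs_le (Real.log (ε / r))
    have := le_abs_self (Real.log (max (Z + r) ε / r))
    have := abs_nonneg (Real.log (ε / r))
    have := abs_nonneg (Real.log (max (Z + r) ε / r))
    rw [abs_le]; constructor <;> linarith
  have htri : ∀ ε, 0 < ε → ∀ z, Integrable (tr ε z) ν := by
    intro ε he z
    refine Integrable.of_bound (C := |Real.log (ε / r)| + |Real.log (max (dist z a + r) ε / r)|)
      (htrm ε z).aestronglyMeasurable ?_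
    · filter_upwards [hae1] with ζ hζ using htrb ε he _ z ζ le_rfl hζ
  rw [continuous_iff_continuousAt]
  intro z0
  refine continuousAt_of_locally_uniform_approx_of_continuousAt ?_
  intro u hu
  obtain ⟨e, he, hue⟩ := Metric.mem_uniformity_dist.1 hu
  have hKl := h.dbl.Klog_nonneg
  have hth0 := h.dbl.th_nonneg
  have hth1 := h.dbl.th_lt
  have hlim : Tendsto (fun k : ℕ => Dbl.Klog C * (Dbl.th C ^ k * μ.real (ball z0 2))) atTop (𝓝 0) := by
    have := ((tendsto_pow_atTop_nhds_zero_of_lt_one hth0 hth1).mul_const (μ.real (ball z0 2))).const_mul (Dbl.Klog C)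
    simpa using this
  obtain ⟨k, hk⟩ := (hlim.eventually (gt_mem_nhds he)).exists
  set ε : ℝ := 1 / 4 ^ k with hε
  have e0 : 0 < ε := by positivity
  refine ⟨ball z0 1, ball_mem_nhds _ one_pos, fun z => ∫ ζ, tr ε z ζ ∂ν, ?_, ?_⟩
  · refine continuousAt_of_dominated (bound := fun _ => |Real.log (ε / r)| + |Real.log (max ((dist z0 a + 1) + r) ε / r)|)
      (Eventually.of_forall fun z => (htrm ε z).aestronglyMeasurable) ?_ (integrable_const _)
      (Eventually.of_forall fun ζ => (htrc ε e0 ζ).continuousAt)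
    filter_upwards [ball_mem_nhds z0 one_pos] with z hz
    filter_upwards [hae1] with ζ hζ
    refine htrb ε e0 _ z ζ ?_ hζ
    rw [mem_ball] at hz
    linarith [dist_triangle z z0 a]
  · intro z hz
    apply hue
    rw [dist_comm, Real.dist_eq, Vpot, ← integral_sub (htri ε e0 z) (hfin z)]
    have hpt : ∀ᵐ ζ ∂ν, |tr ε z ζ - Real.log (‖z - ζ‖ / r)| =
        (ball z ε).indicator (fun ζ => Real.log (ε / dist z ζ)) ζ := by
      filter_upwards [hae3 z] with ζ hζ
      have h0 : 0 < ‖z - ζ‖ := norm_pos_iff.2 (sub_ne_zero.2 hζ.symm)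
      by_cases hc : ζ ∈ ball z ε
      · rw [indicator_of_mem hc]
        rw [mem_ball, dist_comm, dist_eq_norm] at hc
        simp only [htr]
        rw [max_eq_right hc.le, dist_eq_norm, Real.log_div e0.ne' hr0.ne', Real.log_div h0.ne' hr0.ne',
          Real.log_div e0.ne' h0.ne', sub_sub_sub_cancel_right, abs_of_nonneg]
        exact sub_nonneg.2 (Real.log_le_log h0 hc.le)
      · rw [indicator_of_notMem hc]
        rw [mem_ball, dist_comm, dist_eq_norm, not_lt] at hc
        simp only [htr]
        rw [max_eq_left hc]; simp
    have hμ : Dbl.Klog C * μ.real (ball z ε) < e := by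
      refine lt_of_le_of_lt ?_ hk
      refine mul_le_mul_of_nonneg_left ?_ hKl
      refine (h.dbl.rev_iter z one_pos k).trans ?_
      refine mul_le_mul_of_nonneg_left ?_ (pow_nonneg hth0 k)
      apply h.dbl.mono
      rw [mem_ball] at hz; linarith
    refine lt_of_le_of_lt (abs_integral_le_integral_abs) (lt_of_le_of_lt ?_ hμ)
    have hmeas : Measurable fun ζ => Real.log (ε / dist z ζ) := by fun_prop
    rw [integral_congr_ae hpt, integral_indicator measurableSet_ball]
    rw [integral_eq_lintegral_of_nonneg_ae _ hmeas.aestronglyMeasurable]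
    · apply ENNReal.toReal_le_of_le_ofReal (by positivity)
      refine le_trans ?_ (h.dbl.lintegral_log z e0)
      exact lintegral_mono' (Measure.restrict_mono le_rfl hle) le_rfl
    · filter_upwards [ae_restrict_mem measurableSet_ball, ae_restrict_of_ae (hae3 z)] with ζ h2 h3
      rw [mem_ball, dist_comm] at h2
      exact Real.log_nonneg ((one_le_div (dist_pos.2 h3.symm)).2 h2.le)

end RSetup

lemma integral_lap_zero {v : ℂ → ℝ} (hv : ContDiff ℝ (⊤ : ℕ∞) v) (hc : HasCompactSupport v) :
    ∫ z, lap v z = 0 := by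
  have := ibp_lap (u := fun _ => (1:ℝ)) contDiff_const hv hc
  have h0 : ∀ x, lap (fun _ : ℂ => (1:ℝ)) x = 0 := by
    intro x; rw [lap_eq']; simp
  simpa [h0] using this

namespace RSetup
variable {μ : Measure ℂ} {C M : ℝ} {R : ℂ → ℝ}

lemma pot_lap (h : RSetup μ C M R) {a : ℂ} {ν : Measure ℂ} {n : ℕ} (hle : ν ≤ μ) (hν : ν univ = n)
    (hsupp : ν (ball a (2 * R a))ᶜ = 0) {v : ℂ → ℝ} (hv : ContDiff ℝ (⊤ : ℕ∞) v)
    (hc : HasCompactSupport v) : ∫ z, Vpot R ν a z * lap v z = 2 * π * ∫ ζ, v ζ ∂ν := by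
  have : IsFiniteMeasure ν := ⟨by rw [hν]; exact ENNReal.natCast_lt_top n⟩
  have hR := h.pos a
  have hlc := (lap_contDiff hv).continuous
  have hlk := lap_compact hc
  obtain ⟨Z, hZ⟩ := hlk.isBounded.subset_ball a
  obtain ⟨K, hK0, hK⟩ := h.pot_abs (max Z 0 / (2 * R a)) (by positivity) n
  have hK' : ∀ z, lap v z ≠ 0 → Integrable (fun ζ => Real.log (‖z - ζ‖ / (2 * R a))) ν ∧
      ∫ ζ, |Real.log (‖z - ζ‖ / (2 * R a))| ∂ν ≤ K := by
    intro z hz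
    refine hK a ν n le_rfl hle hν hsupp z ?_
    have := hZ (subset_tsupport _ hz)
    rw [mem_ball] at this
    rw [div_mul_cancel₀ _ (by positivity)]
    exact this.le.trans (le_max_left _ _)
  have hmeas : Measurable (Function.uncurry fun (z ζ : ℂ) => Real.log (‖z - ζ‖ / (2 * R a)) * lap v z) := by
    refine Measurable.mul ?_ (hlc.measurable.comp measurable_fst)
    exact Real.measurable_log.comp (by fun_prop)
  have hprod : Integrable (Function.uncurry fun (z ζ : ℂ) => Real.log (‖z - ζ‖ / (2 * R a)) * lap v z)
      (volume.prod ν) := by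
    rw [integrable_prod_iff hmeas.aestronglyMeasurable]
    constructor
    · refine Eventually.of_forall fun z => ?_
      by_cases hz : lap v z = 0
      · simp [Function.uncurry, hz]
      · exact (hK' z hz).1.mul_const (lap v z)
    · have hm2 := hmeas.norm.stronglyMeasurable.integral_prod_right' (ν := ν)
      refine Integrable.mono' (g := fun z => K * |lap v z|)
        ((hlc.integrable_of_hasCompactSupport hlk).abs.const_mul K) hm2.aestronglyMeasurable ?_
      refine Eventually.of_forall fun z => ?_
      simp only [Function.uncurry, norm_mul]
      rw [integral_mul_const, norm_mul]
      by_cases hz : lap v z = 0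
      · simp [hz]
      simp only [Real.norm_eq_abs, abs_abs]
      refine mul_le_mul_of_nonneg_right ?_ (abs_nonneg _)
      rw [abs_of_nonneg (integral_nonneg fun _ => abs_nonneg _)]
      exact (hK' z hz).2
  have h1 : ∫ z, Vpot R ν a z * lap v z = ∫ z, ∫ ζ, Real.log (‖z - ζ‖ / (2 * R a)) * lap v z ∂ν := by
    congr 1; funext z
    rw [Vpot, integral_mul_const]
  rw [h1, integral_integral_swap hprod, ← integral_const_mul]
  congr 1; funext ζ
  have h2 : ∀ᵐ z : ℂ, Real.log (‖z - ζ‖ / (2 * R a)) * lap v z =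
      Real.log ‖z - ζ‖ * lap v z - Real.log (2 * R a) * lap v z := by
    have hae : ∀ᵐ z : ℂ, z ≠ ζ := by rw [ae_iff]; simp
    filter_upwards [hae] with z hz
    rw [Real.log_div (norm_ne_zero_iff.2 (sub_ne_zero.2 hz)) (by positivity)]; ring
  rw [integral_congr_ae h2, integral_sub (integrable_log_mul ζ hlc hlk)
    ((hlc.integrable_of_hasCompactSupport hlk).const_mul _), fund_sol hv hc, integral_const_mul,
    integral_lap_zero hv hc]
  ring

end RSetup

lemma log_expand (N : ℕ) {x : ℂ} (hx : ‖x‖ ≤ 1 / 2) :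
    |Real.log ‖1 - x‖ + (∑ k ∈ Finset.range N, x ^ (k + 1) / ((k : ℂ) + 1)).re| ≤ 2 * ‖x‖ ^ (N + 1) := by
  have h1 := Complex.norm_log_sub_logTaylor_le N (z := -x) (by rw [norm_neg]; linarith)
  have h2 : Complex.logTaylor (N + 1) (-x) = - ∑ k ∈ Finset.range N, x ^ (k + 1) / ((k : ℂ) + 1) := by
    rw [Complex.logTaylor, Finset.sum_range_succ']
    simp only [Nat.cast_add, Nat.cast_one, Nat.cast_zero, div_zero, add_zero]
    rw [← Finset.sum_neg_distrib]
    refine Finset.sum_congr rfl fun k _ => ?_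
    rw [show (-x) ^ (k + 1) = (-1) ^ (k + 1) * x ^ (k + 1) by rw [← mul_pow]; simp]
    have : ((-1 : ℂ) ^ (k + 1)) * (-1) ^ (k + 1) = 1 := by rw [← mul_pow]; simp
    rw [pow_succ (-1 : ℂ) (k + 1)]
    linear_combination (-(x ^ (k + 1) / ((k : ℂ) + 1))) * this
  have h3 : Real.log ‖1 - x‖ + (∑ k ∈ Finset.range N, x ^ (k + 1) / ((k : ℂ) + 1)).re =
      (Complex.log (1 + -x) - Complex.logTaylor (N + 1) (-x)).re := by
    rw [h2, Complex.sub_re, Complex.log_re]; simp [sub_eq_add_neg]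
  rw [h3]
  refine (Complex.abs_re_le_norm _).trans (h1.trans ?_)
  rw [norm_neg]
  have h4 : (1 - ‖x‖)⁻¹ ≤ 2 := by
    rw [inv_le_comm₀ (by linarith) (by norm_num)]; linarith
  have h5 : (1:ℝ) ≤ N + 1 := by
    have : (0:ℝ) ≤ N := Nat.cast_nonneg _
    linarith
  have h6 : 0 ≤ (1 - ‖x‖)⁻¹ := inv_nonneg.2 (by linarith)
  calc ‖x‖ ^ (N + 1) * (1 - ‖x‖)⁻¹ / (N + 1) ≤ ‖x‖ ^ (N + 1) * (1 - ‖x‖)⁻¹ :=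
        div_le_self (by positivity) h5
    _ ≤ ‖x‖ ^ (N + 1) * 2 := by gcongr
    _ = _ := by ring

namespace RSetup
variable {μ : Measure ℂ} {C M : ℝ} {R : ℂ → ℝ}

/-- moments of `ν` -/
def mom (R : ℂ → ℝ) (ν : Measure ℂ) (a : ℂ) (k : ℕ) : ℂ := ∫ ζ, nrm R a ζ ^ (k + 1) ∂ν

lemma nrm_cont (R : ℂ → ℝ) (a : ℂ) : Continuous (nrm R a) := by
  unfold nrm
  exact (continuous_id.sub continuous_const).div_const _

lemma mom_aux (h : RSetup μ C M R) {a : ℂ} {ν : Measure ℂ}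
    (hsupp : ν (ball a (2 * R a))ᶜ = 0) : ∀ᵐ ζ ∂ν, ‖nrm R a ζ‖ ≤ 1 := by
  have hae1 : ∀ᵐ ζ ∂ν, ζ ∈ ball a (2 * R a) := hsupp
  have := h.pos a
  filter_upwards [hae1] with ζ hζ
  rw [h.nrm_norm, div_le_one (by positivity)]
  exact (mem_ball.1 hζ).le

lemma mom_int (h : RSetup μ C M R) {a : ℂ} {ν : Measure ℂ} {n : ℕ} (hν : ν univ = n)
    (hsupp : ν (ball a (2 * R a))ᶜ = 0) (k : ℕ) : Integrable (fun ζ => nrm R a ζ ^ (k + 1)) ν := by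
  have : IsFiniteMeasure ν := ⟨by rw [hν]; exact ENNReal.natCast_lt_top n⟩
  refine Integrable.of_bound (C := 1) ((nrm_cont R a).pow _).aestronglyMeasurable ?_
  filter_upwards [h.mom_aux hsupp] with ζ hζ
  rw [norm_pow]; exact pow_le_one₀ (norm_nonneg _) hζ

lemma mom_le (h : RSetup μ C M R) {a : ℂ} {ν : Measure ℂ} {n : ℕ} (hν : ν univ = n)
    (hsupp : ν (ball a (2 * R a))ᶜ = 0) (k : ℕ) : ‖mom R ν a k‖ ≤ n := by
  have : IsFiniteMeasure ν := ⟨by rw [hν]; exact ENNReal.natCast_lt_top n⟩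
  have := norm_integral_le_of_norm_le_const (μ := ν) (f := fun ζ => nrm R a ζ ^ (k + 1)) (C := 1) (by
    filter_upwards [h.mom_aux hsupp] with ζ hζ
    rw [norm_pow]; exact pow_le_one₀ (norm_nonneg _) hζ)
  simpa [mom, Measure.real, hν] using this

lemma pot_far (h : RSetup μ C M R) (N : ℕ) {a : ℂ} {ν : Measure ℂ} {n : ℕ} (hle : ν ≤ μ) (hν : ν univ = n)
    (hsupp : ν (ball a (2 * R a))ᶜ = 0) {z : ℂ} (hz : 2 ≤ ‖nrm R a z‖) :
    |Vpot R ν a z - (n * Real.log ‖nrm R a z‖ - (polar N (mom R ν a) (nrm R a z)).re)| ≤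
      2 * n / ‖nrm R a z‖ ^ (N + 1) := by
  have : IsFiniteMeasure ν := ⟨by rw [hν]; exact ENNReal.natCast_lt_top n⟩
  have hR := h.pos a
  set w := nrm R a z with hw
  have hw0 : w ≠ 0 := by rintro h0; rw [h0] at hz; simp at hz; linarith
  have hwp : 0 < ‖w‖ := by linarith
  have hx : ∀ᵐ ζ ∂ν, ‖nrm R a ζ / w‖ ≤ 1 / ‖w‖ := by
    filter_upwards [h.mom_aux hsupp] with ζ hζ
    rw [norm_div]; gcongr
  have hw2 : 1 / ‖w‖ ≤ 1 / 2 := by gcongr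
  have hreal : ν.real univ = n := by simp [Measure.real, hν]
  have hVint : Integrable (fun ζ => Real.log (‖z - ζ‖ / (2 * R a))) ν := by
    obtain ⟨K, _, hK⟩ := h.pot_abs (dist z a / (2 * R a)) (by positivity) n
    exact (hK a ν n le_rfl hle hν hsupp z (by field_simp; rfl)).1
  set S : ℂ → ℂ := fun ζ => ∑ k ∈ Finset.range N, (nrm R a ζ / w) ^ (k + 1) / ((k : ℂ) + 1) with hS
  have hSint : Integrable S ν := by
    refine integrable_finsetSum _ fun k _ => ?_
    simp_rw [div_pow]
    exact ((h.mom_int hν hsupp k).div_const _).div_const _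
  have hSI : ∫ ζ, S ζ ∂ν = polar N (mom R ν a) w := by
    rw [hS, integral_finsetSum _ (fun k _ => by
      simp_rw [div_pow]
      exact ((h.mom_int hν hsupp k).div_const _).div_const _)]
    rw [polar]
    refine Finset.sum_congr rfl fun k _ => ?_
    simp_rw [div_pow]
    rw [integral_div, integral_div, mom]
    field_simp
  have hre : ∫ ζ, (S ζ).re ∂ν = (polar N (mom R ν a) w).re := by
    rw [← hSI]
    exact Complex.reCLM.integral_comp_comm hSint
  have hreint : Integrable (fun ζ => (S ζ).re) ν := Complex.reCLM.integrable_comp hSint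
  have hmain : Vpot R ν a z - (n * Real.log ‖w‖ - (polar N (mom R ν a) w).re) =
      ∫ ζ, (Real.log (‖z - ζ‖ / (2 * R a)) - Real.log ‖w‖ + (S ζ).re) ∂ν := by
    have hsub : Integrable (fun ζ => Real.log (‖z - ζ‖ / (2 * R a)) - Real.log ‖w‖) ν :=
      hVint.sub (integrable_const _)
    rw [integral_add hsub hreint, integral_sub hVint (integrable_const _),
      integral_const, hreal, hre, Vpot, smul_eq_mul]
    ring
  rw [hmain]
  have hb := norm_integral_le_of_norm_le_const (μ := ν) (C := 2 / ‖w‖ ^ (N + 1))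
    (f := fun ζ => Real.log (‖z - ζ‖ / (2 * R a)) - Real.log ‖w‖ + (S ζ).re) (by
      filter_upwards [hx] with ζ hζ
      have h1 : ‖nrm R a ζ / w‖ ≤ 1 / 2 := hζ.trans hw2
      have h2 : ‖z - ζ‖ / (2 * R a) = ‖w‖ * ‖1 - nrm R a ζ / w‖ := by
        rw [← dist_eq_norm, ← h.nrm_sub, ← norm_mul, ← hw]
        congr 1; field_simp
      have h3 : ‖1 - nrm R a ζ / w‖ ≠ 0 := by
        have := norm_sub_norm_le (1:ℂ) (nrm R a ζ / w)
        rw [norm_one] at this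
        intro h0; linarith
      rw [h2, Real.log_mul hwp.ne' h3, add_sub_cancel_left]
      refine (log_expand N h1).trans ?_
      calc 2 * ‖nrm R a ζ / w‖ ^ (N + 1) ≤ 2 * (1 / ‖w‖) ^ (N + 1) := by gcongr
        _ = 2 / ‖w‖ ^ (N + 1) := by rw [one_div_pow]; ring)
  rw [hreal] at hb
  refine hb.trans (le_of_eq ?_)
  ring

end RSetup

lemma multiset_log_lap {v : ℂ → ℝ} (hv : ContDiff ℝ (⊤ : ℕ∞) v) (hc : HasCompactSupport v)
    (s : Multiset ℂ) : Integrable (fun z => (s.map fun l => Real.log ‖z - l‖).sum * lap v z) ∧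
      ∫ z, (s.map fun l => Real.log ‖z - l‖).sum * lap v z = 2 * π * (s.map v).sum := by
  induction s using Multiset.induction with
  | empty => simp
  | cons a s ih =>
    have hi := integrable_log_mul a (lap_contDiff hv).continuous (lap_compact hc)
    simp only [Multiset.map_cons, Multiset.sum_cons, add_mul]
    exact ⟨hi.add ih.1, by rw [integral_add hi ih.1, ih.2, fund_sol hv hc]; ring⟩

lemma poly_log_lap {Q : Polynomial ℂ} (hQ : Q ≠ 0) {v : ℂ → ℝ} (hv : ContDiff ℝ (⊤ : ℕ∞) v)
    (hc : HasCompactSupport v) (hz : ∀ z, Q.eval z = 0 → v z = 0) :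
    Integrable (fun z => Real.log ‖Q.eval z‖ * lap v z) ∧ ∫ z, Real.log ‖Q.eval z‖ * lap v z = 0 := by
  have hlog : ∀ z, Q.eval z ≠ 0 → Real.log ‖Q.eval z‖ =
      Real.log ‖Q.leadingCoeff‖ + (Q.roots.map fun l => Real.log ‖z - l‖).sum := by
    intro z hz
    have h1 : Q.eval z = Q.leadingCoeff * (Q.roots.map fun l => z - l).prod := by
      conv_lhs => rw [(IsAlgClosed.splits Q).eq_prod_roots]
      simp [Polynomial.eval_mul, Polynomial.eval_multiset_prod, Multiset.map_map]
    have h2 : ∀ s : Multiset ℂ, (∀ l ∈ s, z ≠ l) → Real.log ‖(s.map fun l => z - l).prod‖ =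
        (s.map fun l => Real.log ‖z - l‖).sum := by
      intro s
      induction s using Multiset.induction with
      | empty => simp
      | cons a s ih =>
        intro hs
        simp only [Multiset.map_cons, Multiset.sum_cons, Multiset.prod_cons, norm_mul]
        rw [Real.log_mul, ih fun l hl => hs l (Multiset.mem_cons_of_mem hl)]
        · exact norm_ne_zero_iff.2 (sub_ne_zero.2 (hs a (Multiset.mem_cons_self _ _)))
        · rw [norm_ne_zero_iff]
          apply Multiset.prod_ne_zero
          intro h0
          obtain ⟨l, hl, hl0⟩ := Multiset.mem_map.1 h0
          exact hs l (Multiset.mem_cons_of_mem hl) (sub_eq_zero.1 hl0)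
    have h3 : (Q.roots.map fun l => z - l).prod ≠ 0 := by
      intro h0; rw [h1, h0, mul_zero] at hz; exact hz rfl
    rw [← h2, ← Real.log_mul (by simpa using hQ) (norm_ne_zero_iff.2 h3), ← norm_mul, ← h1]
    intro l hl hzl
    rw [Polynomial.mem_roots hQ, ← hzl] at hl
    exact hz hl
  have hae : ∀ᵐ z : ℂ, Q.eval z ≠ 0 := by
    rw [ae_iff]
    have : {z | ¬ Q.eval z ≠ 0} ⊆ (Q.roots.toFinset : Set ℂ) := by
      intro z hz
      simpa [hQ] using hz
    exact measure_mono_null this ((Finset.finite_toSet _).measure_zero _)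
  obtain ⟨i1, i2⟩ := multiset_log_lap hv hc Q.roots
  have hl := (lap_contDiff hv).continuous.integrable_of_hasCompactSupport (lap_compact hc) (μ := volume)
  have heq : (fun z => Real.log ‖Q.eval z‖ * lap v z) =ᵐ[volume] fun z =>
      Real.log ‖Q.leadingCoeff‖ * lap v z + (Q.roots.map fun l => Real.log ‖z - l‖).sum * lap v z := by
    filter_upwards [hae] with z hz
    rw [hlog z hz]; ring
  refine ⟨((hl.const_mul _).add i1).congr heq.symm, ?_⟩
  rw [integral_congr_ae heq, integral_add (hl.const_mul _) i1, i2, integral_const_mul,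
    integral_lap_zero hv hc]
  have : (Q.roots.map v).sum = 0 := by
    apply Multiset.sum_eq_zero
    intro x hx
    obtain ⟨l, hl, rfl⟩ := Multiset.mem_map.1 hx
    exact hz l ((Polynomial.mem_roots hQ).1 hl)
  rw [this]; ring

/-- All the data of the construction. -/
structure Pack (μ : Measure ℂ) (C M : ℝ) (R : ℂ → ℝ) (Λ : Set ℂ) (G : Λ → Polynomial ℂ)
    (V : Λ → ℂ → ℝ) (ν : Λ → Measure ℂ) (p : ℕ) (A K δ c : ℝ) : Prop where
  rs : RSetup μ C M R
  hp : C ^ 4 ≤ 4 ^ p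
  sep : RSetup.Sep R Λ
  cov : ∀ z, ∃ a ∈ Λ, dist z a ≤ R a / 19
  A2 : 2 ≤ A
  K1 : 1 ≤ K
  d0 : 0 < δ
  c0 : 0 < c
  far : ∀ (a : Λ) (z : ℂ), A * (2 * R a) ≤ dist z a → (G a).eval z ≠ 0 ∧
    |Real.log ‖(G a).eval z‖ - V a z| ≤ K * (R a / dist z a) ^ p
  near : ∀ (a : Λ) (z : ℂ), dist z a ≤ (A + 1) * (2 * R a) → |V a z| ≤ K
  Vcont : ∀ a, Continuous (V a)
  Vlap : ∀ a, ∀ v : ℂ → ℝ, ContDiff ℝ (⊤ : ℕ∞) v → HasCompactSupport v →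
    ∫ z, V a z * lap v z = 2 * π * ∫ ζ, v ζ ∂(ν a)
  nsum : Measure.sum ν = ENNReal.ofReal (2 * π)⁻¹ • μ
  nsupp : ∀ a : Λ, ν a (ball a.1 (2 * R a))ᶜ = 0
  zero : ∀ a : Λ, (G a).eval a.1 = 0
  ne : ∀ a, G a ≠ 0
  zsep : ∀ a b : Λ, ∀ z z' : ℂ, (G a).eval z = 0 → (G b).eval z' = 0 →
    (a ≠ b ∨ z ≠ z') → δ * (R a + R b) ≤ dist z z'
  low : ∀ a : Λ, ∀ (z : ℂ) (s : ℝ), 0 ≤ s → s ≤ 1 →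
    (∀ ζ : ℂ, (G a).eval ζ = 0 → s * (2 * R a) ≤ dist z ζ) → c * s ≤ ‖(G a).eval z‖
  upp : ∀ a : Λ, ∀ z : ℂ, dist z a ≤ (A + 1) * (2 * R a) → ‖(G a).eval z‖ ≤ K
  upz : ∀ a : Λ, ∀ z ζ : ℂ, dist z a ≤ (A + 1) * (2 * R a) → (G a).eval ζ = 0 →
    ‖(G a).eval z‖ ≤ K * (dist z ζ / (2 * R a))
  znear : ∀ a : Λ, ∀ z, (G a).eval z = 0 → dist z a ≤ A * (2 * R a)

/-- the group as a polynomial -/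
def grpP (R : ℂ → ℝ) (P : Polynomial ℂ) (B a : ℂ) : Polynomial ℂ :=
  (Polynomial.C ((2 * R a : ℝ) : ℂ)⁻¹ * (Polynomial.X - Polynomial.C a)) *
    (P.comp (Polynomial.C ((2 * R a : ℝ) : ℂ)⁻¹ * (Polynomial.X - Polynomial.C a)) - Polynomial.C B)

lemma grpP_eval (R : ℂ → ℝ) (P : Polynomial ℂ) (B a z : ℂ) :
    (grpP R P B a).eval z = RSetup.grp R P B a z := by
  have : (Polynomial.C ((2 * R a : ℝ) : ℂ)⁻¹ * (Polynomial.X - Polynomial.C a)).eval z =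
      RSetup.nrm R a z := by
    rw [RSetup.nrm, Polynomial.eval_mul, Polynomial.eval_sub, Polynomial.eval_C, Polynomial.eval_X,
      Polynomial.eval_C]
    ring
  rw [grpP, RSetup.grp, Polynomial.eval_mul, Polynomial.eval_sub, Polynomial.eval_comp, this,
    Polynomial.eval_C]

lemma exists_pack {φ : ℂ → ℝ} {μ : Measure ℂ} (hφ : HasDoublingLaplacian φ μ)
    {ρ : ℂ → ℝ} (hρ : IsRadius μ ρ) (z₀ : ℂ) :
    ∃ (C M : ℝ) (R : ℂ → ℝ) (Λ : Set ℂ) (G : Λ → Polynomial ℂ)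
      (V : Λ → ℂ → ℝ) (ν : Λ → Measure ℂ) (p : ℕ) (A K δ c : ℝ),
      Pack μ C M R Λ G V ν p A K δ c ∧ z₀ ∈ Λ ∧ (∀ z, ρ z ≤ R z) ∧
      ∃ A : ℝ, 1 ≤ A ∧ ∀ z, R z ≤ A * ρ z := by
  obtain ⟨C, hd⟩ := exists_Dbl hφ hρ
  have hC := hd.one_le
  obtain ⟨N, hN⟩ := pow_unbounded_of_one_lt (C ^ 4) (by norm_num : (1:ℝ) < 4)
  set nmin := N * N + N + 3 with hnmin
  set M : ℝ := max 1 (2 * π * (nmin + 2) * C ^ 7) with hM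
  obtain ⟨R, h, hR1, hR2⟩ := exists_RSetup hd hρ M (le_max_left _ _)
  obtain ⟨Λ, hΛ, hz₀, hcov⟩ := h.exists_net z₀
  obtain ⟨ν, n, hn, hν, hsupp, hsum⟩ := h.exists_partition nmin (le_max_right _ _) hΛ hcov
  have hle : ∀ a, ν a ≤ μ := by
    intro a
    have h1 : ν a ≤ Measure.sum ν := Measure.le_sum ν a
    rw [hsum] at h1
    refine h1.trans ?_
    intro s
    rw [Measure.smul_apply, smul_eq_mul]
    have : ENNReal.ofReal (2 * π)⁻¹ ≤ 1 := by
      rw [ENNReal.ofReal_le_one]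
      apply inv_le_one_of_one_le₀
      linarith [Real.pi_gt_three]
    calc ENNReal.ofReal (2 * π)⁻¹ * μ s ≤ 1 * μ s := by gcongr
      _ = μ s := one_mul _
  have hpos := h.pos
  have hnC : ∀ a, (n a : ℝ) ≤ C * M := by
    intro a
    have h1 : ν a univ ≤ μ (ball a.1 (2 * R a)) := by
      calc ν a univ ≤ ν a (ball a.1 (2 * R a)) + ν a (ball a.1 (2 * R a))ᶜ := by
            rw [← union_compl_self (ball a.1 (2 * R a))]; exact measure_union_le _ _
        _ = ν a (ball a.1 (2 * R a)) := by rw [hsupp, add_zero]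
        _ ≤ _ := hle a _
    have h2 := ENNReal.toReal_mono (hd.fin _ _).ne h1
    rw [hν, ENNReal.toReal_natCast] at h2
    have h3 := h.up a.1
    have h4 := hd.dbl a.1 (R a) (hpos _)
    calc (n a : ℝ) ≤ μ.real (ball a.1 (2 * R a)) := h2
      _ ≤ _ := h4
      _ ≤ _ := mul_le_mul_of_nonneg_left h3 (by linarith)
  set nmax := ⌈C * M⌉₊ with hnmax
  have hnm : ∀ a, n a ≤ nmax := by
    intro a
    have : (n a : ℝ) ≤ nmax := (hnC a).trans (Nat.le_ceil _)
    exact_mod_cast this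
  obtain ⟨A, K1, hA2, hK1, hP⟩ := Ppol_asymp N nmax
  set P : Λ → Polynomial ℂ := fun a => Ppol N (n a) (RSetup.mom R (ν a) a) with hPdef
  have hPa := fun a : Λ => hP (n a) (RSetup.mom R (ν a) a) (hn a) (hnm a) (h.mom_le (hν a) (hsupp a))
  have ha0 : (⟨z₀, hz₀⟩ : Λ) = ⟨z₀, hz₀⟩ := rfl
  obtain ⟨B, δ, c, L, hδ, hc, hL, hB, hB1, hB2, hB3, hB4, hB5⟩ := h.exists_B hΛ A K1 nmax (by linarith) hK1
    (le_trans (by omega) ((hn ⟨z₀, hz₀⟩).trans (hnm _))) P (fun a => Ppol_monic (hn a))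
    (fun a => by rw [hPdef]; simp only; rw [Ppol_natDegree (hn a)]; have := hn a; omega)
    (fun a => by rw [hPdef]; simp only; rw [Ppol_natDegree (hn a)]; have := hnm a; omega)
    (fun a => (hPa a).2) (fun a => Ppol_zero (hn a)) (fun a B w hB hw => ((hPa a).1 B w hB hw).1)
  obtain ⟨K2, hK2, hpot⟩ := h.pot_abs (A + 1) (by linarith) nmax
  set K := max L (max K2 ((K1 + 2 * nmax) * 2 ^ (N + 1))) with hK
  have hKL : L ≤ K := le_max_left _ _
  have hK2' : K2 ≤ K := (le_max_left _ _).trans (le_max_right _ _)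
  have hK3 : ((K1 + 2 * nmax) * 2 ^ (N + 1)) ≤ K := (le_max_right _ _).trans (le_max_right _ _)
  have hfar : ∀ (a : Λ) (z : ℂ), A * (2 * R a) ≤ dist z a → RSetup.grp R (P a) (B a) a z ≠ 0 ∧
    |Real.log ‖RSetup.grp R (P a) (B a) a z‖ - Vpot R (ν a) a z| ≤ K * (R a / dist z a) ^ (N + 1) := by
    intro a z hz
    have hRa := hpos a
    have hw : A ≤ ‖RSetup.nrm R a z‖ := by
      rw [h.nrm_norm, le_div_iff₀ (by positivity)]; exact hz
    have hw0 : 0 < ‖RSetup.nrm R a z‖ := by linarith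
    obtain ⟨q1, q2⟩ := (hPa a).1 (B a) _ (hB a) hw
    have q3 := h.pot_far N (hle a) (hν a) (hsupp a) (hA2.trans hw)
    refine ⟨mul_ne_zero (norm_pos_iff.1 hw0) (sub_ne_zero.2 q1), ?_⟩
    rw [RSetup.grp]
    have hd0 : 0 < dist z a := lt_of_lt_of_le (by positivity) hz
    have q4 : 1 / ‖RSetup.nrm R a z‖ ^ (N + 1) = 2 ^ (N + 1) * (R a / dist z a) ^ (N + 1) := by
      rw [h.nrm_norm, ← mul_pow, ← one_div_pow]
      congr 1; field_simp
    have q5 : (n a : ℝ) ≤ nmax := by exact_mod_cast hnm a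
    calc _ ≤ K1 / ‖RSetup.nrm R a z‖ ^ (N + 1) + 2 * n a / ‖RSetup.nrm R a z‖ ^ (N + 1) := by
          rw [abs_le] at q2 q3 ⊢
          constructor <;> linarith [q2.1, q2.2, q3.1, q3.2]
      _ = (K1 + 2 * n a) * (1 / ‖RSetup.nrm R a z‖ ^ (N + 1)) := by ring
      _ ≤ (K1 + 2 * nmax) * (1 / ‖RSetup.nrm R a z‖ ^ (N + 1)) := by gcongr
      _ = ((K1 + 2 * nmax) * 2 ^ (N + 1)) * (R a / dist z a) ^ (N + 1) := by rw [q4]; ring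
      _ ≤ _ := by gcongr
  refine ⟨C, M, R, Λ, fun a => grpP R (P a) (B a) a, fun a => Vpot R (ν a) a, ν, N + 1, A, K, δ, c,
    ?_, hz₀, hR1, hR2⟩
  refine { rs := h, hp := ?_, sep := hΛ, cov := hcov, A2 := hA2, K1 := hL.trans hKL, d0 := hδ, c0 := hc,
           far := ?_, near := ?_, Vcont := fun a => h.pot_cont (hle a) (hν a) (hsupp a),
           Vlap := fun a v hv hvc => h.pot_lap (hle a) (hν a) (hsupp a) hv hvc, nsum := hsum, nsupp := hsupp,
           zero := ?_, ne := ?_, zsep := ?_, low := ?_, upp := ?_, upz := ?_, znear := ?_ }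
  · exact hN.le.trans (pow_le_pow_right₀ (by norm_num) (by omega))
  · simp only [grpP_eval]; exact hfar
  · intro a z hz
    obtain ⟨q1, q2⟩ := hpot a (ν a) (n a) (hnm a) (hle a) (hν a) (hsupp a) z hz
    exact (abs_integral_le_integral_abs).trans (q2.trans hK2')
  · intro a; simp [grpP_eval, RSetup.grp, RSetup.nrm]
  · intro a h0
    have hRa := hpos a
    refine (hfar a (a.1 + (A * (2 * R a) : ℝ)) ?_).1 ?_
    · rw [dist_eq_norm, add_sub_cancel_left, Complex.norm_real]; exact le_abs_self _
    · rw [← grpP_eval, h0, Polynomial.eval_zero]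
  · simp only [grpP_eval]; exact hB1
  · simp only [grpP_eval]; exact hB2
  · simp only [grpP_eval]; exact fun a z hz => (hB3 a z hz).trans hKL
  · simp only [grpP_eval]
    intro a z ζ hz hζ
    have hRa := hpos a
    exact (hB4 a z ζ hz hζ).trans (by gcongr)
  · simp only [grpP_eval]; exact hB5

namespace Pack
variable {μ : Measure ℂ} {C M : ℝ} {R : ℂ → ℝ} {Λ : Set ℂ} {G : Λ → Polynomial ℂ}
    {V : Λ → ℂ → ℝ} {ν : Λ → Measure ℂ} {p : ℕ} {A K δ c : ℝ}

/-- truncated defect -/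
def Dc (G : Λ → Polynomial ℂ) (V : Λ → ℂ → ℝ) (I : Finset Λ) (a : Λ) (z : ℂ) : ℝ :=
  if a ∈ I then 0 else Real.log ‖(G a).eval z‖ - V a z

/-- modulus of one factor -/
def mf (G : Λ → Polynomial ℂ) (V : Λ → ℂ → ℝ) (a : Λ) (z : ℂ) : ℝ :=
  ‖(G a).eval z‖ * Real.exp (- V a z)

/-- the regularized product -/
def EE (G : Λ → Polynomial ℂ) (V : Λ → ℂ → ℝ) (I : Finset Λ) (z : ℂ) : ℝ :=
  (∏ a ∈ I, mf G V a z) * Real.exp (∑' a, Dc G V I a z)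

/-- all groups outside `I` are far from `z` -/
def Far (R : ℂ → ℝ) (A : ℝ) (I : Finset Λ) (z : ℂ) : Prop := ∀ a : Λ, a ∉ I → A * (2 * R a) ≤ dist z a

lemma far_bound (P : Pack μ C M R Λ G V ν p A K δ c) : ∃ S : ℝ, 0 ≤ S ∧ ∀ (z : ℂ) (I : Finset Λ), Far R A I z →
    Summable (fun a : Λ => if a ∈ I then 0 else (R a / dist z a) ^ p) ∧
    ∑' a : Λ, (if a ∈ I then 0 else (R a / dist z a) ^ p) ≤ S := by
  obtain ⟨S, hS, hs⟩ := P.rs.far_sum P.hp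
  refine ⟨S, hS, fun z I hI => ?_⟩
  have hpos := P.rs.pos
  have hA := P.A2
  have h0 : ∀ a : Λ, 0 ≤ (if a ∈ I then 0 else (R a / dist z a) ^ p) := by
    intro a
    split_ifs
    · exact le_rfl
    · have := hpos a; positivity
  have hb : ∀ u : Finset Λ, ∑ a ∈ u, (if a ∈ I then 0 else (R a / dist z a) ^ p) ≤ S := by
    intro u
    have h1 := hs Λ P.sep z ((u.filter (fun a => a ∉ I)).map (Function.Embedding.subtype _)) (by
      intro a ha
      simp only [Finset.mem_map, Finset.mem_filter, Function.Embedding.subtype_apply] at ha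
      obtain ⟨b, ⟨_, hb⟩, rfl⟩ := ha
      refine ⟨b.2, le_trans ?_ (hI b hb)⟩
      have := hpos b
      nlinarith)
    rw [Finset.sum_map, Finset.sum_filter] at h1
    refine le_trans (le_of_eq ?_) h1
    refine Finset.sum_congr rfl fun a _ => ?_
    by_cases ha : a ∈ I <;> simp [ha]
  have hsm := summable_of_sum_le h0 hb
  exact ⟨hsm, hsm.tsum_le_of_sum_le hb⟩

lemma Dc_le (P : Pack μ C M R Λ G V ν p A K δ c) {I : Finset Λ} {z : ℂ} (hI : Far R A I z) (a : Λ) :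
    ‖Dc G V I a z‖ ≤ K * (if a ∈ I then 0 else (R a / dist z a) ^ p) := by
  rw [Dc]
  split_ifs with ha
  · simp
  · exact (P.far a z (hI a ha)).2

lemma Dc_summable (P : Pack μ C M R Λ G V ν p A K δ c) {I : Finset Λ} {z : ℂ} (hI : Far R A I z) :
    Summable (fun a => Dc G V I a z) := by
  obtain ⟨S, _, hS⟩ := P.far_bound
  exact Summable.of_norm_bounded ((hS z I hI).1.mul_left K) (P.Dc_le hI)

lemma Dc_bound (P : Pack μ C M R Λ G V ν p A K δ c) : ∃ S : ℝ, 0 ≤ S ∧ ∀ (z : ℂ) (I : Finset Λ), Far R A I z →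
    |∑' a, Dc G V I a z| ≤ S := by
  obtain ⟨S, hS0, hS⟩ := P.far_bound
  have hK := P.K1
  refine ⟨K * S, by positivity, fun z I hI => ?_⟩
  refine (tsum_of_norm_bounded ((hS z I hI).1.mul_left K).hasSum (P.Dc_le hI)).trans ?_
  rw [tsum_mul_left]
  exact mul_le_mul_of_nonneg_left (hS z I hI).2 (by linarith)

lemma mf_eq {a : Λ} {z : ℂ} (h : (G a).eval z ≠ 0) :
    mf G V a z = Real.exp (Real.log ‖(G a).eval z‖ - V a z) := by
  rw [mf, sub_eq_add_neg, Real.exp_add, Real.exp_log (norm_pos_iff.2 h)]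

lemma EE_mono (P : Pack μ C M R Λ G V ν p A K δ c) {I J : Finset Λ} {z : ℂ} (hI : Far R A I z)
    (hIJ : I ⊆ J) : EE G V J z = EE G V I z := by
  have hJ : Far R A J z := fun a ha => hI a fun h => ha (hIJ h)
  have h1 : (fun a => Dc G V I a z) = fun a => Dc G V J a z +
      (if a ∈ J \ I then Real.log ‖(G a).eval z‖ - V a z else 0) := by
    ext a
    simp only [Dc, Finset.mem_sdiff]
    by_cases h1 : a ∈ I
    · simp [h1, hIJ h1]
    · by_cases h2 : a ∈ J <;> simp [h1, h2]
  have hs2 : Summable (fun a => if a ∈ J \ I then Real.log ‖(G a).eval z‖ - V a z else 0) :=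
    summable_of_ne_finset_zero (s := J \ I) (fun a ha => if_neg ha)
  have h2 : ∑' a, Dc G V I a z = ∑' a, Dc G V J a z + ∑ a ∈ J \ I, (Real.log ‖(G a).eval z‖ - V a z) := by
    rw [h1, (P.Dc_summable hJ).tsum_add hs2, tsum_eq_sum (s := J \ I) (fun a ha => if_neg ha)]
    congr 1
    exact Finset.sum_congr rfl fun a ha => if_pos ha
  have h3 : ∏ a ∈ J \ I, mf G V a z = Real.exp (∑ a ∈ J \ I, (Real.log ‖(G a).eval z‖ - V a z)) := by
    rw [Real.exp_sum]
    refine Finset.prod_congr rfl fun a ha => mf_eq ?_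
    exact (P.far a z (hI a (Finset.mem_sdiff.1 ha).2)).1
  rw [EE, EE, h2, Real.exp_add, ← h3, ← Finset.prod_sdiff hIJ]
  ring

lemma EE_indep (P : Pack μ C M R Λ G V ν p A K δ c) {I J : Finset Λ} {z : ℂ} (hI : Far R A I z)
    (hJ : Far R A J z) : EE G V J z = EE G V I z := by
  rw [← P.EE_mono hI (Finset.subset_union_left (s₂ := J)), ← P.EE_mono hJ Finset.subset_union_right]

/-- a finite set good on a whole disk -/
lemma exists_I (P : Pack μ C M R Λ G V ν p A K δ c) (T : ℝ) : ∃ I : Finset Λ, ∀ a ∉ I,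
    2 * T < dist 0 a.1 ∧ 4 * A * R a < dist 0 a.1 := by
  obtain ⟨K', hK'1, hK'⟩ := P.rs.comp (4 * A)
  have hpos := P.rs.pos
  have hA := P.A2
  have hfin : {a : Λ | dist 0 a.1 ≤ 2 * T ∨ dist 0 a.1 ≤ 4 * A * R a}.Finite := by
    refine Set.Finite.of_finite_image (f := Subtype.val)
      ((P.rs.finite_ball P.sep 0 (max (2 * T) (4 * A * (K' * R 0)))).subset ?_) Subtype.val_injective.injOn
    rintro _ ⟨a, ha, rfl⟩
    refine ⟨a.2, ?_⟩
    rw [dist_comm]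
    rcases ha with ha | ha
    · exact ha.trans (le_max_left _ _)
    · refine le_trans ?_ (le_max_right _ _)
      refine ha.trans ?_
      exact mul_le_mul_of_nonneg_left (hK' 0 a ha) (by linarith)
  refine ⟨hfin.toFinset, fun a ha => ?_⟩
  simp only [Finite.mem_toFinset, mem_ofPred_eq, not_or, not_le] at ha
  exact ha

end Pack

namespace Pack
variable {μ : Measure ℂ} {C M : ℝ} {R : ℂ → ℝ} {Λ : Set ℂ} {G : Λ → Polynomial ℂ}
    {V : Λ → ℂ → ℝ} {ν : Λ → Measure ℂ} {p : ℕ} {A K δ c : ℝ}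

lemma int_v (P : Pack μ C M R Λ G V ν p A K δ c) {v : ℂ → ℝ} (hv : Continuous v) (hc : HasCompactSupport v)
    {I : Finset Λ} (h0 : ∀ a ∉ I, ∫ ζ, v ζ ∂(ν a) = 0) :
    ∫ z, v z ∂μ = 2 * π * ∑ a ∈ I, ∫ ζ, v ζ ∂(ν a) := by
  have hpi := Real.pi_pos
  have : IsFiniteMeasureOnCompacts μ := ⟨fun s hs => by
    obtain ⟨r, hr⟩ := hs.isBounded.subset_ball 0
    exact (measure_mono hr).trans_lt (P.rs.dbl.fin 0 r)⟩
  have hi : Integrable v μ := hv.integrable_of_hasCompactSupport hc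
  have hi2 : Integrable v (Measure.sum ν) := by
    rw [P.nsum]; exact hi.smul_measure ENNReal.ofReal_ne_top
  have h1 := integral_sum_measure hi2
  rw [tsum_eq_sum (s := I) h0, P.nsum, integral_smul_measure, ENNReal.toReal_ofReal (by positivity),
    smul_eq_mul] at h1
  rw [← h1]; field_simp

lemma weak (P : Pack μ C M R Λ G V ν p A K δ c) {φ : ℂ → ℝ} (hφ : HasDoublingLaplacian φ μ) {T : ℝ}
    {I : Finset Λ} (hF : ∀ z ∈ ball (0:ℂ) T, Far R A I z) (u : Λ → ℝ) (hu : Summable u)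
    (hDu : ∀ a, ∀ z ∈ ball (0:ℂ) T, ‖Dc G V I a z‖ ≤ u a)
    (hSc : ContinuousOn (fun z => ∑' a, Dc G V I a z) (ball 0 T))
    {v : ℂ → ℝ} (hv : ContDiff ℝ (⊤ : ℕ∞) v) (hc : HasCompactSupport v) (hvT : tsupport v ⊆ ball 0 T) :
    ∫ z, (φ z - ∑ a ∈ I, V a z + ∑' a, Dc G V I a z) * lap v z = 0 := by
  have hlc := (lap_contDiff hv).continuous
  have hlk := lap_compact hc
  have hA := P.A2
  have hpos := P.rs.pos
  have hcount : Countable Λ := (P.rs.countable P.sep).to_subtype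
  have hlv : ∀ z, lap v z ≠ 0 → z ∈ ball (0:ℂ) T := fun z hz =>
    hvT (lap_support v (subset_tsupport _ hz))
  have hli : Integrable (lap v) := hlc.integrable_of_hasCompactSupport hlk
  have hVi : ∀ a, Integrable (fun z => V a z * lap v z) := fun a =>
    ((P.Vcont a).mul hlc).integrable_of_hasCompactSupport hlk.mul_left
  have hφi : Integrable (fun z => φ z * lap v z) :=
    (hφ.continuous.mul hlc).integrable_of_hasCompactSupport hlk.mul_left
  have hνv : ∀ a ∉ I, ∫ ζ, v ζ ∂(ν a) = 0 := by
    intro a ha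
    apply integral_eq_zero_of_ae
    have hae : ∀ᵐ ζ ∂(ν a), ζ ∈ ball a.1 (2 * R a) := P.nsupp a
    filter_upwards [hae] with ζ hζ
    by_contra hne
    have h1 := hvT (subset_tsupport _ hne)
    have h2 := hF ζ h1 a ha
    have := hpos a
    rw [mem_ball] at hζ
    nlinarith
  have hGi : ∀ a ∉ I, Integrable (fun z => Real.log ‖(G a).eval z‖ * lap v z) ∧
      ∫ z, Real.log ‖(G a).eval z‖ * lap v z = 0 := by
    intro a ha
    refine poly_log_lap (P.ne a) hv hc fun z hz => ?_
    by_contra hne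
    exact (P.far a z (hF z (hvT (subset_tsupport _ hne)) a ha)).1 hz
  have hDi : ∀ a, Integrable (fun z => Dc G V I a z * lap v z) ∧ ∫ z, Dc G V I a z * lap v z = 0 := by
    intro a
    by_cases ha : a ∈ I
    · simp [Dc, ha]
    · simp only [Dc, ha, if_false, sub_mul]
      refine ⟨(hGi a ha).1.sub (hVi a), ?_⟩
      rw [integral_sub (hGi a ha).1 (hVi a), (hGi a ha).2, P.Vlap a v hv hc, hνv a ha]; simp
  have hsum := hasSum_integral_of_summable_integral_norm (F := fun a z => Dc G V I a z * lap v z)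
    (fun a => (hDi a).1) (by
      refine Summable.of_nonneg_of_le (fun a => by positivity) (fun a => ?_)
        (hu.mul_right (∫ z, ‖lap v z‖))
      rw [← integral_const_mul]
      refine integral_mono (hDi a).1.norm (hli.norm.const_mul _) fun z => ?_
      simp only [norm_mul]
      by_cases hz : lap v z = 0
      · simp [hz]
      · exact mul_le_mul_of_nonneg_right (hDu a z (hlv z hz)) (norm_nonneg _))
  have hS0 : ∫ z, (∑' a, Dc G V I a z) * lap v z = 0 := by
    have h1 := hsum.tsum_eq
    simp only [(hDi _).2, tsum_zero] at h1
    simp only [tsum_mul_right] at h1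
    exact h1.symm
  have hSi : Integrable (fun z => (∑' a, Dc G V I a z) * lap v z) := by
    have h1 : tsupport (fun z => (∑' a, Dc G V I a z) * lap v z) ⊆ tsupport (lap v) :=
      closure_mono fun z hz => right_ne_zero_of_mul hz
    have h2 : Continuous (fun z => (∑' a, Dc G V I a z) * lap v z) :=
      (hSc.mul hlc.continuousOn).continuous_of_tsupport_subset isOpen_ball
        (h1.trans ((lap_support v).trans hvT))
    exact h2.integrable_of_hasCompactSupport hlk.mul_left
  have hsplit : (fun z => (φ z - ∑ a ∈ I, V a z + ∑' a, Dc G V I a z) * lap v z) =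
      fun z => (φ z * lap v z - ∑ a ∈ I, V a z * lap v z) + (∑' a, Dc G V I a z) * lap v z := by
    ext z; rw [add_mul, sub_mul, Finset.sum_mul]
  have hVs : Integrable (fun z => ∑ a ∈ I, V a z * lap v z) := integrable_finsetSum _ fun a _ => hVi a
  have h1 : Integrable (fun z => φ z * lap v z - ∑ a ∈ I, V a z * lap v z) := hφi.sub hVs
  rw [hsplit, integral_add h1 hSi, hS0, integral_sub hφi hVs, integral_finsetSum _ fun a _ => hVi a,
    hφ.lap_eq v hv hc, P.int_v hv.continuous hc hνv, Finset.mul_sum,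
    Finset.sum_congr rfl fun a _ => P.Vlap a v hv hc]
  simp

lemma exists_local (P : Pack μ C M R Λ G V ν p A K δ c) {φ : ℂ → ℝ} (hφ : HasDoublingLaplacian φ μ)
    (T : ℝ) (hT : 0 < T) : ∃ I : Finset Λ, (∀ z ∈ ball (0:ℂ) T, Far R A I z) ∧
      ∃ g : ℂ → ℂ, AnalyticOnNhd ℂ g (ball 0 T) ∧
        ∀ z ∈ ball (0:ℂ) T, ‖g z‖ = Real.exp (φ z) * EE G V I z := by
  have hA := P.A2
  have hK := P.K1
  have hpos := P.rs.pos
  obtain ⟨I, hI⟩ := P.exists_I (T + 2)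
  have hhalf : ∀ z ∈ ball (0:ℂ) (T + 2), ∀ a : Λ, a ∉ I → dist 0 a.1 / 2 ≤ dist z a := by
    intro z hz a ha
    have h1 := (hI a ha).1
    have h2 := dist_triangle 0 z a.1
    rw [mem_ball, dist_comm] at hz
    linarith
  have hF : ∀ z ∈ ball (0:ℂ) (T + 2), Far R A I z := by
    intro z hz a ha
    have := hhalf z hz a ha
    have := (hI a ha).2
    linarith
  set u : Λ → ℝ := fun a => K * 2 ^ p * (if a ∈ I then 0 else (R a / dist 0 a.1) ^ p) with hu
  have hus : Summable u := by
    obtain ⟨S, _, hS⟩ := P.far_bound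
    exact (hS 0 I (hF 0 (mem_ball_self (by linarith)))).1.mul_left _
  have hDu : ∀ a, ∀ z ∈ ball (0:ℂ) (T + 2), ‖Dc G V I a z‖ ≤ u a := by
    intro a z hz
    refine (P.Dc_le (hF z hz) a).trans ?_
    rw [hu]
    simp only
    split_ifs with ha
    · simp
    · have h1 := hhalf z hz a ha
      have h2 := (hI a ha).1
      have h3 := hpos a
      have h4 : 0 < dist 0 a.1 := by linarith
      rw [mul_assoc, ← mul_pow]
      have h5 : R a / dist z a ≤ 2 * (R a / dist 0 a.1) := by
        calc R a / dist z a ≤ R a / (dist 0 a.1 / 2) := by gcongr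
          _ = _ := by field_simp
      gcongr
  have hSc : ContinuousOn (fun z => ∑' a, Dc G V I a z) (ball 0 (T + 2)) := by
    refine continuousOn_tsum (fun a => ?_) hus hDu
    by_cases ha : a ∈ I
    · have : Dc G V I a = fun _ => 0 := by ext z; simp [Dc, ha]
      rw [this]; exact continuousOn_const
    · have : Dc G V I a = fun z => Real.log ‖(G a).eval z‖ - V a z := by ext z; simp [Dc, ha]
      rw [this]
      refine ContinuousOn.sub ?_ (P.Vcont a).continuousOn
      refine ContinuousOn.log ((G a).continuous.norm.continuousOn) fun z hz => ?_
      exact norm_ne_zero_iff.2 (P.far a z (hF z hz a ha)).1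
  have hcont : ContinuousOn (fun z => φ z - ∑ a ∈ I, V a z + ∑' a, Dc G V I a z) (ball 0 (T + 2)) := by
    refine ContinuousOn.add ?_ ?_
    · exact (hφ.continuous.sub (continuous_finsetSum _ fun a _ => P.Vcont a)).continuousOn
    · exact hSc
  obtain ⟨F, hFa, hFre⟩ := weyl hcont (fun v hv hc hvT => P.weak hφ hF u hus hDu hSc hv hc hvT)
  rw [show T + 2 - 2 = T by ring] at hFa hFre
  have hsub : ball (0:ℂ) T ⊆ ball 0 (T + 2) := ball_subset_ball (by linarith)
  refine ⟨I, fun z hz => hF z (hsub hz), fun z => Complex.exp (F z) * ∏ a ∈ I, (G a).eval z, ?_, ?_⟩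
  · intro z hz
    refine (hFa z hz).cexp.mul ?_
    have : Differentiable ℂ (fun z => ∏ a ∈ I, (G a).eval z) := by
      have : (fun z => ∏ a ∈ I, (G a).eval z) = fun z => (∏ a ∈ I, G a).eval z := by
        ext z; rw [Polynomial.eval_prod]
      rw [this]; exact Polynomial.differentiable _
    exact this.analyticAt z
  · intro z hz
    rw [norm_mul, Complex.norm_exp, hFre z hz, norm_prod, EE, Real.exp_add, sub_eq_add_neg, Real.exp_add,
      ← Finset.sum_neg_distrib, Real.exp_sum]
    simp only [mf]
    rw [Finset.prod_mul_distrib]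
    ring

end Pack

lemma norm_eq_unique {T : ℝ} {f g : ℂ → ℂ} (hf : AnalyticOnNhd ℂ f (ball 0 T))
    (hg : AnalyticOnNhd ℂ g (ball 0 T)) (hfg : ∀ z ∈ ball (0:ℂ) T, ‖f z‖ = ‖g z‖) {b : ℂ}
    (hb : b ∈ ball (0:ℂ) T) (h0 : f b ≠ 0) (hbb : f b = g b) : EqOn f g (ball 0 T) := by
  refine hf.eqOn_of_preconnected_of_eventuallyEq hg (convex_ball _ _).isPreconnected hb ?_
  have hg0 : g b ≠ 0 := hbb ▸ h0
  have hne : ∀ᶠ z in 𝓝 b, g z ≠ 0 := (hg b hb).continuousAt.eventually_ne hg0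
  have hin : ∀ᶠ z in 𝓝 b, z ∈ ball (0:ℂ) T := isOpen_ball.mem_nhds hb
  have hd : ∀ᶠ z in 𝓝 b, DifferentiableAt ℂ (fun z => f z / g z) z := by
    filter_upwards [hne, hin] with z h1 h2
    exact (hf z h2).differentiableAt.div (hg z h2).differentiableAt h1
  have hn : ∀ᶠ z in 𝓝 b, ‖f z / g z‖ = 1 := by
    filter_upwards [hne, hin] with z h1 h2
    rw [norm_div, hfg z h2, div_self (norm_ne_zero_iff.2 h1)]
  have hmax : IsLocalMax (norm ∘ fun z => f z / g z) b := by
    filter_upwards [hn] with z hz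
    simp only [Function.comp]
    rw [hz, hn.self_of_nhds]
  filter_upwards [Complex.eventually_eq_of_isLocalMax_norm hd hmax, hne] with z h1 h2
  rw [hbb, div_self hg0, div_eq_one_iff_eq h2] at h1
  exact h1

namespace Pack
variable {μ : Measure ℂ} {C M : ℝ} {R : ℂ → ℝ} {Λ : Set ℂ} {G : Λ → Polynomial ℂ}
    {V : Λ → ℂ → ℝ} {ν : Λ → Measure ℂ} {p : ℕ} {A K δ c : ℝ}

lemma EE_eq_zero {I : Finset Λ} {z : ℂ} :
    EE G V I z = 0 ↔ ∃ a ∈ I, (G a).eval z = 0 := by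
  rw [EE, mul_eq_zero, Finset.prod_eq_zero_iff]
  simp [mf, Real.exp_ne_zero]

lemma exists_entire (P : Pack μ C M R Λ G V ν p A K δ c) {φ : ℂ → ℝ} (hφ : HasDoublingLaplacian φ μ) :
    ∃ g : ℂ → ℂ, Differentiable ℂ g ∧ ∀ z, ∃ I : Finset Λ, Far R A I z ∧
      ‖g z‖ = Real.exp (φ z) * EE G V I z := by
  have hcount : Countable Λ := (P.rs.countable P.sep).to_subtype
  obtain ⟨b, hb⟩ : ∃ b, ∀ a, (G a).eval b ≠ 0 := by
    by_contra hcon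
    push Not at hcon
    have h1 : (⋃ a, ((G a).roots.toFinset : Set ℂ)) = univ := by
      ext z
      obtain ⟨a, ha⟩ := hcon z
      simp only [mem_iUnion, mem_univ, iff_true]
      exact ⟨a, by simpa [P.ne a] using ha⟩
    have h2 : (univ : Set ℂ).Countable := by
      rw [← h1]
      exact countable_iUnion fun a => (Finset.countable_toSet _)
    exact not_countable_complex h2
  have hTp : ∀ n : ℕ, 0 < ‖b‖ + n + 1 := fun n => by positivity
  choose I hI g₀ hg₀a hg₀n using fun n : ℕ => P.exists_local hφ (‖b‖ + n + 1) (hTp n)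
  set T : ℕ → ℝ := fun n => ‖b‖ + n + 1 with hT
  have hTm : ∀ n m : ℕ, n ≤ m → ball (0:ℂ) (T n) ⊆ ball 0 (T m) := by
    intro n m hnm
    apply ball_subset_ball
    have : (n : ℝ) ≤ m := by exact_mod_cast hnm
    simp only [hT]; linarith
  have hbT : ∀ n, b ∈ ball (0:ℂ) (T n) := by
    intro n
    rw [mem_ball_zero_iff]; simp only [hT]
    have : (0:ℝ) ≤ n := Nat.cast_nonneg _
    linarith
  have hEEb : ∀ n, EE G V (I n) b ≠ 0 := by
    intro n h0
    obtain ⟨a, _, ha⟩ := EE_eq_zero.1 h0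
    exact hb a ha
  have hg₀b : ∀ n, g₀ n b ≠ 0 := by
    intro n
    rw [← norm_ne_zero_iff, hg₀n n b (hbT n)]
    exact mul_ne_zero (Real.exp_ne_zero _) (hEEb n)
  have hnn : ∀ n m : ℕ, ∀ z ∈ ball (0:ℂ) (T n), z ∈ ball (0:ℂ) (T m) → ‖g₀ n z‖ = ‖g₀ m z‖ := by
    intro n m z h1 h2
    rw [hg₀n n z h1, hg₀n m z h2, P.EE_indep (hI m z h2) (hI n z h1)]
  set g₁ : ℕ → ℂ → ℂ := fun n z => g₀ 0 b / g₀ n b * g₀ n z with hg₁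
  have hg₁n : ∀ n z, ‖g₁ n z‖ = ‖g₀ n z‖ := by
    intro n z
    rw [hg₁, norm_mul, norm_div, hnn 0 n b (hbT _) (hbT _), div_self (norm_ne_zero_iff.2 (hg₀b n)), one_mul]
  have hg₁a : ∀ n, AnalyticOnNhd ℂ (g₁ n) (ball 0 (T n)) := fun n z hz =>
    analyticAt_const.mul (hg₀a n z hz)
  have hg₁b : ∀ n, g₁ n b = g₀ 0 b := fun n => by
    rw [hg₁]; simp only; rw [div_mul_cancel₀ _ (hg₀b n)]
  have hcons : ∀ n m, n ≤ m → EqOn (g₁ n) (g₁ m) (ball 0 (T n)) := by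
    intro n m hnm
    refine norm_eq_unique (hg₁a n) (fun z hz => hg₁a m z (hTm n m hnm hz)) ?_ (hbT n) ?_ ?_
    · intro z hz
      rw [hg₁n, hg₁n, hnn n m z hz (hTm n m hnm hz)]
    · rw [hg₁b]; exact hg₀b 0
    · rw [hg₁b, hg₁b]
  have hzT : ∀ z : ℂ, z ∈ ball (0:ℂ) (T ⌈‖z‖⌉₊) := by
    intro z
    rw [mem_ball_zero_iff]; simp only [hT]
    have := Nat.le_ceil ‖z‖
    have := norm_nonneg b
    linarith
  refine ⟨fun z => g₁ ⌈‖z‖⌉₊ z, ?_, ?_⟩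
  · intro z
    have h1 : (fun w => g₁ ⌈‖w‖⌉₊ w) =ᶠ[𝓝 z] g₁ ⌈‖z‖⌉₊ := by
      filter_upwards [isOpen_ball.mem_nhds (hzT z)] with w hw
      rcases le_total ⌈‖w‖⌉₊ ⌈‖z‖⌉₊ with hle | hle
      · exact hcons _ _ hle (hzT w)
      · exact (hcons _ _ hle hw).symm
    exact (hg₁a _ z (hzT z)).differentiableAt.congr_of_eventuallyEq h1
  · intro z
    exact ⟨I ⌈‖z‖⌉₊, hI _ z (hzT z), by rw [hg₁n, hg₀n _ z (hzT z)]⟩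

end Pack

lemma prod_low {ι : Type*} (F : Finset ι) (m : ι → ℝ) (bad : ι → Prop) (q τ : ℝ) (J : ℕ) (hq : 0 < q)
    (hq1 : q ≤ 1) (ht : 0 ≤ τ) (ht1 : τ ≤ 1) (hF : F.card ≤ J)
    (hbad : ∀ a ∈ F, ∀ b ∈ F, bad a → bad b → a = b) (h1 : ∀ a ∈ F, ¬ bad a → q ≤ m a)
    (h2 : ∀ a ∈ F, τ ≤ m a) : τ * q ^ J ≤ ∏ a ∈ F, m a := by
  have key : ∀ E : Finset ι, E ⊆ F → (∀ a ∈ E, ¬ bad a) → q ^ J ≤ ∏ a ∈ E, m a := by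
    intro E hE hb
    calc q ^ J ≤ q ^ E.card := pow_le_pow_of_le_one hq.le hq1 ((Finset.card_le_card hE).trans hF)
      _ = ∏ _a ∈ E, q := by rw [Finset.prod_const]
      _ ≤ _ := Finset.prod_le_prod (fun _ _ => hq.le) fun a ha => h1 a (hE ha) (hb a ha)
  by_cases hex : ∃ a ∈ F, bad a
  · obtain ⟨a, ha, hba⟩ := hex
    rw [← Finset.mul_prod_erase F m ha]
    have h3 := key (F.erase a) (Finset.erase_subset _ _) (fun b hb hbb => by
      rw [Finset.mem_erase] at hb
      exact hb.1 (hbad b hb.2 a ha hbb hba))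
    exact mul_le_mul (h2 a ha) h3 (by positivity) (ht.trans (h2 a ha))
  · push Not at hex
    have h3 := key F (Finset.Subset.refl _) hex
    calc τ * q ^ J ≤ 1 * q ^ J := by gcongr
      _ ≤ _ := by rw [one_mul]; exact h3

namespace Pack
variable {μ : Measure ℂ} {C M : ℝ} {R : ℂ → ℝ} {Λ : Set ℂ} {G : Λ → Polynomial ℂ}
    {V : Λ → ℂ → ℝ} {ν : Λ → Measure ℂ} {p : ℕ} {A K δ c : ℝ}

lemma exists_near (P : Pack μ C M R Λ G V ν p A K δ c) : ∃ (K' : ℝ) (J : ℕ), 1 ≤ K' ∧ ∀ z : ℂ,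
    ∃ F : Finset Λ, F.card ≤ J ∧ Far R A F z ∧ (∀ a : Λ, a ∈ F ↔ dist z a ≤ (A + 1) * (2 * R a) ∧
      R a ≤ K' * R z) ∧ ∀ a : Λ, dist z a ≤ (A + 1) * (2 * R a) → a ∈ F := by
  obtain ⟨K', hK'1, hK'⟩ := P.rs.comp ((A + 1) * 2)
  have hA := P.A2
  have hpos := P.rs.pos
  have hK'' : ∀ (z : ℂ) (a : Λ), dist z a ≤ (A + 1) * (2 * R a) → R a ≤ K' * R z := fun z a h =>
    hK' z a (by linarith)
  obtain ⟨J, hJ⟩ := P.rs.card_unif ((A + 1) * 2 * K')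
  refine ⟨K', J, hK'1, fun z => ?_⟩
  have hd : ∀ a : Λ, dist z a ≤ (A + 1) * (2 * R a) → dist a.1 z ≤ (A + 1) * 2 * K' * R z := by
    intro a ha
    rw [dist_comm]
    have := hK'' z a ha
    refine ha.trans ?_
    have h1 : (A + 1) * 2 * R a ≤ (A + 1) * 2 * (K' * R z) :=
      mul_le_mul_of_nonneg_left this (by linarith)
    linarith
  have hfin : {a : Λ | dist z a ≤ (A + 1) * (2 * R a)}.Finite := by
    refine Set.Finite.of_finite_image (f := Subtype.val)
      ((P.rs.finite_ball P.sep z ((A + 1) * 2 * K' * R z)).subset ?_) Subtype.val_injective.injOn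
    rintro _ ⟨a, ha, rfl⟩
    exact ⟨a.2, hd a ha⟩
  have hm : ∀ a, a ∈ hfin.toFinset ↔ dist z a ≤ (A + 1) * (2 * R a) := by
    intro a; simp
  refine ⟨hfin.toFinset, ?_, ?_, ?_, fun a ha => (hm a).2 ha⟩
  · have := hJ Λ P.sep z (hfin.toFinset.map (Function.Embedding.subtype _)) (by
      intro a ha
      simp only [Finset.mem_map, Function.Embedding.subtype_apply] at ha
      obtain ⟨b, hb, rfl⟩ := ha
      exact ⟨b.2, hd b ((hm b).1 hb)⟩)
    rwa [Finset.card_map] at this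
  · intro a ha
    rw [hm, not_le] at ha
    have := hpos a
    nlinarith
  · intro a
    rw [hm]
    exact ⟨fun h => ⟨h, hK'' z a h⟩, fun h => h.1⟩

lemma estimates (P : Pack μ C M R Λ G V ν p A K δ c) {φ : ℂ → ℝ} {g : ℂ → ℂ}
    (hg : ∀ z, ∃ I : Finset Λ, Far R A I z ∧ ‖g z‖ = Real.exp (φ z) * EE G V I z) :
    ∃ k L : ℝ, 0 < k ∧ 0 < L ∧ (∀ z, g z = 0 ↔ ∃ a, (G a).eval z = 0) ∧
      (∀ z, ‖g z‖ ≤ L * Real.exp (φ z)) ∧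
      (∀ z w, g w = 0 → ‖g z‖ ≤ L * Real.exp (φ z) * (dist z w / R z)) ∧
      (∀ z s, 0 ≤ s → s ≤ 1 → (∀ w, g w = 0 → s * R z ≤ dist z w) → k * s * Real.exp (φ z) ≤ ‖g z‖) := by
  have hA := P.A2
  have hK := P.K1
  have hpos := P.rs.pos
  have hδ := P.d0
  have hc := P.c0
  obtain ⟨K', J, hK'1, hnear⟩ := P.exists_near
  obtain ⟨S, hS0, hS⟩ := P.Dc_bound
  choose F hFc hFF hFm hFm' using hnear
  have hgF : ∀ z, ‖g z‖ = Real.exp (φ z) * EE G V (F z) z := by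
    intro z
    obtain ⟨I, hI, h⟩ := hg z
    rw [h, P.EE_indep hI (hFF z)]
  have hg0 : ∀ z, g z = 0 ↔ ∃ a, (G a).eval z = 0 := by
    intro z
    rw [← norm_eq_zero, hgF, mul_eq_zero, or_iff_right (Real.exp_ne_zero _), EE_eq_zero]
    constructor
    · rintro ⟨a, _, ha⟩; exact ⟨a, ha⟩
    · rintro ⟨a, ha⟩
      refine ⟨a, ?_, ha⟩
      by_contra hn
      exact (P.far a z (hFF z a hn)).1 ha
  have hV : ∀ z, ∀ a ∈ F z, |V a z| ≤ K := fun z a ha => P.near a z ((hFm z a).1 ha).1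
  have hmf0 : ∀ z a, 0 ≤ mf G V a z := fun z a => by rw [mf]; positivity
  set U := K * Real.exp K with hU
  have hU1 : 1 ≤ U := by
    have : 1 ≤ Real.exp K := Real.one_le_exp (by linarith)
    rw [hU]; nlinarith
  have hmfU : ∀ z, ∀ a ∈ F z, mf G V a z ≤ U := by
    intro z a ha
    rw [mf, hU]
    have h1 := P.upp a z ((hFm z a).1 ha).1
    have h2 := (abs_le.1 (hV z a ha)).1
    exact mul_le_mul h1 (Real.exp_le_exp.2 (by linarith)) (Real.exp_pos _).le (by linarith)
  have hES' : ∀ z, Real.exp (-S) ≤ Real.exp (∑' a, Dc G V (F z) a z) := fun z =>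
    Real.exp_le_exp.2 (abs_le.1 (hS z _ (hFF z))).1
  have hprodU : ∀ z, ∀ E ⊆ F z, ∏ a ∈ E, mf G V a z ≤ U ^ J := by
    intro z E hE
    calc ∏ a ∈ E, mf G V a z ≤ ∏ _a ∈ E, U := Finset.prod_le_prod (fun a _ => hmf0 z a) fun a ha => hmfU z a (hE ha)
      _ = U ^ E.card := by rw [Finset.prod_const]
      _ ≤ U ^ J := pow_le_pow_right₀ hU1 ((Finset.card_le_card hE).trans (hFc z))
  set L := U ^ J * Real.exp S * (U * (3 + 2 * A)) with hL
  have hUJ : 0 < U ^ J := by positivity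
  have hup1 : ∀ z, ‖g z‖ ≤ Real.exp (φ z) * (U ^ J * Real.exp S) := by
    intro z
    rw [hgF, EE]
    gcongr
    · exact hprodU z _ (Finset.Subset.refl _)
    · exact (abs_le.1 (hS z _ (hFF z))).2
  have hUA : 1 ≤ U * (3 + 2 * A) := by nlinarith
  have hRz : ∀ z, ∀ a ∈ F z, R z ≤ (3 + 2 * A) * R a := by
    intro z a ha
    have h1 := P.rs.lip z a
    have h2 := ((hFm z a).1 ha).1
    linarith
  set δ' := δ / (2 * (3 + 2 * A)) with hδ'
  have hδ'0 : 0 < δ' := by positivity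
  set q := min 1 (Real.exp (-K) * (c * min 1 (δ' / (2 * K')))) with hq
  have hm0 : 0 < min 1 (δ' / (2 * K')) := lt_min one_pos (by positivity)
  have hq0 : 0 < q := lt_min one_pos (by positivity)
  set τ := min 1 (Real.exp (-K) * (c / (2 * K'))) with hτ
  have hτ0 : 0 < τ := lt_min one_pos (by positivity)
  refine ⟨Real.exp (-S) * (τ * q ^ J), L, by positivity, by positivity, hg0, ?_, ?_, ?_⟩
  · intro z
    refine (hup1 z).trans ?_
    rw [hL, mul_comm]
    have : U ^ J * Real.exp S * 1 ≤ U ^ J * Real.exp S * (U * (3 + 2 * A)) := by gcongr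
    exact mul_le_mul_of_nonneg_right (by linarith) (Real.exp_pos _).le
  · intro z w hw
    obtain ⟨a, ha⟩ := (hg0 w).1 hw
    have hRzp := hpos z
    have hRap := hpos a
    by_cases hF : a ∈ F z
    · rw [hgF, EE, ← Finset.mul_prod_erase _ _ hF]
      have h1 := hprodU z _ (Finset.erase_subset a (F z))
      have h2 : mf G V a z ≤ U * (3 + 2 * A) * (dist z w / R z) := by
        rw [mf, hU]
        have h3 := P.upz a z w ((hFm z a).1 hF).1 ha
        have h4 := (abs_le.1 (hV z a hF)).1
        have h5 : dist z w / (2 * R a) ≤ (3 + 2 * A) * (dist z w / R z) := by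
          rw [div_le_iff₀ (by positivity)]
          have h6 := hRz z a hF
          calc dist z w = dist z w / R z * R z := by field_simp
            _ ≤ dist z w / R z * ((3 + 2 * A) * (2 * R a)) := by
                gcongr
                nlinarith
            _ = _ := by ring
        calc ‖(G a).eval z‖ * Real.exp (-V a z) ≤ (K * ((3 + 2 * A) * (dist z w / R z))) * Real.exp K := by
              gcongr
              · exact h3.trans (by gcongr)
              · linarith
          _ = _ := by ring
      have hmp : 0 ≤ ∏ a ∈ (F z).erase a, mf G V a z := Finset.prod_nonneg fun b _ => hmf0 z b
      calc _ ≤ Real.exp (φ z) * ((U * (3 + 2 * A) * (dist z w / R z)) * U ^ J * Real.exp S) := by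
            gcongr
            exact (abs_le.1 (hS z _ (hFF z))).2
        _ = _ := by rw [hL]; ring
    · have h1 : ¬ dist z a ≤ (A + 1) * (2 * R a) := by
        exact fun h => hF (hFm' z a h)
      rw [not_le] at h1
      have h2 := P.znear a w ha
      have h3 := P.rs.lip z a
      have h4 := dist_triangle z w a
      have h5 : 1 ≤ (3 + 2 * A) * (dist z w / R z) := by
        rw [← mul_div_assoc, one_le_div hRzp]
        nlinarith
      calc ‖g z‖ ≤ Real.exp (φ z) * (U ^ J * Real.exp S) * 1 * 1 := by simpa using hup1 z
        _ ≤ Real.exp (φ z) * (U ^ J * Real.exp S) * U * ((3 + 2 * A) * (dist z w / R z)) := by gcongr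
        _ = _ := by rw [hL]; ring
  · intro z s hs0 hs1 hs
    have hRzp := hpos z
    have hzero : ∀ (a : Λ) ζ, (G a).eval ζ = 0 → s * R z ≤ dist z ζ := fun a ζ h => hs ζ ((hg0 ζ).2 ⟨a, h⟩)
    have hmflow : ∀ a ∈ F z, ∀ r : ℝ, 0 ≤ r → r / (2 * K') ≤ 1 → (∀ ζ, (G a).eval ζ = 0 → r * R z ≤ dist z ζ) →
        Real.exp (-K) * (c * (r / (2 * K'))) ≤ mf G V a z := by
      intro a ha r hr hr1 hz
      have h1 := P.low a z (r / (2 * K')) (by positivity) hr1 (fun ζ hζ => by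
        refine le_trans ?_ (hz ζ hζ)
        have h2 := ((hFm z a).1 ha).2
        calc r / (2 * K') * (2 * R a) = r / K' * R a := by field_simp
          _ ≤ r / K' * (K' * R z) := by gcongr
          _ = r * R z := by field_simp)
      have h3 := (abs_le.1 (hV z a ha)).2
      rw [mf, mul_comm]
      exact mul_le_mul h1 (Real.exp_le_exp.2 (by linarith)) (Real.exp_pos _).le (norm_nonneg _)
    have hpl := prod_low (F z) (fun a => mf G V a z) (fun a => ∃ ζ, (G a).eval ζ = 0 ∧ dist z ζ < δ' * R z)
      q (τ * s) J hq0 (min_le_left _ _) (by positivity)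
      (by have := min_le_left 1 (Real.exp (-K) * (c / (2 * K'))); nlinarith) (hFc z) (by
        rintro a ha b hb ⟨ζ, hζ, hζd⟩ ⟨ζ', hζ', hζ'd⟩
        by_contra hab
        have h1 := P.zsep a b ζ ζ' hζ hζ' (Or.inl hab)
        have h2 := dist_triangle_left ζ ζ' z
        have h3 := hRz z a ha
        have h4 := hRz z b hb
        have h5 : 2 * (3 + 2 * A) * δ' = δ := by rw [hδ']; field_simp
        have h6 : dist ζ ζ' < 2 * δ' * R z := by linarith
        have h7 : 2 * δ' * R z ≤ 2 * δ' * ((3 + 2 * A) * R a) := by gcongr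
        have h8 : 2 * δ' * ((3 + 2 * A) * R a) = δ * R a := by rw [← h5]; ring
        have h9 : 0 < δ * R b := mul_pos hδ (hpos b)
        rw [mul_add] at h1
        linarith) (by
        intro a ha hb
        push Not at hb
        refine (min_le_right _ _).trans ?_
        have := hmflow a ha (min 1 (δ' / (2 * K')) * (2 * K')) (by positivity)
          (by rw [mul_div_cancel_right₀ _ (by positivity)]; exact min_le_left _ _) (fun ζ hζ => by
            refine le_trans ?_ (hb ζ hζ)
            gcongr
            calc min 1 (δ' / (2 * K')) * (2 * K') ≤ δ' / (2 * K') * (2 * K') := by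
                  gcongr; exact min_le_right _ _
              _ = δ' := by field_simp)
        rwa [mul_div_cancel_right₀ _ (by positivity)] at this) (by
        intro a ha
        have := hmflow a ha s hs0 (by rw [div_le_one (by positivity)]; linarith) (hzero a)
        refine le_trans ?_ this
        calc τ * s ≤ (Real.exp (-K) * (c / (2 * K'))) * s := by gcongr; exact min_le_right _ _
          _ = _ := by ring)
    rw [hgF, EE]
    calc Real.exp (-S) * (τ * q ^ J) * s * Real.exp (φ z)
        = Real.exp (φ z) * ((τ * s * q ^ J) * Real.exp (-S)) := by ring
      _ ≤ _ := by
          refine mul_le_mul_of_nonneg_left ?_ (Real.exp_pos _).le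
          exact mul_le_mul hpl (hES' z) (Real.exp_pos _).le (Finset.prod_nonneg fun b _ => hmf0 z b)

end Pack

lemma path_bdd {ρ : ℂ → ℝ} (hpos : ∀ z, 0 < ρ z) (z ζ : ℂ) :
    ∀ L ∈ { L : ℝ | ∃ γ : ℝ → ℂ, γ 0 = z ∧ γ 1 = ζ ∧ ContDiff ℝ 1 γ ∧
    L = ∫ t in (0:ℝ)..1, ‖deriv γ t‖ / ρ (γ t) }, 0 ≤ L := by
  rintro L ⟨γ, _, _, _, rfl⟩
  refine intervalIntegral.integral_nonneg zero_le_one fun t _ => ?_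
  have := hpos (γ t)
  positivity

lemma path_up {ρ : ℂ → ℝ} (hc : Continuous ρ) (hpos : ∀ z, 0 < ρ z) {z ζ : ℂ} {m : ℝ} (hm : 0 < m)
    (h : ∀ w, dist w z ≤ dist ζ z → dist w ζ ≤ dist ζ z → m ≤ ρ w) : pathDist ρ z ζ ≤ dist ζ z / m := by
  set γ : ℝ → ℂ := fun t => z + (t : ℂ) * (ζ - z) with hγ
  have hγd : ∀ t, HasDerivAt γ (ζ - z) t := by
    intro t
    have := ((Complex.ofRealCLM.hasDerivAt (x := t)).mul_const (ζ - z)).const_add z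
    rw [hγ]
    simpa only [Complex.ofRealCLM_apply, Complex.ofReal_one, one_mul] using this
  have hγC : ContDiff ℝ 1 γ := contDiff_const.add (Complex.ofRealCLM.contDiff.mul contDiff_const)
  have hmem : (∫ t in (0:ℝ)..1, ‖deriv γ t‖ / ρ (γ t)) ∈ { L : ℝ | ∃ γ : ℝ → ℂ, γ 0 = z ∧ γ 1 = ζ ∧ ContDiff ℝ 1 γ ∧
      L = ∫ t in (0:ℝ)..1, ‖deriv γ t‖ / ρ (γ t) } := ⟨γ, by simp [hγ], by simp [hγ], hγC, rfl⟩
  refine (csInf_le ⟨0, fun L hL => path_bdd hpos z ζ L hL⟩ hmem).trans ?_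
  have hd : ∀ t, deriv γ t = ζ - z := fun t => (hγd t).deriv
  simp only [hd]
  calc ∫ t in (0:ℝ)..1, ‖ζ - z‖ / ρ (γ t) ≤ ∫ t in (0:ℝ)..1, dist ζ z / m := by
        refine intervalIntegral.integral_mono_on zero_le_one ?_ ?_ fun t ht => ?_
        · refine Continuous.intervalIntegrable ?_ _ _
          exact continuous_const.div (hc.comp hγC.continuous) fun t => (hpos _).ne'
        · exact continuous_const.intervalIntegrable _ _
        · have h1 : dist (γ t) z ≤ dist ζ z := by
            rw [dist_eq_norm, dist_eq_norm, hγ]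
            simp only [add_sub_cancel_left, norm_mul, Complex.norm_real, Real.norm_of_nonneg ht.1]
            exact mul_le_of_le_one_left (norm_nonneg _) ht.2
          have h2 : dist (γ t) ζ ≤ dist ζ z := by
            rw [dist_eq_norm, dist_eq_norm, hγ]
            have : z + (t:ℂ) * (ζ - z) - ζ = (((t - 1 : ℝ)) : ℂ) * (ζ - z) := by push_cast; ring
            simp only [this, norm_mul, Complex.norm_real]
            apply mul_le_of_le_one_left (norm_nonneg _)
            rw [Real.norm_eq_abs, abs_le]
            constructor <;> linarith [ht.1, ht.2]
          rw [← dist_eq_norm]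
          have := h _ h1 h2
          gcongr
    _ = dist ζ z / m := by simp

lemma path_low {ρ : ℂ → ℝ} (hc : Continuous ρ) (hpos : ∀ z, 0 < ρ z)
    (hlip : ∀ z w, ρ z ≤ ρ w + dist z w) (z ζ : ℂ) :
    min 1 (dist z ζ / ρ z) / 2 ≤ pathDist ρ z ζ := by
  have hne : { L : ℝ | ∃ γ : ℝ → ℂ, γ 0 = z ∧ γ 1 = ζ ∧ ContDiff ℝ 1 γ ∧
    L = ∫ t in (0:ℝ)..1, ‖deriv γ t‖ / ρ (γ t) }.Nonempty := by
    refine ⟨_, fun t => z + (t : ℂ) * (ζ - z), by simp, by simp, ?_, rfl⟩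
    exact contDiff_const.add (Complex.ofRealCLM.contDiff.mul contDiff_const)
  refine le_csInf hne ?_
  rintro L ⟨γ, h0, h1, hγ, rfl⟩
  have hρz := hpos z
  set r := min (ρ z) (dist z ζ) with hr
  have hr' : min 1 (dist z ζ / ρ z) / 2 = r / (2 * ρ z) := by
    have e : min 1 (dist z ζ / ρ z) = r / ρ z := by
      rw [hr, ← min_div_div_right hρz.le, div_self hρz.ne']
    rw [e]; field_simp
  rw [hr']
  have hcomp : IsCompact {t ∈ Icc (0:ℝ) 1 | r ≤ dist (γ t) z} := by
    refine isCompact_Icc.inter_right ?_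
    exact isClosed_le continuous_const (hγ.continuous.dist continuous_const)
  obtain ⟨T, ⟨⟨hT0, hT1⟩, hTr⟩, hTmin⟩ := hcomp.exists_isLeast ⟨1, ⟨zero_le_one, le_rfl⟩, by
    rw [h1, dist_comm]; exact min_le_right _ _⟩
  have hdc : Continuous (deriv γ) := hγ.continuous_deriv le_rfl
  have hcont : Continuous (fun t => ‖deriv γ t‖ / ρ (γ t)) :=
    hdc.norm.div (hc.comp hγ.continuous) fun t => (hpos _).ne'
  have hftc : ∫ t in (0:ℝ)..T, deriv γ t = γ T - γ 0 :=
    intervalIntegral.integral_deriv_eq_sub (fun t _ => (hγ.differentiable one_ne_zero) t)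
      (hdc.intervalIntegrable _ _)
  have hle : ∀ t ∈ Ioo 0 T, ‖deriv γ t‖ ≤ 2 * ρ z * (‖deriv γ t‖ / ρ (γ t)) := by
    intro t ht
    have hd : dist (γ t) z ≤ ρ z := by
      by_contra hcon
      rw [not_le] at hcon
      have := hTmin ⟨⟨ht.1.le, ht.2.le.trans hT1⟩, (min_le_left _ _).trans hcon.le⟩
      linarith [ht.2]
    have h3 := hlip (γ t) z
    have h4 := hpos (γ t)
    rw [← mul_div_assoc, le_div_iff₀ h4, mul_comm]
    exact mul_le_mul_of_nonneg_right (by linarith) (norm_nonneg _)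
  have hfin : r ≤ 2 * ρ z * ∫ t in (0:ℝ)..1, ‖deriv γ t‖ / ρ (γ t) := by
    calc r ≤ ‖γ T - γ 0‖ := by rw [h0, ← dist_eq_norm]; exact hTr
      _ = ‖∫ t in (0:ℝ)..T, deriv γ t‖ := by rw [hftc]
      _ ≤ ∫ t in (0:ℝ)..T, ‖deriv γ t‖ := intervalIntegral.norm_integral_le_integral_norm hT0
      _ ≤ ∫ t in (0:ℝ)..T, 2 * ρ z * (‖deriv γ t‖ / ρ (γ t)) :=
          intervalIntegral.integral_mono_on_of_le_Ioo hT0 (hdc.norm.intervalIntegrable _ _)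
            ((continuous_const.mul hcont).intervalIntegrable _ _) hle
      _ = 2 * ρ z * ∫ t in (0:ℝ)..T, ‖deriv γ t‖ / ρ (γ t) := by
          rw [intervalIntegral.integral_const_mul]
      _ ≤ _ := by
          refine mul_le_mul_of_nonneg_left ?_ (by positivity)
          refine intervalIntegral.integral_mono_interval le_rfl hT0 hT1 ?_ (hcont.intervalIntegrable _ _)
          refine Eventually.of_forall fun t => ?_
          have := hpos (γ t)
          simp only [Pi.zero_apply]
          positivity
  rw [div_le_iff₀ (by positivity)]
  linarith

/-- Existence of a multiplier: an entire function `g`, vanishing at any prescribed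
point, whose zero set is `ρ_φ`-separated and relatively dense, and with
`|g(z)| ≍ e^{φ(z)} d_φ(z, Z(g))`. -/
theorem multiplier_exists
    (φ : ℂ → ℝ) (μ : Measure ℂ) (hφ : HasDoublingLaplacian φ μ)
    (ρ : ℂ → ℝ) (hρ : IsRadius μ ρ) :
    ∀ z₀ : ℂ, ∃ g : ℂ → ℂ, Differentiable ℂ g ∧ g z₀ = 0 ∧
      RhoSeparated ρ {w : ℂ | g w = 0} ∧
      (∃ M : ℝ, ∀ z : ℂ, pathDistSet ρ z {w : ℂ | g w = 0} ≤ M) ∧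
      (∃ c : ℝ, 0 < c ∧ ∀ z : ℂ,
        c * (Real.exp (φ z) * pathDistSet ρ z {w : ℂ | g w = 0}) ≤ ‖g z‖ ∧
        ‖g z‖ ≤
          c⁻¹ * (Real.exp (φ z) * pathDistSet ρ z {w : ℂ | g w = 0})) := by
  intro z₀
  obtain ⟨C, M, R, Λ, G, V, ν, p, A, K, δ, c, P, hz₀, hρR, A', hA'1, hRρ⟩ := exists_pack hφ hρ z₀
  obtain ⟨g, hgd, hg⟩ := P.exists_entire hφ
  obtain ⟨k, L, hk, hL, hg0, hup1, hup2, hlow⟩ := P.estimates hg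
  have hpos := P.rs.pos
  have hA := P.A2
  have hδ := P.d0
  have hρpos : ∀ z, 0 < ρ z := fun z => (hρ z).1
  have hlip : ∀ z w, ρ z ≤ ρ w + dist z w := radius_lip P.rs.dbl hρ
  have hρc : Continuous ρ := by
    have : LipschitzWith 1 ρ := LipschitzWith.of_le_add fun x y => hlip x y
    exact this.continuous
  have hza : ∀ a : Λ, g a.1 = 0 := fun a => (hg0 _).2 ⟨a, P.zero a⟩
  have hnon : ∀ z w, 0 ≤ pathDist ρ z w := fun z w =>
    Real.sInf_nonneg (path_bdd hρpos z w)
  set Z : Set ℂ := {w : ℂ | g w = 0} with hZ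
  have hne : Nonempty Z := ⟨⟨z₀, hza ⟨z₀, hz₀⟩⟩⟩
  have hle : ∀ z, ∀ w, g w = 0 → pathDistSet ρ z Z ≤ pathDist ρ z w := by
    intro z w hw
    exact ciInf_le (f := fun l : Z => pathDist ρ z l.1) ⟨0, by rintro _ ⟨l, rfl⟩; exact hnon _ _⟩ ⟨w, hw⟩
  have hd0 : ∀ z, 0 ≤ pathDistSet ρ z Z := fun z => le_ciInf fun l => hnon _ _
  have hbd : ∀ z, pathDistSet ρ z Z ≤ A' := by
    intro z
    obtain ⟨a, ha, hza'⟩ := P.cov z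
    have hRa := hpos a
    refine (hle z a (hza ⟨a, ha⟩)).trans ?_
    refine (path_up hρc hρpos (m := R a / (2 * A')) (by positivity) ?_).trans ?_
    · intro w _ hw
      rw [dist_comm a z] at hw
      have h1 := P.rs.lip a w
      have h2 := hRρ w
      rw [dist_comm] at hw
      rw [div_le_iff₀ (by positivity)]
      nlinarith
    · rw [dist_comm, div_div_eq_mul_div, div_le_iff₀ hRa]
      nlinarith
  refine ⟨g, hgd, hza ⟨z₀, hz₀⟩, ?_, ⟨A', hbd⟩, ?_⟩
  · refine ⟨δ / (1 + 2 * A), by positivity, ?_⟩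
    intro l hl l' hl' hll
    obtain ⟨a, ha⟩ := (hg0 l).1 hl
    obtain ⟨b, hb⟩ := (hg0 l').1 hl'
    have h1 := P.zsep a b l l' ha hb (Or.inr hll)
    have hRa := hpos a
    have hRb := hpos b
    have h2 : ∀ (a : Λ) l, (G a).eval l = 0 → ρ l ≤ (1 + 2 * A) * R a := by
      intro a l hl
      have := P.znear a l hl
      have := P.rs.lip l a
      have := hρR l
      linarith
    have h3 : max (ρ l) (ρ l') ≤ (1 + 2 * A) * (R a + R b) := by
      refine max_le ((h2 a l ha).trans ?_) ((h2 b l' hb).trans ?_) <;> nlinarith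
    calc δ / (1 + 2 * A) * max (ρ l) (ρ l') ≤ δ / (1 + 2 * A) * ((1 + 2 * A) * (R a + R b)) := by gcongr
      _ = δ * (R a + R b) := by field_simp
      _ ≤ _ := h1
  · have hdef : 0 < k / (2 * A' * A') := by positivity
    refine ⟨min (k / (2 * A' * A')) (2 * L)⁻¹, lt_min hdef (by positivity), fun z => ⟨?_, ?_⟩⟩
    · set d := pathDistSet ρ z Z with hd
      have hdz : 0 ≤ d := hd0 z
      have hdA : d ≤ A' := hbd z
      set s := d / (2 * A' * A') with hs
      have hs0 : 0 ≤ s := by positivity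
      have hsA : s * (2 * A' * A') = d := by rw [hs]; field_simp
      have hs2 : 2 * A' * s ≤ 1 := by
        have : 2 * A' * s = d / A' := by rw [hs]; field_simp
        rw [this, div_le_one (by positivity)]; exact hdA
      have hs1 : s ≤ 1 := by nlinarith
      have hs3 : 2 * A' * s ≤ d := by nlinarith
      have h1 := hlow z s hs0 hs1 (by
        intro w hw
        by_contra hcon
        rw [not_le] at hcon
        have hρz := hρpos z
        have h2 : dist z w < s * A' * ρ z := by
          refine hcon.trans_le ?_
          rw [mul_assoc]
          exact mul_le_mul_of_nonneg_left (hRρ z) hs0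
        have h3 : dist z w ≤ ρ z / 2 := by nlinarith
        have h4 := path_up hρc hρpos (z := z) (ζ := w) (m := ρ z / 2) (by positivity) (by
          intro y hy _
          have := hlip z y
          rw [dist_comm w z] at hy
          rw [dist_comm] at hy
          linarith)
        have h5 := hle z w hw
        have h6 : dist w z / (ρ z / 2) < 2 * A' * s := by
          rw [div_lt_iff₀ (by positivity), dist_comm]
          linarith
        linarith)
      refine le_trans ?_ h1
      calc min (k / (2 * A' * A')) (2 * L)⁻¹ * (Real.exp (φ z) * d)
          ≤ k / (2 * A' * A') * (Real.exp (φ z) * d) := by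
            gcongr; exact min_le_left _ _
        _ = k * s * Real.exp (φ z) := by rw [hs]; field_simp
    · have hE := Real.exp_pos (φ z)
      have h1 : ‖g z‖ / (2 * L * Real.exp (φ z)) ≤ pathDistSet ρ z Z := by
        refine le_ciInf fun l => ?_
        refine le_trans ?_ (path_low hρc hρpos hlip z l.1)
        have hρz := hρpos z
        rw [div_le_iff₀ (by positivity)]
        have h2 : ‖g z‖ ≤ L * Real.exp (φ z) * (dist z l.1 / ρ z) := by
          refine (hup2 z l.1 l.2).trans ?_
          have := hρR z
          gcongr
        have h3 := hup1 z
        have h4 : ‖g z‖ ≤ L * Real.exp (φ z) * min 1 (dist z l.1 / ρ z) := by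
          rcases min_choice 1 (dist z l.1 / ρ z) with h | h <;> rw [h]
          · rw [mul_one]; exact h3
          · exact h2
        linarith
      rw [div_le_iff₀ (by positivity)] at h1
      have h2 : 2 * L ≤ (min (k / (2 * A' * A')) (2 * L)⁻¹)⁻¹ := by
        rw [le_inv_comm₀ (by positivity) (lt_min hdef (by positivity))]
        exact min_le_right _ _
      calc ‖g z‖ ≤ 2 * L * (Real.exp (φ z) * pathDistSet ρ z Z) := by linarith
        _ ≤ _ := mul_le_mul_of_nonneg_right h2 (mul_nonneg hE.le (hd0 z))

end
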